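/- There exist ordinals α < β < γ such that α and γ are OTM-clockable but β is not; i.e., there are gaps in the OTM-clockable ordinals. -/

import Mathlib

open Ordinal

noncomputable section

/-- liminf at `α` of an ordinal-indexed sequence of ordinals:
the sup over `γ < α` of the inf of the values on `[γ, α)`. -/
noncomputable def liminfAt (α : Ordinal.{0}) (p : Ordinal.{0} → Ordinal.{0}) : Ordinal :=
  ⨆ γ : Set.Iio α, sInf (p '' {i | γ.1 ≤ i ∧ i < α})

/-- liminf at `α` of a `Bool`-valued sequence (with `false < true`):
`true` iff the value is eventually `true` before `α`. -/
noncomputable def boolLiminfAt (α : Ordinal.{0}) (b : Ordinal.{0} → Bool) : Bool :=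
  open scoped Classical in
  if (∃ γ < α, ∀ i, γ ≤ i → i < α → b i = true) then true else false

/-- liminf at `α` of a `ℕ`-valued sequence, with the convention that an
unbounded sequence has liminf `0` (reset/overflow rule). -/
noncomputable def natLiminfAt (α : Ordinal.{0}) (s : Ordinal.{0} → ℕ) : ℕ :=
  (liminfAt α (fun i => (s i : Ordinal))).card.toNat

open scoped Classical in
/-- Moving a head one step to the left: predecessor at successors, `0` at `0` and at limits. -/
noncomputable def leftOf (o : Ordinal.{0}) : Ordinal :=
  if h : ∃ p, o = p + 1 then Classical.choose h else 0

/-- A program for an Ordinal Turing Machine (Koepke), with finitely many tapes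
(of proper-class length) and finitely many states.  `trans` maps the current state
and the symbols read by the heads either to `none` (halt) or to a new state, the
symbols to be written, and for each tape the direction of head movement
(`true` = right, `false` = left). -/
structure OTMProgram where
  tapes : ℕ
  states : ℕ
  trans : Fin (states + 1) → (Fin tapes → Bool) →
    Option (Fin (states + 1) × (Fin tapes → Bool) × (Fin tapes → Bool))

/-- A configuration of an OTM: inner state, head positions and tape contents. -/
structure OTMConfig (P : OTMProgram) where
  state : Fin (P.states + 1)
  head : Fin P.tapes → Ordinal.{0}
  tape : Fin P.tapes → Ordinal.{0} → Bool

namespace OTMProgram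

variable (P : OTMProgram)

/-- The symbols currently read by the heads. -/
def readSymbols (c : OTMConfig P) : Fin P.tapes → Bool :=
  fun t => c.tape t (c.head t)

/-- One computation step; a halted configuration stays unchanged. -/
noncomputable def stepConfig (c : OTMConfig P) : OTMConfig P :=
  match P.trans c.state (P.readSymbols c) with
  | none => c
  | some (s', w, mv) =>
      { state := s'
        head := fun t => if mv t then c.head t + 1 else leftOf (c.head t)
        tape := fun t i => if i = c.head t then w t else c.tape t i }

/-- The configuration at a limit time, determined by the liminf rules for the
state, the head positions and the cell contents. -/
noncomputable def limitConfig (lam : Ordinal.{0}) (g : ∀ β, β < lam → OTMConfig P) :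
    OTMConfig P :=
  { state := ⟨natLiminfAt lam
        (fun i => if h : i < lam then ((g i h).state : ℕ) else 0) % (P.states + 1),
      Nat.mod_lt _ (Nat.succ_pos _)⟩
    head := fun t => liminfAt lam (fun i => if h : i < lam then (g i h).head t else 0)
    tape := fun t j =>
      boolLiminfAt lam (fun i => if h : i < lam then (g i h).tape t j else false) }

/-- The initial configuration: state `0`, all heads on cell `0`, empty tapes. -/
def initConfig : OTMConfig P :=
  { state := ⟨0, Nat.succ_pos _⟩, head := fun _ => 0, tape := fun _ _ => false }

/-- The run of an OTM-program (on empty input, without parameters):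
the configuration at each ordinal time. -/
noncomputable def run (o : Ordinal.{0}) : OTMConfig P :=
  Ordinal.limitRecOn o P.initConfig (fun _ ih => P.stepConfig ih)
    (fun lam _ ih => P.limitConfig lam ih)

/-- The machine is in a halting configuration at time `τ`. -/
def haltedAt (τ : Ordinal.{0}) : Prop :=
  P.trans (P.run τ).state (P.readSymbols (P.run τ)) = none

/-- The machine halts exactly at time `τ`. -/
def haltsAt (τ : Ordinal.{0}) : Prop :=
  P.haltedAt τ ∧ ∀ σ < τ, ¬ P.haltedAt σ

end OTMProgram

/-- An ordinal `α` is OTM-clockable iff some OTM-program halts at time `α + 1`. -/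
def OTMClockable (α : Ordinal.{0}) : Prop :=
  ∃ P : OTMProgram, P.haltsAt (α + 1)

/-- `α` is closed under ordinal exponentiation. -/
def ExpClosed (α : Ordinal.{0}) : Prop :=
  ∀ β < α, ∀ γ < α, β ^ γ < α


namespace GapU
open Order

/-! ### Basic facts about liminfs -/

theorem le_liminfAt {α γ x : Ordinal.{0}} {p : Ordinal.{0} → Ordinal.{0}} (hγ : γ < α)
    (h : ∀ i, γ ≤ i → i < α → x ≤ p i) : x ≤ liminfAt α p := by
  refine le_trans ?_ (Ordinal.le_iSup
    (fun γ : Set.Iio α => sInf (p '' {i | γ.1 ≤ i ∧ i < α})) ⟨γ, hγ⟩)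
  refine le_csInf ⟨p γ, γ, ⟨le_rfl, hγ⟩, rfl⟩ ?_
  rintro _ ⟨i, ⟨h1, h2⟩, rfl⟩
  exact h i h1 h2

theorem liminfAt_le {α x : Ordinal.{0}} {p : Ordinal.{0} → Ordinal.{0}}
    (h : ∀ γ < α, ∃ i, γ ≤ i ∧ i < α ∧ p i ≤ x) : liminfAt α p ≤ x := by
  refine Ordinal.iSup_le ?_
  rintro ⟨γ, hγ⟩
  obtain ⟨i, h1, h2, h3⟩ := h γ hγ
  exact le_trans (csInf_le' ⟨i, ⟨h1, h2⟩, rfl⟩) h3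

theorem lt_liminfAt_iff {α x : Ordinal.{0}} {p : Ordinal.{0} → Ordinal.{0}} :
    x < liminfAt α p ↔ ∃ γ < α, ∀ i, γ ≤ i → i < α → x < p i := by
  constructor
  · intro h
    by_contra hc
    push Not at hc
    exact absurd (liminfAt_le hc) (not_le.2 h)
  · rintro ⟨γ, hγ, h⟩
    exact lt_of_lt_of_le (lt_add_one x)
      (le_liminfAt hγ fun i h1 h2 => Order.add_one_le_of_lt (h i h1 h2))

theorem liminfAt_congr {α : Ordinal.{0}} {p q : Ordinal.{0} → Ordinal.{0}}
    (h : ∀ i < α, p i = q i) : liminfAt α p = liminfAt α q := by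
  refine eq_of_forall_lt_iff fun x => ?_
  rw [lt_liminfAt_iff, lt_liminfAt_iff]
  constructor
  · rintro ⟨γ, hγ, h'⟩
    exact ⟨γ, hγ, fun i h1 h2 => by rw [← h i h2]; exact h' i h1 h2⟩
  · rintro ⟨γ, hγ, h'⟩
    exact ⟨γ, hγ, fun i h1 h2 => by rw [h i h2]; exact h' i h1 h2⟩

theorem boolLiminfAt_iff {α : Ordinal.{0}} {b : Ordinal.{0} → Bool} :
    boolLiminfAt α b = true ↔ ∃ γ < α, ∀ i, γ ≤ i → i < α → b i = true := by
  unfold boolLiminfAt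
  split_ifs with h
  · exact ⟨fun _ => h, fun _ => rfl⟩
  · exact ⟨fun h' => by simp at h', fun h' => absurd h' h⟩

theorem boolLiminfAt_congr {α : Ordinal.{0}} {p q : Ordinal.{0} → Bool}
    (h : ∀ i < α, p i = q i) : boolLiminfAt α p = boolLiminfAt α q := by
  rw [Bool.eq_iff_iff, boolLiminfAt_iff, boolLiminfAt_iff]
  constructor
  · rintro ⟨γ, hγ, h'⟩
    exact ⟨γ, hγ, fun i h1 h2 => by rw [← h i h2]; exact h' i h1 h2⟩
  · rintro ⟨γ, hγ, h'⟩
    exact ⟨γ, hγ, fun i h1 h2 => by rw [h i h2]; exact h' i h1 h2⟩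

theorem natLiminfAt_eq {α : Ordinal.{0}} {s : Ordinal.{0} → ℕ} {n : ℕ}
    (h1 : ∃ γ < α, ∀ i, γ ≤ i → i < α → n ≤ s i)
    (h2 : ∀ γ < α, ∃ i, γ ≤ i ∧ i < α ∧ s i = n) : natLiminfAt α s = n := by
  have : liminfAt α (fun i => (s i : Ordinal)) = (n : Ordinal) := by
    apply le_antisymm
    · refine liminfAt_le fun γ hγ => ?_
      obtain ⟨i, a, b, c⟩ := h2 γ hγ
      exact ⟨i, a, b, by simp [c]⟩
    · obtain ⟨γ, hγ, h⟩ := h1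
      exact le_liminfAt hγ fun i a b => by exact_mod_cast h i a b
  rw [natLiminfAt, this]
  simp

/-- For natural number sequences bounded below `N`, the liminf is characterized. -/
theorem exists_natLiminf {α : Ordinal.{0}} (hα : 0 < α) {s : Ordinal.{0} → ℕ} {N : ℕ}
    (hb : ∀ i < α, s i ≤ N) :
    ∃ n, (∃ γ < α, ∀ i, γ ≤ i → i < α → n ≤ s i) ∧
      (∀ γ < α, ∃ i, γ ≤ i ∧ i < α ∧ s i = n) := by
  classical
  have key : ∃ n, ¬ ∃ γ < α, ∀ i, γ ≤ i → i < α → n ≤ s i := by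
    refine ⟨N + 1, ?_⟩
    rintro ⟨γ, hγ, h⟩
    have := h γ le_rfl hγ
    have := hb γ hγ
    omega
  have hn := Nat.find_spec key
  set n := Nat.find key
  have hpos : n ≠ 0 := by
    intro h0
    apply hn
    exact ⟨0, hα, fun i _ _ => by omega⟩
  obtain ⟨m, hm⟩ := Nat.exists_eq_succ_of_ne_zero hpos
  have hm' : ∃ γ < α, ∀ i, γ ≤ i → i < α → m ≤ s i := by
    by_contra hc
    exact Nat.find_min key (m := m) (by omega) hc
  refine ⟨m, hm', fun γ hγ => ?_⟩
  by_contra hc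
  push Not at hc
  apply hn
  obtain ⟨γ', hγ', h'⟩ := hm'
  refine ⟨max γ γ', max_lt hγ hγ', fun i h1 h2 => ?_⟩
  have := h' i (le_trans (le_max_right _ _) h1) h2
  have := hc i (le_trans (le_max_left _ _) h1) h2
  omega

theorem leftOf_add_one (o : Ordinal.{0}) : leftOf (o + 1) = o := by
  have h : ∃ p, o + 1 = p + 1 := ⟨o, rfl⟩
  unfold leftOf
  rw [dif_pos h]
  have := Classical.choose_spec h
  exact (Order.succ_injective (by simpa using this)).symm

theorem leftOf_limit {o : Ordinal.{0}} (h : IsSuccPrelimit o) : leftOf o = 0 := by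
  unfold leftOf
  rw [dif_neg]
  rintro ⟨p, rfl⟩
  exact h p (Order.covBy_add_one p)

@[simp] theorem leftOf_zero : leftOf 0 = 0 := leftOf_limit (by simp)

theorem leftOf_le (o : Ordinal.{0}) : leftOf o ≤ o := by
  by_cases h : ∃ p, o = p + 1
  · obtain ⟨p, rfl⟩ := h
    rw [leftOf_add_one]
    exact le_self_add
  · unfold leftOf
    rw [dif_neg h]
    exact zero_le

theorem leftOf_lt {o : Ordinal.{0}} (h : o ≠ 0) : leftOf o < o := by
  by_cases h' : ∃ p, o = p + 1
  · obtain ⟨p, rfl⟩ := h'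
    rw [leftOf_add_one]
    exact lt_add_one p
  · unfold leftOf
    rw [dif_neg h']
    exact pos_iff_ne_zero.2 h

/-- Iterated left moves get to zero after finitely many steps. -/
theorem exists_iter_leftOf (o : Ordinal.{0}) : ∃ n : ℕ, leftOf^[n] o = 0 := by
  induction o using WellFoundedLT.induction with
  | ind o ih =>
    by_cases h : o = 0
    · exact ⟨0, h⟩
    · obtain ⟨n, hn⟩ := ih _ (leftOf_lt h)
      exact ⟨n + 1, by simpa using hn⟩

end GapU

namespace GapU
open Order

/-! ### Abstract scripts -/

inductive Op where
  | one | and | andn | set | clr | inc | dec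
  deriving DecidableEq

structure Mem where
  h : ℕ → Ordinal.{0}
  T : ℕ → Ordinal.{0} → Bool

namespace Mem
def rd (m : Mem) (j : ℕ) : Bool := m.T j (m.h j)
def wr (m : Mem) (j : ℕ) (v : Bool) : Mem :=
  ⟨m.h, Function.update m.T j (Function.update (m.T j) (m.h j) v)⟩
def mv (m : Mem) (j : ℕ) (o : Ordinal.{0}) : Mem := ⟨Function.update m.h j o, m.T⟩
def zero : Mem := ⟨fun _ => 0, fun _ _ => false⟩
end Mem

abbrev Script := List (Op × ℕ)

def exec (s : Mem × Bool) (I : Op × ℕ) : Mem × Bool :=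
  match I.1 with
  | Op.one => (s.1, true)
  | Op.and => (s.1, s.2 && s.1.rd I.2)
  | Op.andn => (s.1, s.2 && !s.1.rd I.2)
  | Op.set => (if s.2 then s.1.wr I.2 true else s.1, s.2)
  | Op.clr => (if s.2 then s.1.wr I.2 false else s.1, s.2)
  | Op.inc => (if s.2 then s.1.mv I.2 (s.1.h I.2 + 1) else s.1, s.2)
  | Op.dec => (if s.2 then s.1.mv I.2 (leftOf (s.1.h I.2)) else s.1, s.2)

def execL (L : Script) (s : Mem × Bool) : Mem × Bool := L.foldl exec s

def pref (L : Script) (k : ℕ) (m : Mem) : Mem × Bool := execL (L.take k) (m, false)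

def stage (L : Script) (m : Mem) : Mem × Bool := execL L (m, false)

def absLimit (L : Script) (lam : Ordinal.{0}) (g : Ordinal.{0} → Mem) : Mem :=
  ⟨fun j => liminfAt lam (fun σ => ⨅ k, (pref L k (g σ)).1.h j),
   fun j i => boolLiminfAt lam
    (fun σ => open scoped Classical in decide (∀ k, (pref L k (g σ)).1.T j i = true))⟩

def absRun (L : Script) (o : Ordinal.{0}) : Mem :=
  Ordinal.limitRecOn o Mem.zero (fun _ ih => (stage L ih).1)
    (fun lam _ ih => absLimit L lam
      (fun σ => open scoped Classical in if h : σ < lam then ih σ h else Mem.zero))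

theorem absRun_zero (L : Script) : absRun L 0 = Mem.zero := by
  unfold absRun; rw [Ordinal.limitRecOn_zero]

theorem absRun_succ (L : Script) (σ : Ordinal.{0}) :
    absRun L (σ + 1) = (stage L (absRun L σ)).1 := by
  unfold absRun; rw [Ordinal.limitRecOn_add_one]

theorem absRun_limit (L : Script) {lam : Ordinal.{0}} (h : IsSuccLimit lam) :
    absRun L lam = absLimit L lam (absRun L) := by
  have : absRun L lam = absLimit L lam (fun σ => open scoped Classical in
    if h : σ < lam then absRun L σ else Mem.zero) := by
    unfold absRun; rw [Ordinal.limitRecOn_limit _ _ _ _ h]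
  rw [this]
  unfold absLimit
  congr 1
  · funext j
    exact liminfAt_congr fun i hi => by simp [hi]
  · funext j i
    exact boolLiminfAt_congr fun i hi => by simp [hi]

theorem lt_iInf_nat {x : Ordinal.{0}} {f : ℕ → Ordinal.{0}} : x < ⨅ k, f k ↔ ∀ k, x < f k := by
  constructor
  · intro h k
    exact lt_of_lt_of_le h (ciInf_le' f k)
  · intro h
    obtain ⟨k, hk⟩ := ciInf_mem f
    rw [← hk]; exact h k

theorem absRun_limit_h (L : Script) {lam : Ordinal.{0}} (h : IsSuccLimit lam) (j : ℕ)
    (x : Ordinal.{0}) : x < (absRun L lam).h j ↔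
      ∃ γ < lam, ∀ σ, γ ≤ σ → σ < lam → ∀ k, x < (pref L k (absRun L σ)).1.h j := by
  rw [absRun_limit L h]
  show x < liminfAt _ _ ↔ _
  rw [lt_liminfAt_iff]
  simp only [lt_iInf_nat]

theorem absRun_limit_T (L : Script) {lam : Ordinal.{0}} (h : IsSuccLimit lam) (j : ℕ)
    (x : Ordinal.{0}) : (absRun L lam).T j x = true ↔
      ∃ γ < lam, ∀ σ, γ ≤ σ → σ < lam → ∀ k, (pref L k (absRun L σ)).1.T j x = true := by
  rw [absRun_limit L h]
  show boolLiminfAt _ _ = true ↔ _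
  rw [boolLiminfAt_iff]
  simp only [decide_eq_true_eq]

def ev (L : Script) (σ : Ordinal.{0}) : Prop := (stage L (absRun L σ)).2 = true

def firstEvent (L : Script) (α : Ordinal.{0}) : Prop := ev L α ∧ ∀ σ < α, ¬ ev L σ

theorem firstEvent_unique {L : Script} {α β : Ordinal.{0}} (h1 : firstEvent L α)
    (h2 : firstEvent L β) : α = β := by
  rcases lt_trichotomy α β with h | h | h
  · exact absurd h1.1 (h2.2 _ h)
  · exact h
  · exact absurd h2.1 (h1.2 _ h)

/-! ### Predicates along an execution -/

def Along (Q : Mem → Prop) : Script → Mem × Bool → Prop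
  | [], s => Q s.1
  | I :: L, s => Q s.1 ∧ Along Q L (exec s I)

theorem Along.imp {Q Q' : Mem → Prop} (h : ∀ m, Q m → Q' m) {L : Script} {s : Mem × Bool}
    (hh : Along Q L s) : Along Q' L s := by
  induction L generalizing s with
  | nil => exact h _ hh
  | cons I L ih => exact ⟨h _ hh.1, ih hh.2⟩

theorem Along.start {Q : Mem → Prop} {L : Script} {s : Mem × Bool}
    (hh : Along Q L s) : Q s.1 := by
  cases L with
  | nil => exact hh
  | cons I L => exact hh.1

theorem Along.append {Q : Mem → Prop} {L L' : Script} {s : Mem × Bool}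
    (h1 : Along Q L s) (h2 : Along Q L' (execL L s)) : Along Q (L ++ L') s := by
  induction L generalizing s with
  | nil => exact h2
  | cons I L ih => exact ⟨h1.1, ih h1.2 h2⟩

theorem Along.pref {Q : Mem → Prop} {L : Script} {s : Mem × Bool}
    (h1 : Along Q L s) (k : ℕ) : Q (execL (L.take k) s).1 := by
  induction L generalizing s k with
  | nil => simpa [execL, Along] using h1
  | cons I L ih =>
    cases k with
    | zero => exact h1.1
    | succ k => exact ih h1.2 k

theorem execL_append (L L' : Script) (s : Mem × Bool) :
    execL (L ++ L') s = execL L' (execL L s) := by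
  simp [execL]

theorem execL_cons (I : Op × ℕ) (L : Script) (s : Mem × Bool) :
    execL (I :: L) s = execL L (exec s I) := rfl

theorem execL_nil (s : Mem × Bool) : execL [] s = s := rfl

/-- Tests. -/
def tst (b : Bool) (j : ℕ) : Op × ℕ := (if b then Op.and else Op.andn, j)
def put (b : Bool) (j : ℕ) : Op × ℕ := (if b then Op.set else Op.clr, j)
def mov (b : Bool) (j : ℕ) : Op × ℕ := (if b then Op.inc else Op.dec, j)

theorem exec_tst (m : Mem) (acc b : Bool) (j : ℕ) :
    exec (m, acc) (tst b j) = (m, acc && (m.rd j == b)) := by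
  cases b <;> simp [exec, tst]

theorem exec_put_true (m : Mem) (b : Bool) (j : ℕ) :
    exec (m, true) (put b j) = (m.wr j b, true) := by
  cases b <;> simp [exec, put]

theorem exec_mov_true (m : Mem) (b : Bool) (j : ℕ) :
    exec (m, true) (mov b j) =
      (m.mv j (if b then m.h j + 1 else leftOf (m.h j)), true) := by
  cases b <;> simp [exec, mov]

theorem exec_put_false (m : Mem) (b : Bool) (j : ℕ) :
    exec (m, false) (put b j) = (m, false) := by
  cases b <;> simp [exec, put]

theorem exec_mov_false (m : Mem) (b : Bool) (j : ℕ) :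
    exec (m, false) (mov b j) = (m, false) := by
  cases b <;> simp [exec, mov]

theorem execL_tests (l : List (Bool × ℕ)) (m : Mem) (acc : Bool) :
    execL (l.map fun p => tst p.1 p.2) (m, acc) =
      (m, acc && l.all fun p => m.rd p.2 == p.1) := by
  induction l generalizing acc with
  | nil => simp [execL]
  | cons p l ih => simp [execL_cons, exec_tst, ih, Bool.and_assoc]

theorem along_tests {Q : Mem → Prop} (l : List (Bool × ℕ)) (m : Mem) (acc : Bool) (h : Q m) :
    Along Q (l.map fun p => tst p.1 p.2) (m, acc) := by
  induction l generalizing acc with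
  | nil => exact h
  | cons p l ih => exact ⟨h, by rw [exec_tst]; exact ih _⟩

end GapU

namespace GapU
open Order

/-! ### Compiling OTM programs to scripts -/

section Compile
variable (P : OTMProgram)

abbrev dcol : ℕ := P.tapes + (P.states + 1)

def conds (q : Fin (P.states + 1)) (f : Fin P.tapes → Bool) : List (Bool × ℕ) :=
  (List.finRange P.tapes).map (fun t => (f t, t.val)) ++
  (List.range (P.states + 1)).map (fun s => (decide (s < q.val), P.tapes + s))

def actW (w : Fin P.tapes → Bool) (l : List (Fin P.tapes)) : Script :=
  l.map fun t => put (w t) t.val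
def actM (mv : Fin P.tapes → Bool) (l : List (Fin P.tapes)) : Script :=
  l.map fun t => mov (mv t) t.val
def actB (q : Fin (P.states + 1)) (l : List ℕ) : Script :=
  l.map fun s => put (decide (s < q.val)) (P.tapes + s)

def actions (r : Fin (P.states + 1) × (Fin P.tapes → Bool) × (Fin P.tapes → Bool)) : Script :=
  actW P r.2.1 (List.finRange P.tapes) ++ (actM P r.2.2 (List.finRange P.tapes) ++
    actB P r.1 (List.range (P.states + 1)))

def block (act : Bool) (p : Fin (P.states + 1) × (Fin P.tapes → Bool)) : Script :=
  match P.trans p.1 p.2 with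
  | none => []
  | some r => ([(Op.one, 0), tst false (dcol P)] ++ (conds P p.1 p.2).map (fun p => tst p.1 p.2)) ++
      (put true (dcol P) :: (if act then actions P r else []))

def blocks (act : Bool) (l : List (Fin (P.states + 1) × (Fin P.tapes → Bool))) : Script :=
  l.flatMap (block P act)

def clrD : Script := [(Op.one, 0), put false (dcol P)]

def allPairs : List (Fin (P.states + 1) × (Fin P.tapes → Bool)) := Finset.univ.toList

def compile : Script :=
  clrD P ++ (blocks P true (allPairs P) ++ (clrD P ++ (blocks P false (allPairs P) ++
    [(Op.one, 0), tst false (dcol P)])))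

/-- In-between memories. -/
structure Mid (c c' : OTMConfig P) (W M : List (Fin P.tapes)) (B : List ℕ) (m : Mem) : Prop where
  h0 : ∀ t : Fin P.tapes, t ∉ M → m.h t = c.head t
  h1 : ∀ t : Fin P.tapes, t ∈ M → m.h t = c'.head t
  T0 : ∀ t : Fin P.tapes, t ∉ W → m.T t = c.tape t
  T1 : ∀ t : Fin P.tapes, t ∈ W → m.T t = c'.tape t
  b0 : ∀ s < P.states + 1, s ∉ B → m.T (P.tapes + s) 0 = decide (s < c.state.val)
  b1 : ∀ s < P.states + 1, s ∈ B → m.T (P.tapes + s) 0 = decide (s < c'.state.val)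
  hb : ∀ s < P.states + 2, m.h (P.tapes + s) = 0

def CRel (c : OTMConfig P) (m : Mem) : Prop := Mid P c c [] [] [] m

structure Btw (c c' : OTMConfig P) (m : Mem) : Prop where
  h : ∀ t : Fin P.tapes, m.h t = c.head t ∨ m.h t = c'.head t
  T : ∀ (t : Fin P.tapes) i, m.T t i = c.tape t i ∨ m.T t i = c'.tape t i
  b : ∀ s < P.states + 1, m.T (P.tapes + s) 0 = decide (s < c.state.val) ∨
    m.T (P.tapes + s) 0 = decide (s < c'.state.val)
  hb : ∀ s < P.states + 2, m.h (P.tapes + s) = 0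

variable {P}

theorem Mid.btw {c c' : OTMConfig P} {W M B} {m : Mem} (h : Mid P c c' W M B m) :
    Btw P c c' m where
  h t := by
    by_cases ht : t ∈ M
    · exact Or.inr (h.h1 t ht)
    · exact Or.inl (h.h0 t ht)
  T t i := by
    by_cases ht : t ∈ W
    · exact Or.inr (by rw [h.T1 t ht])
    · exact Or.inl (by rw [h.T0 t ht])
  b s hs := by
    by_cases ht : s ∈ B
    · exact Or.inr (h.b1 s hs ht)
    · exact Or.inl (h.b0 s hs ht)
  hb := h.hb

theorem CRel.mid {c c' : OTMConfig P} {m : Mem} (h : CRel P c m) : Mid P c c' [] [] [] m :=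
  ⟨h.h0, by simp, h.T0, by simp, h.b0, by simp, h.hb⟩

theorem Mid.crel {c c' : OTMConfig P} {m : Mem}
    (h : Mid P c c' (List.finRange _) (List.finRange _) (List.range (P.states + 1)) m) :
    CRel P c' m :=
  ⟨fun t _ => h.h1 t (by simp), by simp, fun t _ => h.T1 t (by simp), by simp,
    fun s hs _ => h.b1 s hs (by simpa using hs), by simp, h.hb⟩

theorem CRel.btw' {c c' : OTMConfig P} {m : Mem} (h : CRel P c' m) : Btw P c c' m :=
  ⟨fun t => Or.inr (h.h0 t (by simp)), fun t i => Or.inr (by rw [h.T0 t (by simp)]),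
    fun s hs => Or.inr (h.b0 s hs (by simp)), h.hb⟩

/-- Writing on the flag column `D`. -/
theorem Mid.wrD {c c' : OTMConfig P} {W M B} {m : Mem} (h : Mid P c c' W M B m) (v : Bool) :
    Mid P c c' W M B (m.wr (dcol P) v) ∧ (m.wr (dcol P) v).rd (dcol P) = v := by
  have e1 : ∀ t : Fin P.tapes, t.val ≠ dcol P := fun t => by have := t.2; simp [dcol]; omega
  have e2 : ∀ s < P.states + 1, P.tapes + s ≠ dcol P := fun t => by simp [dcol]; omega
  refine ⟨⟨h.h0, h.h1, fun t ht => ?_, fun t ht => ?_, fun s hs ht => ?_, fun s hs ht => ?_,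
    h.hb⟩, ?_⟩
  · simp [Mem.wr, Function.update_of_ne (e1 t), h.T0 t ht]
  · simp [Mem.wr, Function.update_of_ne (e1 t), h.T1 t ht]
  · simp [Mem.wr, Function.update_of_ne (e2 s hs), h.b0 s hs ht]
  · simp [Mem.wr, Function.update_of_ne (e2 s hs), h.b1 s hs ht]
  · simp [Mem.wr, Mem.rd]

def MidD (c c' : OTMConfig P) (W M : List (Fin P.tapes)) (B : List ℕ) (m : Mem) : Prop :=
  Mid P c c' W M B m ∧ m.rd (dcol P) = true

section
variable {c : OTMConfig P} {r : Fin (P.states + 1) × (Fin P.tapes → Bool) × (Fin P.tapes → Bool)}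

/-- the result of a step -/
def nxt (c : OTMConfig P)
    (r : Fin (P.states + 1) × (Fin P.tapes → Bool) × (Fin P.tapes → Bool)) : OTMConfig P :=
  { state := r.1
    head := fun t => if r.2.2 t then c.head t + 1 else leftOf (c.head t)
    tape := fun t i => if i = c.head t then r.2.1 t else c.tape t i }

theorem midW {W B} {m : Mem} (h : MidD c (nxt c r) W [] B m) (t : Fin P.tapes) :
    MidD c (nxt c r) (t :: W) [] B (m.wr t.val (r.2.1 t)) := by
  have e1 : dcol P ≠ t.val := by have := t.2; simp [dcol]; omega
  have e2 : ∀ s, P.tapes + s ≠ t.val := fun s => by have := t.2; omega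
  have hh : m.h t.val = c.head t := h.1.h0 t (by simp)
  refine ⟨⟨h.1.h0, h.1.h1, fun t' ht => ?_, fun t' ht => ?_, fun s hs ht => ?_, fun s hs ht => ?_,
    h.1.hb⟩, ?_⟩
  · simp only [List.mem_cons, not_or] at ht
    have : t'.val ≠ t.val := fun e => ht.1 (Fin.ext e)
    simp [Mem.wr, Function.update_of_ne this, h.1.T0 t' ht.2]
  · by_cases e : t' = t
    · subst e
      funext i
      simp only [Mem.wr, Function.update_self, nxt, hh]
      by_cases hi : i = c.head t'
      · subst hi; simp
      · rw [Function.update_of_ne hi, if_neg hi]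
        by_cases hw : t' ∈ W
        · rw [h.1.T1 _ hw]; simp [nxt, hi]
        · rw [h.1.T0 _ hw]
    · have e' : t'.val ≠ t.val := fun e1 => e (Fin.ext e1)
      simp [e] at ht
      simp [Mem.wr, Function.update_of_ne e', h.1.T1 t' ht]
  · simp [Mem.wr, Function.update_of_ne (e2 s), h.1.b0 s hs ht]
  · simp [Mem.wr, Function.update_of_ne (e2 s), h.1.b1 s hs ht]
  · have := h.2
    simpa [Mem.wr, Mem.rd, Function.update_of_ne e1] using this

theorem midM {W M B} {m : Mem} (h : MidD c (nxt c r) W M B m) (t : Fin P.tapes) (ht : t ∉ M) :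
    MidD c (nxt c r) W (t :: M) B
      (m.mv t.val (if r.2.2 t then m.h t + 1 else leftOf (m.h t))) := by
  have e1 : dcol P ≠ t.val := by have := t.2; simp [dcol]; omega
  have e2 : ∀ s, P.tapes + s ≠ t.val := fun s => by have := t.2; omega
  have hh : m.h t.val = c.head t := h.1.h0 t ht
  refine ⟨⟨fun t' ht => ?_, fun t' ht' => ?_, h.1.T0, h.1.T1, h.1.b0, h.1.b1, fun s hs => ?_⟩, ?_⟩
  · simp only [List.mem_cons, not_or] at ht
    have : t'.val ≠ t.val := fun e => ht.1 (Fin.ext e)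
    simp [Mem.mv, Function.update_of_ne this, h.1.h0 t' ht.2]
  · by_cases e : t' = t
    · subst e
      simp [Mem.mv, hh, nxt]
    · have e' : t'.val ≠ t.val := fun e1 => e (Fin.ext e1)
      simp [e] at ht'
      simp [Mem.mv, Function.update_of_ne e', h.1.h1 t' ht']
  · simp [Mem.mv, Function.update_of_ne (e2 s), h.1.hb s hs]
  · have := h.2
    simpa [Mem.mv, Mem.rd, Function.update_of_ne e1] using this

theorem midB {W M B} {m : Mem} (h : MidD c (nxt c r) W M B m) (s : ℕ) (hs : s < P.states + 1) :
    MidD c (nxt c r) W M (s :: B) (m.wr (P.tapes + s) (decide (s < r.1.val))) := by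
  have e1 : dcol P ≠ P.tapes + s := by simp [dcol]; omega
  have e2 : ∀ t : Fin P.tapes, t.val ≠ P.tapes + s := fun t => by have := t.2; omega
  have hh : m.h (P.tapes + s) = 0 := h.1.hb s (by omega)
  refine ⟨⟨h.1.h0, h.1.h1, fun t' ht => ?_, fun t' ht => ?_, fun s' hs ht => ?_, fun s' hs ht => ?_,
    h.1.hb⟩, ?_⟩
  · simp [Mem.wr, Function.update_of_ne (e2 t'), h.1.T0 t' ht]
  · simp [Mem.wr, Function.update_of_ne (e2 t'), h.1.T1 t' ht]
  · simp only [List.mem_cons, not_or] at ht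
    have : P.tapes + s' ≠ P.tapes + s := fun e => ht.1 (by omega)
    simp [Mem.wr, Function.update_of_ne this, h.1.b0 s' hs ht.2]
  · by_cases e : s' = s
    · subst e
      simp only [Mem.wr, hh, nxt, Function.update_self]
      rfl
    · have e' : P.tapes + s' ≠ P.tapes + s := fun e1 => e (by omega)
      simp [e] at ht
      simp [Mem.wr, Function.update_of_ne e', h.1.b1 s' hs ht]
  · have := h.2
    simpa [Mem.wr, Mem.rd, Function.update_of_ne e1] using this

theorem actW_run (l : List (Fin P.tapes)) {W B} {m : Mem} (h : MidD c (nxt c r) W [] B m) :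
    ∃ m' W', execL (actW P r.2.1 l) (m, true) = (m', true) ∧ MidD c (nxt c r) W' [] B m' ∧
      (∀ t, t ∈ W' ↔ t ∈ l ∨ t ∈ W) ∧ Along (Btw P c (nxt c r)) (actW P r.2.1 l) (m, true) := by
  induction l generalizing m W with
  | nil => exact ⟨m, W, rfl, h, by simp, h.1.btw⟩
  | cons t l ih =>
    obtain ⟨m', W', h1, h2, h3, h4⟩ := ih (midW h t)
    refine ⟨m', W', ?_, h2, ?_, h.1.btw, ?_⟩
    · simp only [actW, List.map_cons, execL_cons, exec_put_true]; exact h1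
    · intro t'; rw [h3]; simp; tauto
    · simp only [exec_put_true]; exact h4

theorem actM_run (l : List (Fin P.tapes)) (hl : l.Nodup) {W M B} (hM : ∀ t ∈ l, t ∉ M) {m : Mem}
    (h : MidD c (nxt c r) W M B m) :
    ∃ m' M', execL (actM P r.2.2 l) (m, true) = (m', true) ∧ MidD c (nxt c r) W M' B m' ∧
      (∀ t, t ∈ M' ↔ t ∈ l ∨ t ∈ M) ∧ Along (Btw P c (nxt c r)) (actM P r.2.2 l) (m, true) := by
  induction l generalizing m M with
  | nil => exact ⟨m, M, rfl, h, by simp, h.1.btw⟩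
  | cons t l ih =>
    rw [List.nodup_cons] at hl
    obtain ⟨m', W', h1, h2, h3, h4⟩ := ih hl.2 (M := t :: M) (by
      intro t' ht'
      simp only [List.mem_cons, not_or]
      exact ⟨fun e => hl.1 (e ▸ ht'), hM t' (by simp [ht'])⟩) (midM h t (hM t (by simp)))
    refine ⟨m', W', ?_, h2, ?_, h.1.btw, ?_⟩
    · simp only [actM, List.map_cons, execL_cons, exec_mov_true]; exact h1
    · intro t'; rw [h3]; simp; tauto
    · simp only [exec_mov_true]; exact h4

theorem actB_run (l : List ℕ) (hl : ∀ s ∈ l, s < P.states + 1) {W M B} {m : Mem}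
    (h : MidD c (nxt c r) W M B m) :
    ∃ m' B', execL (actB P r.1 l) (m, true) = (m', true) ∧ MidD c (nxt c r) W M B' m' ∧
      (∀ t, t ∈ B' ↔ t ∈ l ∨ t ∈ B) ∧ Along (Btw P c (nxt c r)) (actB P r.1 l) (m, true) := by
  induction l generalizing m B with
  | nil => exact ⟨m, B, rfl, h, by simp, h.1.btw⟩
  | cons t l ih =>
    obtain ⟨m', W', h1, h2, h3, h4⟩ := ih (fun s hs => hl s (by simp [hs]))
      (midB h t (hl t (by simp)))
    refine ⟨m', W', ?_, h2, ?_, h.1.btw, ?_⟩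
    · simp only [actB, List.map_cons, execL_cons, exec_put_true]; exact h1
    · intro t'; rw [h3]; simp; tauto
    · simp only [exec_put_true]; exact h4

theorem actions_run {m : Mem} (h : MidD c (nxt c r) [] [] [] m) :
    ∃ m', execL (actions P r) (m, true) = (m', true) ∧ CRel P (nxt c r) m' ∧
      m'.rd (dcol P) = true ∧ Along (Btw P c (nxt c r)) (actions P r) (m, true) := by
  obtain ⟨m1, W, a1, a2, a3, a4⟩ := actW_run (List.finRange _) h
  obtain ⟨m2, M, b1, b2, b3, b4⟩ := actM_run (List.finRange _) (List.nodup_finRange _)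
    (by simp) a2
  obtain ⟨m3, B, d1, d2, d3, d4⟩ := actB_run (List.range (P.states + 1)) (by simp) b2
  refine ⟨m3, ?_, ?_, d2.2, ?_⟩
  · rw [actions, execL_append, execL_append, a1, b1, d1]
  · have := d2.1
    exact ⟨fun t _ => this.h1 t (by simp [b3]), by simp, fun t _ => this.T1 t (by simp [a3]), by simp,
      fun s hs _ => this.b1 s hs (by simpa [d3] using hs), by simp, this.hb⟩
  · exact a4.append (by rw [a1]; exact b4.append (by rw [b1]; exact d4))

end

theorem conds_true {c : OTMConfig P} {m : Mem} (h : CRel P c m) (q : Fin (P.states + 1))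
    (f : Fin P.tapes → Bool) :
    ((conds P q f).all fun p => m.rd p.2 == p.1) = true ↔
      (q = c.state ∧ f = P.readSymbols c) := by
  simp only [conds, List.all_append, Bool.and_eq_true, List.all_map, List.all_eq_true,
    Function.comp, List.mem_finRange, List.mem_range, beq_iff_eq, true_implies]
  have e1 : ∀ t : Fin P.tapes, m.rd t = P.readSymbols c t := fun t => by
    rw [Mem.rd, h.h0 t (by simp), h.T0 t (by simp)]; rfl
  have e2 : ∀ s < P.states + 1, m.rd (P.tapes + s) = decide (s < c.state.val) := fun s hs => by
    rw [Mem.rd, h.hb s (by omega), h.b0 s hs (by simp)]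
  constructor
  · rintro ⟨h1, h2⟩
    refine ⟨?_, funext fun t => by rw [← h1 t, e1]⟩
    apply Fin.ext
    by_contra hne
    rcases Nat.lt_or_gt_of_ne hne with hlt | hlt
    · have := h2 q.val (by omega)
      rw [e2 _ (by omega)] at this
      simp [hlt] at this
    · have := h2 c.state.val (by omega)
      rw [e2 _ (by omega)] at this
      simp at this
      omega
  · rintro ⟨rfl, rfl⟩
    exact ⟨fun t => e1 t, fun s hs => e2 s hs⟩

/-- the outcome of a block when it does not fire -/
theorem block_skip {Q : Mem → Prop} {c : OTMConfig P} {m : Mem} (act acc : Bool)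
    (hm : m.rd (dcol P) = true ∨ CRel P c m) (hQ : Q m)
    (p : Fin (P.states + 1) × (Fin P.tapes → Bool))
    (h : m.rd (dcol P) = true ∨ P.trans p.1 p.2 = none ∨ p ≠ (c.state, P.readSymbols c)) :
    ∃ acc', execL (block P act p) (m, acc) = (m, acc') ∧ Along Q (block P act p) (m, acc) := by
  have actF : ∀ r, execL (actions P r) (m, false) = (m, false) ∧ Along Q (actions P r) (m, false) := by
    intro r
    have gen : ∀ L : Script, (∀ I ∈ L, exec (m, false) I = (m, false)) →
        execL L (m, false) = (m, false) ∧ Along Q L (m, false) := by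
      intro L hL
      induction L with
      | nil => exact ⟨rfl, hQ⟩
      | cons I L ih =>
        have := ih fun I hI => hL I (by simp [hI])
        have e := hL I (by simp)
        exact ⟨by rw [execL_cons, e]; exact this.1, hQ, by rw [e]; exact this.2⟩
    apply gen
    intro I hI
    simp only [actions, actW, actM, actB, List.mem_append, List.mem_map] at hI
    rcases hI with ⟨t, _, rfl⟩ | ⟨t, _, rfl⟩ | ⟨t, _, rfl⟩
    · exact exec_put_false _ _ _
    · exact exec_mov_false _ _ _
    · exact exec_put_false _ _ _
  unfold block
  cases hr : P.trans p.1 p.2 with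
  | none => exact ⟨acc, rfl, hQ⟩
  | some r =>
    have key : execL ([(Op.one, 0), tst false (dcol P)] ++
        (conds P p.1 p.2).map (fun p => tst p.1 p.2)) (m, acc) = (m, false) := by
      rw [execL_append, execL_cons, execL_cons, execL_nil]
      have : exec (exec (m, acc) (Op.one, 0)) (tst false (dcol P)) =
        (m, true && (m.rd (dcol P) == false)) := exec_tst _ _ _ _
      rw [this, execL_tests]
      congr 1
      by_cases hD : m.rd (dcol P) = true
      · simp [hD]
      · have h2 : ¬ (((conds P p.1 p.2).all fun p => m.rd p.2 == p.1) = true) := by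
          rw [conds_true (by tauto : CRel P c m)]
          intro h3
          rcases h with h | h | h
          · exact hD h
          · rw [hr] at h; simp at h
          · exact h (Prod.ext h3.1 h3.2)
        simp only [Bool.not_eq_true] at h2
        rw [h2]; simp
    have al : Along Q ([(Op.one, 0), tst false (dcol P)] ++
        (conds P p.1 p.2).map (fun p => tst p.1 p.2)) (m, acc) := by
      refine ⟨hQ, hQ, ?_⟩
      have : exec (exec (m, acc) (Op.one, 0)) (tst false (dcol P)) =
        (m, true && (m.rd (dcol P) == false)) := exec_tst _ _ _ _
      rw [this]
      exact along_tests _ _ _ hQ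
    refine ⟨false, ?_, ?_⟩
    · dsimp only
      rw [execL_append, key, execL_cons, exec_put_false]
      cases act
      · rfl
      · exact (actF r).1
    · refine al.append ?_
      rw [key]
      refine ⟨hQ, ?_⟩
      rw [exec_put_false]
      cases act
      · exact hQ
      · exact (actF r).2

/-- the outcome of a block when it fires -/
theorem block_fire {c : OTMConfig P} {m : Mem} (act acc : Bool)
    (hm : CRel P c m) (hD : m.rd (dcol P) = false) {r} (hr : P.trans c.state (P.readSymbols c) = some r) :
    ∃ m' acc', execL (block P act (c.state, P.readSymbols c)) (m, acc) = (m', acc') ∧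
      CRel P (if act then nxt c r else c) m' ∧ m'.rd (dcol P) = true ∧
      Along (Btw P c (if act then nxt c r else c)) (block P act (c.state, P.readSymbols c)) (m, acc) := by
  unfold block
  simp only [hr]
  have hbt : Btw P c (if act then nxt c r else c) m := (CRel.mid hm).btw
  have key : execL ([(Op.one, 0), tst false (dcol P)] ++
      (conds P c.state (P.readSymbols c)).map (fun p => tst p.1 p.2)) (m, acc) = (m, true) := by
    rw [execL_append, execL_cons, execL_cons, execL_nil]
    have : exec (exec (m, acc) (Op.one, 0)) (tst false (dcol P)) =
      (m, true && (m.rd (dcol P) == false)) := exec_tst _ _ _ _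
    rw [this, execL_tests, (conds_true hm _ _).2 ⟨rfl, rfl⟩, hD]; simp
  have al : Along (Btw P c (if act then nxt c r else c)) ([(Op.one, 0), tst false (dcol P)] ++
      (conds P c.state (P.readSymbols c)).map (fun p => tst p.1 p.2)) (m, acc) := by
    refine ⟨hbt, hbt, ?_⟩
    have : exec (exec (m, acc) (Op.one, 0)) (tst false (dcol P)) =
      (m, true && (m.rd (dcol P) == false)) := exec_tst _ _ _ _
    rw [this]
    exact along_tests _ _ _ hbt
  cases act
  · refine ⟨m.wr (dcol P) true, true, ?_, ?_, (Mid.wrD hm true).2, ?_⟩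
    · rw [execL_append, key, execL_cons, exec_put_true]; rfl
    · exact (Mid.wrD hm true).1
    · refine al.append ?_
      rw [key]
      refine ⟨hbt, ?_⟩
      rw [exec_put_true]
      exact (Mid.wrD hm true).1.btw
  · have hmd : MidD c (nxt c r) [] [] [] (m.wr (dcol P) true) := Mid.wrD (CRel.mid hm) true
    obtain ⟨m', a1, a2, a3, a4⟩ := actions_run hmd
    refine ⟨m', true, ?_, a2, a3, ?_⟩
    · rw [execL_append, key, execL_cons, exec_put_true]; exact a1
    · refine al.append ?_
      rw [key]
      refine ⟨hbt, ?_⟩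
      rw [exec_put_true]
      exact a4

theorem blocks_skip {Q : Mem → Prop} {c : OTMConfig P} {m : Mem} (act acc : Bool)
    (hm : m.rd (dcol P) = true ∨ CRel P c m) (hQ : Q m)
    (l : List (Fin (P.states + 1) × (Fin P.tapes → Bool)))
    (h : m.rd (dcol P) = true ∨ P.trans c.state (P.readSymbols c) = none ∨
      (c.state, P.readSymbols c) ∉ l) :
    ∃ acc', execL (blocks P act l) (m, acc) = (m, acc') ∧ Along Q (blocks P act l) (m, acc) := by
  induction l generalizing acc with
  | nil => exact ⟨acc, rfl, hQ⟩
  | cons p l ih =>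
    obtain ⟨a1, h1, h2⟩ := block_skip act acc hm hQ p (by
      rcases h with h | h | h
      · exact Or.inl h
      · right
        by_cases e : p = (c.state, P.readSymbols c)
        · left; rw [e]; exact h
        · exact Or.inr e
      · right; right; intro e; exact h (by simp [e]))
    obtain ⟨a2, h3, h4⟩ := ih a1 (by simp at h; tauto)
    refine ⟨a2, ?_, ?_⟩
    · show execL (block P act p ++ blocks P act l) _ = _
      rw [execL_append, h1, h3]
    · show Along _ (block P act p ++ blocks P act l) _
      exact h2.append (by rw [h1]; exact h4)

theorem blocks_fire {c : OTMConfig P} {m : Mem} (act acc : Bool)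
    (hm : CRel P c m) (hD : m.rd (dcol P) = false) {r} (hr : P.trans c.state (P.readSymbols c) = some r)
    (l : List (Fin (P.states + 1) × (Fin P.tapes → Bool))) (hl : (c.state, P.readSymbols c) ∈ l) :
    ∃ m' acc', execL (blocks P act l) (m, acc) = (m', acc') ∧
      CRel P (if act then nxt c r else c) m' ∧ m'.rd (dcol P) = true ∧
      Along (Btw P c (if act then nxt c r else c)) (blocks P act l) (m, acc) := by
  induction l generalizing acc with
  | nil => simp at hl
  | cons p l ih =>
    show ∃ m' acc', execL (block P act p ++ blocks P act l) _ = _ ∧ _ ∧ _ ∧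
      Along _ (block P act p ++ blocks P act l) _
    by_cases e : p = (c.state, P.readSymbols c)
    · subst e
      obtain ⟨m', a1, h1, h2, h3, h4⟩ := block_fire act acc hm hD hr
      obtain ⟨a2, h5, h6⟩ := blocks_skip (Q := Btw P c (if act then nxt c r else c)) (c := c) act a1
        (Or.inl h3) h2.btw' l (Or.inl h3)
      refine ⟨m', a2, by rw [execL_append, h1, h5], h2, h3, h4.append (by rw [h1]; exact h6)⟩
    · obtain ⟨a1, h1, h2⟩ := block_skip (Q := Btw P c (if act then nxt c r else c)) act acc
        (Or.inr hm) (CRel.mid hm).btw p (Or.inr (Or.inr e))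
      obtain ⟨m', a2, h3, h4, h5, h6⟩ := ih a1 (by simp at hl; tauto)
      exact ⟨m', a2, by rw [execL_append, h1, h3], h4, h5, h2.append (by rw [h1]; exact h6)⟩

theorem clrD_run {Q : Mem → Prop} (m : Mem) (acc : Bool) (h1 : Q m) (h2 : Q (m.wr (dcol P) false)) :
    execL (clrD P) (m, acc) = (m.wr (dcol P) false, true) ∧ Along Q (clrD P) (m, acc) := by
  refine ⟨?_, h1, h1, ?_⟩
  · exact exec_put_true m false (dcol P)
  · have : exec (exec (m, acc) (Op.one, 0)) (put false (dcol P)) = (m.wr (dcol P) false, true) :=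
      exec_put_true _ _ _
    show Q _
    rw [this]; exact h2

theorem stepConfig_nxt {c : OTMConfig P} {r} (hr : P.trans c.state (P.readSymbols c) = some r) :
    P.stepConfig c = nxt c r := by
  unfold OTMProgram.stepConfig
  rw [hr]
  rfl

theorem stepConfig_none {c : OTMConfig P} (hr : P.trans c.state (P.readSymbols c) = none) :
    P.stepConfig c = c := by
  unfold OTMProgram.stepConfig
  rw [hr]

/-- The stage lemma. -/
theorem compile_stage {c : OTMConfig P} {m : Mem} (hm : CRel P c m) :
    CRel P (P.stepConfig c) (stage (compile P) m).1 ∧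
    (∀ k, Btw P c (P.stepConfig c) (pref (compile P) k m).1) ∧
    ((stage (compile P) m).2 = true ↔
      P.trans (P.stepConfig c).state (P.readSymbols (P.stepConfig c)) = none) := by
  set c' := P.stepConfig c with hc'
  have hmem : ∀ c : OTMConfig P, (c.state, P.readSymbols c) ∈ allPairs P := fun c => by
    simp [allPairs]
  -- first clear
  have w1 := Mid.wrD hm false
  obtain ⟨x1, x2⟩ := clrD_run (P := P) (Q := Btw P c c') m false (CRel.mid hm).btw (CRel.mid w1.1).btw
  -- main blocks
  obtain ⟨m2, acc2, y1, y2, y3⟩ : ∃ m' acc', execL (blocks P true (allPairs P))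
      (m.wr (dcol P) false, true) = (m', acc') ∧ CRel P c' m' ∧
      Along (Btw P c c') (blocks P true (allPairs P)) (m.wr (dcol P) false, true) := by
    cases hr : P.trans c.state (P.readSymbols c) with
    | none =>
      have : c' = c := stepConfig_none hr
      rw [this]
      obtain ⟨a, h1, h2⟩ := blocks_skip (Q := Btw P c c) (c := c) true true (Or.inr w1.1)
        (Mid.btw w1.1) (allPairs P) (Or.inr (Or.inl hr))
      exact ⟨_, a, h1, w1.1, h2⟩
    | some r =>
      have : c' = nxt c r := stepConfig_nxt hr
      rw [this]
      obtain ⟨m', a, h1, h2, h3, h4⟩ := blocks_fire true true w1.1 w1.2 hr (allPairs P) (hmem c)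
      exact ⟨m', a, h1, h2, h4⟩
  have w2 := Mid.wrD y2 false
  obtain ⟨z1, z2⟩ := clrD_run (P := P) (Q := Btw P c c') m2 acc2 y2.btw' (CRel.btw' w2.1)
  obtain ⟨m3, acc3, u1, u2, u3, u4⟩ : ∃ m' acc', execL (blocks P false (allPairs P))
      (m2.wr (dcol P) false, true) = (m', acc') ∧ CRel P c' m' ∧
      Along (Btw P c' c') (blocks P false (allPairs P)) (m2.wr (dcol P) false, true) ∧
      (m'.rd (dcol P) = false ↔ P.trans c'.state (P.readSymbols c') = none) := by
    cases hr : P.trans c'.state (P.readSymbols c') with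
    | none =>
      obtain ⟨a, h1, h2⟩ := blocks_skip (Q := Btw P c' c') (c := c') false true (Or.inr w2.1)
        (Mid.btw w2.1) (allPairs P) (Or.inr (Or.inl hr))
      exact ⟨_, a, h1, w2.1, h2, by simp [w2.2]⟩
    | some r =>
      obtain ⟨m', a, h1, h2, h3, h4⟩ := blocks_fire false true w2.1 w2.2 hr (allPairs P) (hmem c')
      exact ⟨m', a, h1, h2, h4, by simp [h3]⟩
  have u3' : Along (Btw P c c') (blocks P false (allPairs P)) (m2.wr (dcol P) false, true) :=
    u3.imp fun m h => ⟨fun t => Or.inr (by simpa using h.h t), fun t i => Or.inr (by simpa using h.T t i),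
      fun s hs => Or.inr (by simpa using h.b s hs), h.hb⟩
  have last : exec (exec (m3, acc3) (Op.one, 0)) (tst false (dcol P)) =
      (m3, true && (m3.rd (dcol P) == false)) := exec_tst _ _ _ _
  have full : stage (compile P) m = (m3, m3.rd (dcol P) == false) := by
    unfold stage compile
    rw [execL_append, x1, execL_append, y1, execL_append, z1, execL_append, u1]
    show exec (exec (m3, acc3) (Op.one, 0)) (tst false (dcol P)) = _
    rw [last]; simp
  refine ⟨by rw [full]; exact u2, ?_, ?_⟩
  · intro k
    refine Along.pref (s := (m, false)) ?_ k
    refine x2.append ?_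
    rw [x1]
    refine y3.append ?_
    rw [y1]
    refine z2.append ?_
    rw [z1]
    refine u3'.append ?_
    rw [u1]
    refine ⟨u2.btw', u2.btw', ?_⟩
    show Btw P c c' _
    rw [last]
    exact u2.btw'
  · rw [full, ← u4]
    simp

theorem run_zero : P.run 0 = P.initConfig := by
  unfold OTMProgram.run; rw [Ordinal.limitRecOn_zero]

theorem run_succ (σ : Ordinal.{0}) : P.run (σ + 1) = P.stepConfig (P.run σ) := by
  unfold OTMProgram.run; rw [Ordinal.limitRecOn_add_one]

theorem run_limit {lam : Ordinal.{0}} (h : IsSuccLimit lam) :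
    P.run lam = P.limitConfig lam (fun β _ => P.run β) := by
  unfold OTMProgram.run; rw [Ordinal.limitRecOn_limit _ _ _ _ h]

theorem run_limit_head {lam : Ordinal.{0}} (h : IsSuccLimit lam) (t : Fin P.tapes) :
    (P.run lam).head t = liminfAt lam (fun σ => (P.run σ).head t) := by
  rw [run_limit h]
  exact liminfAt_congr fun i hi => by simp [hi]

theorem run_limit_tape {lam : Ordinal.{0}} (h : IsSuccLimit lam) (t : Fin P.tapes) (x) :
    (P.run lam).tape t x = boolLiminfAt lam (fun σ => (P.run σ).tape t x) := by
  rw [run_limit h]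
  exact boolLiminfAt_congr fun i hi => by simp [hi]

/-- the liminf of the states -/
theorem run_limit_state {lam : Ordinal.{0}} (h : IsSuccLimit lam) :
    (∃ γ < lam, ∀ i, γ ≤ i → i < lam → (P.run lam).state ≤ (P.run i).state) ∧
      (∀ γ < lam, ∃ i, γ ≤ i ∧ i < lam ∧ (P.run i).state = (P.run lam).state) := by
  obtain ⟨n, h1, h2⟩ := exists_natLiminf (α := lam) h.bot_lt
    (s := fun i => if h : i < lam then ((P.run i).state : ℕ) else 0) (N := P.states)
    (fun i hi => by simp only [hi, dif_pos]; omega)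
  have e := natLiminfAt_eq h1 h2
  have hn : n < P.states + 1 := by
    obtain ⟨i, _, hi, h3⟩ := h2 0 h.bot_lt
    simp only [hi, dif_pos] at h3; omega
  have e2 : (P.run lam).state = ⟨n, hn⟩ := by
    rw [run_limit h]
    apply Fin.ext
    show natLiminfAt _ _ % _ = n
    rw [e]
    exact Nat.mod_eq_of_lt hn
  rw [e2]
  constructor
  · obtain ⟨γ, hγ, h3⟩ := h1
    exact ⟨γ, hγ, fun i a b => by have := h3 i a b; simpa [b, Fin.le_def] using this⟩
  · intro γ hγ
    obtain ⟨i, a, b, h3⟩ := h2 γ hγ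
    exact ⟨i, a, b, by apply Fin.ext; simpa [b] using h3⟩

theorem compile_rel (σ : Ordinal.{0}) : CRel P (P.run σ) (absRun (compile P) σ) := by
  induction σ using Ordinal.limitRecOn with
  | zero =>
    rw [absRun_zero, run_zero]
    refine ⟨by simp [Mem.zero, OTMProgram.initConfig], by simp, ?_, by simp, ?_, by simp, by simp [Mem.zero]⟩
    · intro t _; rfl
    · intro s hs _; simp [Mem.zero, OTMProgram.initConfig]
  | add_one σ ih =>
    rw [absRun_succ, run_succ]
    exact (compile_stage ih).1
  | limit lam hl ih =>
    have hbt : ∀ σ < lam, ∀ k, Btw P (P.run σ) (P.run (σ + 1)) (pref (compile P) k (absRun (compile P) σ)).1 := by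
      intro σ hσ k
      rw [run_succ]
      exact (compile_stage (ih σ hσ)).2.1 k
    have hs1 : ∀ σ < lam, σ + 1 < lam := fun σ h => hl.add_one_lt h
    have p0 : ∀ σ, (pref (compile P) 0 (absRun (compile P) σ)).1 = absRun (compile P) σ := fun σ => rfl
    refine ⟨fun t _ => ?_, by simp, fun t _ => ?_, by simp, fun s hs _ => ?_, by simp, fun s hs => ?_⟩
    · refine eq_of_forall_lt_iff fun x => ?_
      rw [absRun_limit_h _ hl, run_limit_head hl, lt_liminfAt_iff]
      constructor
      · rintro ⟨γ, hγ, h⟩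
        refine ⟨γ, hγ, fun i a b => ?_⟩
        have := h i a b 0
        rwa [p0, (ih i b).h0 t (by simp)] at this
      · rintro ⟨γ, hγ, h⟩
        refine ⟨γ, hγ, fun i a b k => ?_⟩
        rcases (hbt i b k).h t with e | e <;> rw [e]
        · exact h i a b
        · exact h (i + 1) (a.trans le_self_add) (hs1 i b)
    · funext x
      rw [Bool.eq_iff_iff, absRun_limit_T _ hl, run_limit_tape hl, boolLiminfAt_iff]
      constructor
      · rintro ⟨γ, hγ, h⟩
        refine ⟨γ, hγ, fun i a b => ?_⟩
        have := h i a b 0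
        rwa [p0, (ih i b).T0 t (by simp)] at this
      · rintro ⟨γ, hγ, h⟩
        refine ⟨γ, hγ, fun i a b k => ?_⟩
        rcases (hbt i b k).T t x with e | e <;> rw [e]
        · exact h i a b
        · exact h (i + 1) (a.trans le_self_add) (hs1 i b)
    · rw [Bool.eq_iff_iff, absRun_limit_T _ hl, decide_eq_true_eq]
      obtain ⟨⟨γ1, hγ1, s1⟩, s2⟩ := run_limit_state (P := P) hl
      constructor
      · rintro ⟨γ, hγ, h⟩
        obtain ⟨i, a, b, e⟩ := s2 γ hγ
        have := h i a b 0
        rw [p0, (ih i b).b0 s hs (by simp)] at this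
        rw [← e]; simpa using this
      · intro h
        refine ⟨γ1, hγ1, fun i a b k => ?_⟩
        rcases (hbt i b k).b s hs with e | e <;> rw [e]
        · have := s1 i a b; rw [Fin.le_def] at this; simp; omega
        · have := s1 (i + 1) (a.trans le_self_add) (hs1 i b); rw [Fin.le_def] at this; simp; omega
    · by_contra hne
      have : 0 < (absRun (compile P) lam).h (P.tapes + s) := pos_iff_ne_zero.2 hne
      rw [absRun_limit_h _ hl] at this
      obtain ⟨γ, hγ, h⟩ := this
      have := h γ le_rfl hγ 0
      rw [p0, (ih γ hγ).hb s hs] at this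
      exact lt_irrefl _ this

theorem compile_ev (σ : Ordinal.{0}) : ev (compile P) σ ↔ P.haltedAt (σ + 1) := by
  unfold ev OTMProgram.haltedAt
  rw [run_succ]
  exact (compile_stage (compile_rel σ)).2.2

theorem compile_firstEvent {α : Ordinal.{0}} (h : P.haltsAt (α + 1)) : firstEvent (compile P) α := by
  refine ⟨(compile_ev α).2 h.1, fun σ hσ h' => ?_⟩
  refine h.2 (σ + 1) ?_ ((compile_ev σ).1 h')
  simpa using hσ

end Compile

end GapU

namespace GapU
open Order

/-! ### The universal machine -/

inductive Mode where
  | find (op : Op) (acc : Bool) | cl0 | cl1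
  deriving DecidableEq

inductive Knd where
  | nrm (acc : Bool) | dec
  deriving DecidableEq

inductive St where
  | start0 | N0 | H | E0 | E1 | E2 | E3 | E4
  | F (k : Knd) | Hb (k : Knd)
  | PRE (m : Mode) | SKa (m : Mode) | SKb (m : Mode) | SEEK (m : Mode) | RET (m : Mode)
  | RETD | D1 | D2 | TK (acc : Bool) | TKh
  deriving DecidableEq

inductive Gr where
  | R | Y | X | K
  deriving DecidableEq

inductive Tr where
  | zr | s | a | q | zy | tt | mm | vv | zx | b (i : Fin 4) | d | g | bb
  deriving DecidableEq, Fintype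

open Tr

def grp : Tr → Gr
  | zr => .R | s => .R | a => .R | q => .R
  | zy => .Y | tt => .Y | mm => .Y | vv => .Y
  | zx => .X | b _ => .X
  | d => .K | g => .K | bb => .K

def dir (r y x : Bool) : Gr → Bool
  | .R => r | .Y => y | .X => x | .K => false

def sym (rd : Tr → Bool) : ℕ :=
  (rd (b 0)).toNat + 2 * (rd (b 1)).toNat + 4 * (rd (b 2)).toNat + 8 * (rd (b 3)).toNat

def wsym (v : ℕ) (rd : Tr → Bool) : Tr → Bool
  | b i => v.testBit i
  | tr => rd tr

def opOf : ℕ → Option Op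
  | 2 => some .one | 3 => some .and | 4 => some .andn | 5 => some .set
  | 6 => some .clr | 7 => some .inc | 8 => some .dec
  | _ => none

def newacc (op : Op) (acc v : Bool) : Bool :=
  match op with
  | .one => true
  | .and => acc && v
  | .andn => acc && !v
  | _ => acc

def newtt (op : Op) (acc v : Bool) : Bool :=
  match op with
  | .set => acc || v
  | .clr => v && !acc
  | _ => v

def newmm (op : Op) (acc : Bool) : Bool :=
  match op with
  | .inc => acc
  | _ => false

abbrev Res := Option (St × (Tr → Bool) × (Gr → Bool))

abbrev upd (rd : Tr → Bool) (tr : Tr) (v : Bool) : Tr → Bool := Function.update rd tr v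

def base (st : St) (rd : Tr → Bool) : Res :=
  match st with
  | .start0 => some (.N0, upd (upd (upd rd zr true) zy true) zx true, dir false false false)
  | .N0 => if !rd d && rd g then some (.H, rd, dir false false false)
      else some (.F (.nrm false), upd (upd rd g (rd g || !rd d)) d false, dir false false false)
  | .H => none
  | .F k => if rd zr && rd zy then
        match k with
        | .nrm acc =>
          match opOf (sym rd) with
          | some op => some (.PRE (.find op acc), rd, dir false false true)
          | none => some (.TK acc, rd, dir false false false)
        | .dec => some (.PRE .cl0, rd, dir false false true)
      else some (.Hb k, rd, dir false false true)
  | .Hb k => some (.F k, rd, dir false false false)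
  | .PRE m => some (.SKa m, upd rd bb false, dir false false false)
  | .SKa m => if rd bb then some (.SKb m, upd rd bb false, dir true true true)
      else if m = .cl0 ∧ rd q = true then
        some (.SEEK .cl1, upd (upd rd bb true) q false, dir true true true)
      else some (.SEEK m, upd rd bb true, dir true true true)
  | .SKb m => some (.SKa m, upd rd bb true, dir false true false)
  | .SEEK m => if sym rd = 1 then some (.SEEK m, rd, dir true true true)
      else match m with
      | .find op acc =>
        if rd mm then some (.RET m, rd, dir true true false)
        else if op = .dec ∧ acc = true then some (.RETD, rd, dir false false false)
        else some (.Hb (.nrm (newacc op acc (rd tt))),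
          upd (upd rd tt (newtt op acc (rd tt))) mm (newmm op acc), dir false false true)
      | .cl0 => some (.RET .cl0, rd, dir true true false)
      | .cl1 => if rd mm then some (.RET .cl1, upd rd mm false, dir true true false)
        else some (.Hb (.nrm true), rd, dir false false true)
  | .RET m => if sym rd = 1 then some (.RET m, rd, dir false true false)
      else some (.SKb m, rd, dir true true true)
  | .RETD => if sym rd = 1 then some (.RETD, rd, dir false false false)
      else some (.D1, rd, dir false false true)
  | .D1 => some (.D2, rd, dir false false false)
  | .D2 => some (.Hb .dec, upd rd q true, dir false false true)
  | .TK acc => if rd s then some (.TK acc, rd, dir true false false)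
      else if rd a then
        if acc then some (.E0, rd, dir false false false)
        else some (.TKh, upd rd s true, dir false false false)
      else if acc then some (.E0, upd (upd rd a true) g false, dir false false false)
        else some (.E0, rd, dir false false false)
  | .TKh => if rd zr && rd zx then some (.F (.nrm false), rd, dir false false false)
      else some (.TKh, rd, dir false false false)
  | .E0 => if rd zr && rd zx then some (.E1, rd, dir false false false)
      else some (.E0, rd, dir false false false)
  | .E1 => if rd s || rd vv then
        some (.E1, upd (upd (upd (upd rd s false) vv false) tt false) mm false, dir true true false)
      else some (.E2, rd, dir false false false)
  | .E2 => if rd zr && rd zy then some (.E3, rd, dir false false false)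
      else some (.E2, rd, dir false false false)
  | .E3 => if sym rd = 15 then some (.E3, wsym 0 rd, dir false false true)
      else some (.E4, wsym (sym rd + 1) rd, dir false false false)
  | .E4 => if rd zx then some (.N0, upd rd d true, dir false false false)
      else some (.E4, rd, dir false false false)

def opCode : Op → ℕ
  | .one => 0 | .and => 1 | .andn => 2 | .set => 3 | .clr => 4 | .inc => 5 | .dec => 6

def modeCode : Mode → ℕ
  | .find op acc => 2 * opCode op + acc.toNat
  | .cl0 => 14
  | .cl1 => 15

def code : St → ℕ
  | .start0 => 0 | .N0 => 1 | .H => 2 | .E0 => 3 | .E1 => 4 | .E2 => 5 | .E3 => 6 | .E4 => 7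
  | .F (.nrm false) => 8
  | .SKa m => 10 + modeCode m
  | .SKb m => 30 + modeCode m
  | .SEEK m => 50 + modeCode m
  | .RET m => 70 + modeCode m
  | .PRE m => 90 + modeCode m
  | .F (.nrm true) => 110 | .F .dec => 111
  | .Hb (.nrm false) => 112 | .Hb (.nrm true) => 113 | .Hb .dec => 114
  | .RETD => 115 | .D1 => 116 | .D2 => 117
  | .TK false => 118 | .TK true => 119 | .TKh => 120

theorem opCode_lt (o : Op) : opCode o < 7 := by cases o <;> decide

theorem modeCode_lt (m : Mode) : modeCode m < 16 := by
  rcases m with ⟨o, b⟩ | _ | _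
  · have := opCode_lt o; cases b <;> simp [modeCode] <;> omega
  · decide
  · decide

theorem opCode_inj : Function.Injective opCode := by
  intro a b h; revert h; cases a <;> cases b <;> decide

theorem modeCode_inj : Function.Injective modeCode := by
  intro a b h
  rcases a with ⟨o, b1⟩ | _ | _ <;> rcases b with ⟨o', b2⟩ | _ | _
  · have : o = o' := opCode_inj (by cases b1 <;> cases b2 <;> simp [modeCode] at h <;> omega)
    subst this
    cases b1 <;> cases b2 <;> simp [modeCode] at h ⊢
  all_goals first
    | rfl
    | (exfalso; simp [modeCode] at h; done)
    | (exfalso; have := opCode_lt o; cases b1 <;> simp [modeCode] at h <;> omega)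
    | (exfalso; have := opCode_lt o'; cases b2 <;> simp [modeCode] at h <;> omega)

def decodeFn (n : ℕ) : St :=
  open scoped Classical in if h : ∃ st, code st = n then Classical.choose h else .start0

theorem code_lt (st : St) : code st < 200 := by
  unfold code
  split
  all_goals first
    | decide
    | (rename_i m; have := modeCode_lt m; omega)

theorem code_inj : Function.Injective code := by
  intro x y h
  rcases x with _ | _ | _ | _ | _ | _ | _ | _ | ⟨⟨⟨⟩⟩ | _⟩ | ⟨⟨⟨⟩⟩ | _⟩ | m | m | m | m | m | _ | _ | _ | ⟨⟨⟩⟩ | _ <;>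
  rcases y with _ | _ | _ | _ | _ | _ | _ | _ | ⟨⟨⟨⟩⟩ | _⟩ | ⟨⟨⟨⟩⟩ | _⟩ | m' | m' | m' | m' | m' | _ | _ | _ | ⟨⟨⟩⟩ | _ <;>
  first
    | rfl
    | (exfalso; revert h; simp [code]; done)
    | (exfalso; have := modeCode_lt m; simp [code] at h; omega)
    | (exfalso; have := modeCode_lt m'; simp [code] at h; omega)
    | (exfalso; have := modeCode_lt m; have := modeCode_lt m'; simp [code] at h; omega)
    | (have : m = m' := modeCode_inj (by simpa [code] using h)
       rw [this])

theorem decode_code (st : St) : decodeFn (code st) = st := by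
  have h : ∃ s', code s' = code st := ⟨st, rfl⟩
  unfold decodeFn
  rw [dif_pos h]
  exact code_inj (Classical.choose_spec h)

def trans (st : St) (rd : Tr → Bool) : Res :=
  (base st rd).map fun r => (r.1, if 8 ≤ code st then upd r.2.1 vv true else r.2.1, r.2.2)

def trE : Tr ≃ Fin (Fintype.card Tr) := Fintype.equivFin Tr

def U : OTMProgram where
  tapes := Fintype.card Tr
  states := 199
  trans q f := (trans (decodeFn q) (fun tr => f (trE tr))).map fun r =>
    (⟨code r.1, code_lt _⟩, fun t => r.2.1 (trE.symm t), fun t => r.2.2 (grp (trE.symm t)))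

def rep : Gr → Tr
  | .R => s | .Y => tt | .X => zx | .K => d

def st (t : Ordinal.{0}) : St := decodeFn (U.run t).state
def hd (γ : Gr) (t : Ordinal.{0}) : Ordinal.{0} := (U.run t).head (trE (rep γ))
def tp (tr : Tr) (t : Ordinal.{0}) : Ordinal.{0} → Bool := (U.run t).tape (trE tr)
def rd (t : Ordinal.{0}) (tr : Tr) : Bool := tp tr t (hd (grp tr) t)

theorem grp_rep (γ : Gr) : grp (rep γ) = γ := by cases γ <;> rfl

theorem run_head (t : Ordinal.{0}) (tr : Tr) : (U.run t).head (trE tr) = hd (grp tr) t := by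
  unfold hd
  induction t using Ordinal.limitRecOn with
  | zero => rw [run_zero]; rfl
  | add_one t ih =>
    rw [run_succ]
    unfold OTMProgram.stepConfig
    split
    · exact ih
    · next s' w mv heq =>
      simp only [U, Option.map_eq_some_iff, Prod.mk.injEq] at heq
      obtain ⟨r, _, _, _, rfl⟩ := heq
      simp only [Equiv.symm_apply_apply, grp_rep]
      rw [ih]
  | limit lam hl ih =>
    refine (run_limit_head (P := U) hl (trE tr)).trans
      (Eq.trans ?_ (run_limit_head (P := U) hl (trE (rep (grp tr)))).symm)
    exact liminfAt_congr fun i hi => ih i hi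

theorem run_read (t : Ordinal.{0}) : (fun tr => U.readSymbols (U.run t) (trE tr)) = rd t := by
  funext tr
  unfold OTMProgram.readSymbols rd tp
  rw [run_head]

theorem code_st (t : Ordinal.{0}) : code (st t) = (U.run t).state := by
  unfold st
  induction t using Ordinal.limitRecOn with
  | zero => rw [run_zero]; exact congrArg code (decode_code .start0)
  | add_one t ih =>
    rw [run_succ]
    unfold OTMProgram.stepConfig
    split
    · exact ih
    · next s' w mv heq =>
      simp only [U, Option.map_eq_some_iff, Prod.mk.injEq] at heq
      obtain ⟨r, _, rfl, _, _⟩ := heq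
      simp only [decode_code]
  | limit lam hl ih =>
    obtain ⟨i, _, h1, h2⟩ := (run_limit_state (P := U) hl).2 0 hl.bot_lt
    rw [← h2]; exact ih i h1

theorem halted_iff (t : Ordinal.{0}) : U.haltedAt t ↔ trans (st t) (rd t) = none := by
  unfold OTMProgram.haltedAt
  rw [← run_read]
  show (Option.map _ _) = none ↔ _
  rw [Option.map_eq_none_iff]
  rfl

theorem U_trans (t : Ordinal.{0}) : U.trans (U.run t).state (U.readSymbols (U.run t)) =
    (trans (st t) (rd t)).map fun r =>
    (⟨code r.1, code_lt _⟩, fun t => r.2.1 (trE.symm t), fun t => r.2.2 (grp (trE.symm t))) := by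
  rw [← run_read]; rfl

theorem step_none {t : Ordinal.{0}} (h : trans (st t) (rd t) = none) : U.run (t + 1) = U.run t := by
  rw [run_succ]
  have := U_trans t
  rw [h] at this
  exact stepConfig_none this

theorem step_some {t : Ordinal.{0}} {s' w mv} (h : trans (st t) (rd t) = some (s', w, mv)) :
    st (t + 1) = s' ∧ (∀ γ, hd γ (t + 1) = if mv γ then hd γ t + 1 else leftOf (hd γ t)) ∧
    (∀ tr x, tp tr (t + 1) x = if x = hd (grp tr) t then w tr else tp tr t x) := by
  have h2 := U_trans t
  rw [h] at h2
  have h3 := stepConfig_nxt h2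
  refine ⟨?_, ?_, ?_⟩
  · unfold st; rw [run_succ, h3]; exact decode_code s'
  · intro γ
    unfold hd; rw [run_succ, h3]
    simp only [nxt, Equiv.symm_apply_apply, grp_rep]
  · intro tr x
    unfold tp; rw [run_succ, h3, ← run_head]
    simp only [nxt, Equiv.symm_apply_apply]

theorem st_zero : st 0 = .start0 := by
  unfold st; rw [run_zero]; exact decode_code .start0
theorem hd_zero (γ : Gr) : hd γ 0 = 0 := by unfold hd; rw [run_zero]; rfl
theorem tp_zero (tr : Tr) (x) : tp tr 0 x = false := by unfold tp; rw [run_zero]; rfl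

theorem hd_limit {T : Ordinal.{0}} (h : IsSuccLimit T) (γ : Gr) :
    hd γ T = liminfAt T (hd γ) := run_limit_head h _

theorem tp_limit {T : Ordinal.{0}} (h : IsSuccLimit T) (tr : Tr) (x) :
    tp tr T x = true ↔ ∃ ρ < T, ∀ i, ρ ≤ i → i < T → tp tr i x = true := by
  rw [show tp tr T x = _ from run_limit_tape h _ x, boolLiminfAt_iff]; rfl

theorem st_limit {T : Ordinal.{0}} (h : IsSuccLimit T) {σ : St}
    (h1 : ∃ ρ < T, ∀ i, ρ ≤ i → i < T → code σ ≤ code (st i))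
    (h2 : ∀ ρ < T, ∃ i, ρ ≤ i ∧ i < T ∧ st i = σ) : st T = σ := by
  obtain ⟨⟨ρ1, a1, a2⟩, a3⟩ := run_limit_state (P := U) h
  obtain ⟨ρ2, b1, b2⟩ := h1
  apply code_inj
  apply le_antisymm
  · obtain ⟨i, c1, c2, c3⟩ := h2 ρ1 a1
    have := a2 i c1 c2
    rw [Fin.le_def] at this
    rw [← c3, code_st, code_st]; exact this
  · obtain ⟨i, c1, c2, c3⟩ := a3 ρ2 b1
    rw [code_st T, ← c3, ← code_st]
    exact b2 i c1 c2

theorem st_limit_const {T : Ordinal.{0}} (h : IsSuccLimit T) {σ : St}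
    (h1 : ∃ ρ < T, ∀ i, ρ ≤ i → i < T → st i = σ) : st T = σ := by
  obtain ⟨ρ, a, h1⟩ := h1
  refine st_limit h ⟨ρ, a, fun i b c => by rw [h1 i b c]⟩ fun ρ' h' => ?_
  exact ⟨max ρ ρ', le_max_right _ _, max_lt a h', h1 _ (le_max_left _ _) (max_lt a h')⟩

theorem tp_limit_const {T : Ordinal.{0}} (h : IsSuccLimit T) {tr x v}
    (h1 : ∃ ρ < T, ∀ i, ρ ≤ i → i < T → tp tr i x = v) : tp tr T x = v := by
  obtain ⟨ρ, a, h1⟩ := h1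
  cases v
  · rw [← Bool.not_eq_true, tp_limit h]
    rintro ⟨ρ', a', h2⟩
    have e1 := h2 _ (le_max_right ρ ρ') (max_lt a a')
    rw [h1 _ (le_max_left ρ ρ') (max_lt a a')] at e1
    simp at e1
  · rw [tp_limit h]; exact ⟨ρ, a, h1⟩

theorem tp_limit_false {T : Ordinal.{0}} (h : IsSuccLimit T) {tr x}
    (h1 : ∀ ρ < T, ∃ i, ρ ≤ i ∧ i < T ∧ tp tr i x = false) : tp tr T x = false := by
  rw [← Bool.not_eq_true, tp_limit h]
  rintro ⟨ρ, a, h2⟩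
  obtain ⟨i, b, c, e⟩ := h1 ρ a
  rw [h2 i b c] at e; simp at e

theorem hd_limit_eq {T : Ordinal.{0}} (h : IsSuccLimit T) {γ : Gr} {o : Ordinal.{0}}
    (h1 : ∀ x < o, ∃ ρ < T, ∀ i, ρ ≤ i → i < T → x < hd γ i)
    (h2 : ∀ ρ < T, ∃ i, ρ ≤ i ∧ i < T ∧ hd γ i ≤ o) : hd γ T = o := by
  rw [hd_limit h]
  apply le_antisymm
  · exact liminfAt_le h2
  · refine le_of_forall_lt fun x hx => ?_
    rw [lt_liminfAt_iff]; exact h1 x hx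

/-- which tracks a state may write -/
def writes : Tr → St → Prop
  | zr, t => t = .start0
  | zy, t => t = .start0
  | zx, t => t = .start0
  | s, t => (∃ c, t = .TK c) ∨ t = .E1
  | a, t => ∃ c, t = .TK c
  | q, t => (∃ m, t = .SKa m) ∨ t = .D2
  | tt, t => (∃ m, t = .SEEK m) ∨ t = .E1
  | mm, t => (∃ m, t = .SEEK m) ∨ t = .E1
  | vv, t => 8 ≤ code t ∨ t = .E1
  | b _, t => t = .E3
  | d, t => t = .N0 ∨ t = .E4
  | g, t => t = .N0 ∨ ∃ c, t = .TK c
  | bb, t => ∃ m, t = .SKa m ∨ t = .SKb m ∨ t = .PRE m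

theorem base_keep {σ : St} {rd : Tr → Bool} {s' w mv} (h : base σ rd = some (s', w, mv)) {tr : Tr}
    (h2 : tr ≠ vv ∨ σ ≠ .E1) (hw : tr ≠ vv → ¬ writes tr σ) : w tr = rd tr := by
  unfold base at h
  split at h <;> (try split at h) <;> (try split at h) <;> (try split at h) <;> (try split at h) <;>
    simp only [Option.some.injEq, Prod.mk.injEq, reduceCtorEq] at h <;>
    first
    | (obtain ⟨-, rfl, -⟩ := h; rfl)
    | (obtain ⟨-, rfl, -⟩ := h; cases tr <;> first | rfl | (exfalso; simp [writes] at hw; done) | (exfalso; simp at h2; done))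
    | exact absurd h id

theorem step_keep (t : Ordinal.{0}) {tr : Tr} (h : ¬ writes tr (st t)) :
    tp tr (t + 1) = tp tr t := by
  cases hb : base (st t) (rd t) with
  | none =>
    have : trans (st t) (rd t) = none := by simp [trans, hb]
    unfold tp; rw [step_none this]
  | some r =>
    obtain ⟨s', w, mv⟩ := r
    have h1 : trans (st t) (rd t) = some (s', if 8 ≤ code (st t) then upd w vv true else w, mv) := by
      simp [trans, hb]
    obtain ⟨-, -, h2⟩ := step_some h1
    funext x
    rw [h2]
    split_ifs with hx hc
    · by_cases e : tr = vv
      · subst e; exact absurd (Or.inl hc) h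
      · rw [upd, Function.update_of_ne e, base_keep hb (Or.inl e) (fun _ => h), hx]; rfl
    · rw [hx]
      refine base_keep hb ?_ (fun _ => h)
      by_cases e : tr = vv
      · subst e; right; intro e; exact h (Or.inr e)
      · exact Or.inl e
    · rfl

/-- persistence of a track along an interval -/
theorem keep {t0 t : Ordinal.{0}} (hle : t0 ≤ t) {tr : Tr}
    (h : ∀ ρ, t0 ≤ ρ → ρ < t → ¬ writes tr (st ρ)) : tp tr t = tp tr t0 := by
  induction t using Ordinal.limitRecOn with
  | zero => rw [le_antisymm hle zero_le]
  | add_one t ih =>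
    rcases hle.lt_or_eq with hlt | rfl
    · have hle' : t0 ≤ t := Order.lt_add_one_iff.1 hlt
      rw [step_keep t (h t hle' (lt_add_one t)), ih hle' fun ρ a b => h ρ a (b.trans (lt_add_one t))]
    · rfl
  | limit t hl ih =>
    rcases hle.lt_or_eq with hlt | rfl
    · funext x
      refine tp_limit_const hl ⟨t0, hlt, fun i a b => ?_⟩
      rw [ih i b a fun ρ c e => h ρ c (e.trans b)]
    · rfl

end GapU

namespace GapU
open Order Tr

/-! ### Transfinite loops -/

/-- The situation at a limit `lam` of a loop, reached at time `T`. -/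
structure Lim (Pre : Ordinal.{0} → Ordinal.{0} → Prop)
    (Thr : Ordinal.{0} → Ordinal.{0} → Ordinal.{0} → Prop) (i0 lam T : Ordinal.{0}) : Prop where
  lim : IsSuccLimit T
  ev : ∀ i, i0 ≤ i → i < lam → ∃ s < T, Pre i s ∧ ∀ ρ, s ≤ ρ → ρ < T →
    ∃ j u u', i ≤ j ∧ j < lam ∧ u ≤ ρ ∧ ρ < u' ∧ u' < T ∧ Thr j u u'
  cof : ∀ ρ < T, ∃ i, i0 ≤ i ∧ i < lam ∧ ∀ j, i ≤ j → j < lam →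
    ∃ s s', ρ ≤ s ∧ s < s' ∧ s' < T ∧ Pre j s ∧ Pre (j + 1) s' ∧ Thr j s s'

section Loop
variable (Pre : Ordinal.{0} → Ordinal.{0} → Prop)
    (Thr : Ordinal.{0} → Ordinal.{0} → Ordinal.{0} → Prop) (t0 : Ordinal.{0})

def loopT (i0 o : Ordinal.{0}) : Ordinal.{0} :=
  Ordinal.limitRecOn o t0
    (fun i t => open scoped Classical in
      if h : ∃ t', t < t' ∧ Pre (i0 + i + 1) t' ∧ Thr (i0 + i) t t' then Classical.choose h else t)
    (fun lam _ ih => ⨆ i : Set.Iio lam, ih i.1 i.2)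

theorem loopT_zero (i0) : loopT Pre Thr t0 i0 0 = t0 := by
  unfold loopT; rw [Ordinal.limitRecOn_zero]

theorem loopT_succ (i0 i) (h : ∃ t', loopT Pre Thr t0 i0 i < t' ∧ Pre (i0 + i + 1) t' ∧
      Thr (i0 + i) (loopT Pre Thr t0 i0 i) t') :
    loopT Pre Thr t0 i0 i < loopT Pre Thr t0 i0 (i + 1) ∧
      Pre (i0 + i + 1) (loopT Pre Thr t0 i0 (i + 1)) ∧
      Thr (i0 + i) (loopT Pre Thr t0 i0 i) (loopT Pre Thr t0 i0 (i + 1)) := by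
  have : loopT Pre Thr t0 i0 (i + 1) = Classical.choose h := by
    have e : loopT Pre Thr t0 i0 (i + 1) = open scoped Classical in
      if h : ∃ t', loopT Pre Thr t0 i0 i < t' ∧ Pre (i0 + i + 1) t' ∧
        Thr (i0 + i) (loopT Pre Thr t0 i0 i) t' then Classical.choose h
        else loopT Pre Thr t0 i0 i := by
      unfold loopT; rw [Ordinal.limitRecOn_add_one]
    rw [e, dif_pos h]
  rw [this]
  exact Classical.choose_spec h

theorem loopT_limit (i0) {lam} (h : IsSuccLimit lam) :
    loopT Pre Thr t0 i0 lam = ⨆ i : Set.Iio lam, loopT Pre Thr t0 i0 i.1 := by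
  unfold loopT; rw [Ordinal.limitRecOn_limit _ _ _ _ h]

variable {Pre Thr t0}

theorem loop {i0 h : Ordinal.{0}} (hle : i0 ≤ h) (h0 : Pre i0 t0)
    (hs : ∀ i t, i0 ≤ i → i < h → t0 ≤ t → Pre i t → ∃ t', t < t' ∧ Pre (i + 1) t' ∧ Thr i t t')
    (hl : ∀ lam T, i0 < lam → lam ≤ h → IsSuccLimit lam → t0 < T → Lim Pre Thr i0 lam T →
      Pre lam T) :
    ∃ T, t0 ≤ T ∧ Pre h T ∧ (i0 < h → t0 < T) ∧ ∀ ρ, t0 ≤ ρ → ρ < T →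
      ∃ j u u', i0 ≤ j ∧ j < h ∧ u ≤ ρ ∧ ρ < u' ∧ u' ≤ T ∧ Thr j u u' := by
  obtain ⟨h', rfl⟩ : ∃ h', h = i0 + h' := ⟨h - i0, (Ordinal.add_sub_cancel_of_le hle).symm⟩
  set f := loopT Pre Thr t0 i0 with hf
  have main : ∀ i ≤ h', Pre (i0 + i) (f i) ∧ t0 ≤ f i ∧ (∀ j < i, f j < f i) ∧
      (∀ ρ, t0 ≤ ρ → ρ < f i → ∃ j < i, f j ≤ ρ ∧ ρ < f (j + 1)) ∧
      (∀ j < i, Pre (i0 + (j + 1)) (f (j + 1)) ∧ Thr (i0 + j) (f j) (f (j + 1))) := by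
    intro i hi
    induction i using Ordinal.limitRecOn with
    | zero =>
      rw [hf, loopT_zero]
      refine ⟨by simpa using h0, le_rfl, ?_, ?_, ?_⟩
      · intro j hj; exact absurd hj not_lt_zero
      · intro ρ a b; exact absurd a (not_le.2 b)
      · intro j hj; exact absurd hj not_lt_zero
    | add_one i ih =>
      have hi' : i < h' := lt_of_lt_of_le (lt_add_one i) hi
      obtain ⟨a1, a2, a3, a4, a5⟩ := ih hi'.le
      obtain ⟨b1, b2, b3⟩ := loopT_succ Pre Thr t0 i0 i
        (hs (i0 + i) (f i) le_self_add (by simpa using hi') a2 a1)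
      rw [← hf] at b1 b2 b3
      refine ⟨by rw [← add_assoc]; exact b2, a2.trans b1.le, ?_, ?_, ?_⟩
      · intro j hj
        rcases (Order.lt_add_one_iff.1 hj).lt_or_eq with h1 | rfl
        · exact (a3 j h1).trans b1
        · exact b1
      · intro ρ c1 c2
        rcases lt_or_ge ρ (f i) with h1 | h1
        · obtain ⟨j, d1, d2⟩ := a4 ρ c1 h1
          exact ⟨j, d1.trans (lt_add_one i), d2⟩
        · exact ⟨i, lt_add_one i, h1, c2⟩
      · intro j hj
        rcases (Order.lt_add_one_iff.1 hj).lt_or_eq with h1 | rfl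
        · exact a5 j h1
        · exact ⟨by rw [← add_assoc]; exact b2, b3⟩
    | limit lam hlam ih =>
      have e : f lam = ⨆ i : Set.Iio lam, f i.1 := loopT_limit Pre Thr t0 i0 hlam
      have hlt : ∀ j < lam, f j < f lam := by
        intro j hj
        have hj1 : j + 1 < lam := hlam.add_one_lt hj
        have h1 : f j < f (j + 1) := (ih (j + 1) hj1 (hj1.le.trans hi)).2.2.1 j (lt_add_one j)
        refine h1.trans_le ?_
        rw [e]
        exact Ordinal.le_iSup (fun i : Set.Iio lam => f i.1) ⟨j + 1, hj1⟩
      have hex : ∀ ρ < f lam, ∃ j < lam, ρ < f j := by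
        intro ρ hρ
        rw [e, Ordinal.lt_iSup_iff] at hρ
        obtain ⟨⟨j, hj⟩, hj2⟩ := hρ
        exact ⟨j, hj, hj2⟩
      have h00 : f 0 = t0 := loopT_zero Pre Thr t0 i0
      have hpos : (0 : Ordinal.{0}) < lam := hlam.bot_lt
      have ht0 : t0 < f lam := by rw [← h00]; exact hlt 0 hpos
      have hmono : ∀ j k, j < k → k < lam → f j < f k := fun j k h1 h2 =>
        (ih k h2 (h2.le.trans hi)).2.2.1 j h1
      have q4 : ∀ ρ, t0 ≤ ρ → ρ < f lam → ∃ j < lam, f j ≤ ρ ∧ ρ < f (j + 1) := by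
        intro ρ c1 c2
        obtain ⟨k, k1, k2⟩ := hex ρ c2
        obtain ⟨j, d1, d2⟩ := (ih k k1 (k1.le.trans hi)).2.2.2.1 ρ c1 k2
        exact ⟨j, d1.trans k1, d2⟩
      have q5 : ∀ j < lam, Pre (i0 + (j + 1)) (f (j + 1)) ∧ Thr (i0 + j) (f j) (f (j + 1)) := by
        intro j hj
        have hj1 : j + 1 < lam := hlam.add_one_lt hj
        exact (ih (j + 1) hj1 (hj1.le.trans hi)).2.2.2.2 j (lt_add_one j)
      have q1 : ∀ j < lam, Pre (i0 + j) (f j) := fun j hj => (ih j hj (hj.le.trans hi)).1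
      have cvt : ∀ i, i0 ≤ i → i < i0 + lam → ∃ j < lam, i = i0 + j := by
        intro i h1 h2
        refine ⟨i - i0, ?_, (Ordinal.add_sub_cancel_of_le h1).symm⟩
        rw [← Ordinal.add_sub_cancel_of_le h1] at h2
        simpa using h2
      have hT : IsSuccLimit (f lam) := by
        refine ⟨?_, ?_⟩
        · intro hmin
          have : f lam ≤ t0 := by
            have h3 : f lam = 0 := by simpa using hmin
            rw [h3]; exact zero_le
          exact absurd ht0 (not_lt.2 this)
        · intro b hb
          obtain ⟨j, hj, hj2⟩ := hex b hb.lt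
          exact hb.2 hj2 (hlt j hj)
      refine ⟨?_, ht0.le, hlt, q4, q5⟩
      refine hl (i0 + lam) (f lam) (by simpa using hpos) (by simpa using hi)
        (Ordinal.isSuccLimit_add _ hlam) ht0 ⟨hT, ?_, ?_⟩
      · intro i h1 h2
        obtain ⟨i, h2', rfl⟩ := cvt i h1 h2; clear h2; rename' h2' => h2
        refine ⟨f i, hlt i h2, q1 i h2, ?_⟩
        intro ρ c1 c2
        have : t0 ≤ f i := (ih i h2 (h2.le.trans hi)).2.1
        obtain ⟨j, d1, d2, d3⟩ := q4 ρ (this.trans c1) c2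
        refine ⟨i0 + j, f j, f (j + 1), ?_, by simpa using d1, d2, d3, hlt _ (hlam.add_one_lt d1),
          (q5 j d1).2⟩
        simp only [add_le_add_iff_left]
        by_contra hc
        have hc1 : j + 1 ≤ i := Order.add_one_le_of_lt (not_le.1 hc)
        have : f (j + 1) ≤ f i := by
          rcases hc1.lt_or_eq with h3 | h3
          · exact (hmono _ _ h3 h2).le
          · rw [h3]
        exact absurd (d3.trans_le (this.trans c1)) (lt_irrefl _)
      · intro ρ hρ
        obtain ⟨i, k1, k2⟩ := hex ρ hρ
        refine ⟨i0 + i, le_self_add, by simpa using k1, ?_⟩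
        intro j h1 h2
        obtain ⟨j, h2', rfl⟩ := cvt j (le_self_add.trans h1) h2; clear h2; rename' h2' => h2
        have h1 : i ≤ j := by simpa using h1
        have e2 : f i ≤ f j := by
          rcases h1.lt_or_eq with h3 | h3
          · exact (hmono _ _ h3 h2).le
          · rw [h3]
        refine ⟨f j, f (j + 1), k2.le.trans e2, hmono _ _ (lt_add_one j) (hlam.add_one_lt h2),
          hlt _ (hlam.add_one_lt h2), q1 j h2, ?_, (q5 j h2).2⟩
        rw [add_assoc]; exact (q5 j h2).1
  obtain ⟨a1, a2, a3, a4, a5⟩ := main h' le_rfl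
  refine ⟨f h', a2, a1, ?_, ?_⟩
  · intro hlt
    have : 0 < h' := by
      rw [pos_iff_ne_zero]; rintro rfl; simp at hlt
    have := a3 0 this
    rwa [hf, loopT_zero] at this
  · intro ρ c1 c2
    obtain ⟨j, d1, d2, d3⟩ := a4 ρ c1 c2
    refine ⟨i0 + j, f j, f (j + 1), le_self_add, by simpa using d1, d2, d3, ?_, (a5 j d1).2⟩
    rcases (Order.add_one_le_of_lt d1).lt_or_eq with h3 | h3
    · exact (a3 _ h3).le
    · rw [h3]

end Loop

end GapU

namespace GapU
open Order Tr

/-! ### Step API for the universal machine -/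

theorem base_dir {σ : St} {r : Tr → Bool} {s' w mv} (h : base σ r = some (s', w, mv)) :
    ∃ x y z, mv = dir x y z := by
  unfold base at h
  split at h <;> (try split at h) <;> (try split at h) <;> (try split at h) <;> (try split at h) <;>
    simp only [Option.some.injEq, Prod.mk.injEq, reduceCtorEq] at h <;>
    first
    | exact ⟨_, _, _, h.2.2.symm⟩
    | exact absurd h id

theorem base_none {σ : St} {r : Tr → Bool} : base σ r = none ↔ σ = .H := by
  constructor
  · intro h
    unfold base at h
    split at h <;> (try split at h) <;> (try split at h) <;> (try split at h) <;> (try split at h) <;>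
      simp only [reduceCtorEq] at h
    rfl
  · rintro rfl; rfl

theorem base_ne_init {σ : St} {r : Tr → Bool} {s' w mv} (h : base σ r = some (s', w, mv)) :
    s' ≠ .start0 := by
  unfold base at h
  split at h <;> (try split at h) <;> (try split at h) <;> (try split at h) <;> (try split at h) <;>
    simp only [Option.some.injEq, Prod.mk.injEq, reduceCtorEq] at h <;>
    first
    | (obtain ⟨rfl, -⟩ := h; simp; done)
    | exact absurd h id

theorem trans_none {σ : St} {r : Tr → Bool} : trans σ r = none ↔ σ = .H := by
  simp [trans, base_none]

theorem halted_iff' (t : Ordinal.{0}) : U.haltedAt t ↔ st t = .H := by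
  rw [halted_iff, trans_none]

/-- a step in terms of `base` -/
theorem step_base {t : Ordinal.{0}} {s' w mv} (h : base (st t) (rd t) = some (s', w, mv)) :
    st (t + 1) = s' ∧ (∀ γ, hd γ (t + 1) = if mv γ then hd γ t + 1 else leftOf (hd γ t)) ∧
    (∀ tr, tr ≠ vv → tp tr (t + 1) = Function.update (tp tr t) (hd (grp tr) t) (w tr)) ∧
    tp vv (t + 1) = Function.update (tp vv t) (hd .Y t) (if 8 ≤ code (st t) then true else w vv) := by
  have h1 : trans (st t) (rd t) = some (s', if 8 ≤ code (st t) then upd w vv true else w, mv) := by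
    simp [trans, h]
  obtain ⟨e1, e2, e3⟩ := step_some h1
  refine ⟨e1, e2, fun tr htr => ?_, ?_⟩
  · funext x
    rw [e3]
    simp only [Function.update_apply]
    split_ifs
    · rw [upd, Function.update_of_ne htr]
    · rfl
    · rfl
  · funext x
    rw [e3]
    have hg : grp vv = Gr.Y := rfl
    rw [hg, Function.update_apply]
    split_ifs <;> simp

theorem st_limit_cof {T : Ordinal.{0}} (h : IsSuccLimit T) : ∀ ρ < T, ∃ i, ρ ≤ i ∧ i < T ∧ st i = st T := by
  intro ρ hρ
  obtain ⟨i, c1, c2, c3⟩ := (run_limit_state (P := U) h).2 ρ hρ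
  exact ⟨i, c1, c2, by unfold st; rw [c3]⟩

theorem hK (t : Ordinal.{0}) : hd .K t = 0 := by
  induction t using Ordinal.limitRecOn with
  | zero => exact hd_zero _
  | add_one t ih =>
    cases hb : base (st t) (rd t) with
    | none =>
      have : trans (st t) (rd t) = none := by simp [trans, hb]
      unfold hd; rw [step_none this]; exact ih
    | some r =>
      obtain ⟨s', w, mv⟩ := r
      obtain ⟨x, y, z, rfl⟩ := base_dir hb
      rw [(step_base hb).2.1 .K, ih]; simp [dir]
  | limit lam hl ih =>
    refine hd_limit_eq hl (fun x hx => absurd hx (by simp)) fun ρ hρ => ⟨ρ, le_rfl, hρ, ?_⟩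
    rw [ih ρ hρ]

theorem hd_le (γ : Gr) (t : Ordinal.{0}) : hd γ t ≤ t := by
  induction t using Ordinal.limitRecOn with
  | zero => exact (hd_zero _).le
  | add_one t ih =>
    cases hb : base (st t) (rd t) with
    | none =>
      have : trans (st t) (rd t) = none := by simp [trans, hb]
      have : hd γ (t + 1) = hd γ t := by unfold hd; rw [step_none this]
      rw [this]; exact ih.trans le_self_add
    | some r =>
      obtain ⟨s', w, mv⟩ := r
      rw [(step_base hb).2.1 γ]
      split_ifs
      · gcongr
      · exact (leftOf_le _).trans (ih.trans le_self_add)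
  | limit lam hl ih =>
    rw [hd_limit hl]
    exact liminfAt_le fun ρ hρ => ⟨ρ, le_rfl, hρ, (ih ρ hρ).trans hρ.le⟩

theorem tp_lt (tr : Tr) (t x : Ordinal.{0}) (h : tp tr t x = true) : x < t := by
  induction t using Ordinal.limitRecOn with
  | zero => rw [tp_zero] at h; simp at h
  | add_one t ih =>
    cases hb : base (st t) (rd t) with
    | none =>
      have : trans (st t) (rd t) = none := by simp [trans, hb]
      have : tp tr (t + 1) = tp tr t := by unfold tp; rw [step_none this]
      rw [this] at h; exact (ih h).trans (lt_add_one t)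
    | some r =>
      obtain ⟨s', w, mv⟩ := r
      have h1 : trans (st t) (rd t) = some (s', if 8 ≤ code (st t) then upd w vv true else w, mv) := by
        simp [trans, hb]
      have e3 := (step_some h1).2.2 tr x
      rw [e3] at h
      split_ifs at h with e
      · rw [e]; exact Order.lt_add_one_iff.2 (hd_le _ _)
      · rw [e]; exact Order.lt_add_one_iff.2 (hd_le _ _)
      · exact (ih h).trans (lt_add_one t)
  | limit lam hl ih =>
    rw [tp_limit hl] at h
    obtain ⟨ρ, h1, h2⟩ := h
    exact (ih ρ h1 (h2 ρ le_rfl h1)).trans h1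

theorem base_init : base (st 0) (rd 0) = some (.N0, upd (upd (upd (rd 0) zr true) zy true) zx true,
    dir false false false) := by rw [st_zero]; rfl

theorem st_one : st 1 = .N0 := by
  have := (step_base base_init).1
  rwa [zero_add] at this

theorem hd_one (γ : Gr) : hd γ 1 = 0 := by
  have := (step_base base_init).2.1 γ
  rw [zero_add, hd_zero] at this
  rw [this]; cases γ <;> simp [dir]

theorem tp_one (tr : Tr) (h : tr ≠ zr ∧ tr ≠ zy ∧ tr ≠ zx) (x : Ordinal.{0}) : tp tr 1 x = false := by
  obtain ⟨-, -, e1, e2⟩ := step_base base_init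
  by_cases hv : tr = vv
  · subst hv
    rw [zero_add] at e2
    rw [e2, Function.update_apply]
    have : ¬ 8 ≤ code (st 0) := by rw [st_zero]; simp [code]
    split_ifs <;> simp [upd, Function.update_of_ne, rd, tp_zero]
  · have := e1 tr hv
    rw [zero_add] at this
    rw [this, Function.update_apply]
    split_ifs
    · rw [upd, Function.update_of_ne h.2.2, upd, Function.update_of_ne h.2.1, upd,
        Function.update_of_ne h.1, rd, tp_zero]
    · rw [tp_zero]

theorem st_ne_start0 {t : Ordinal.{0}} (ht : 1 ≤ t) : st t ≠ .start0 := by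
  induction t using Ordinal.limitRecOn with
  | zero => simp at ht
  | add_one t ih =>
    cases hb : base (st t) (rd t) with
    | none =>
      have : trans (st t) (rd t) = none := by simp [trans, hb]
      have h2 : st (t + 1) = st t := by unfold st; rw [step_none this]
      rw [h2, base_none.1 hb]; simp
    | some r =>
      obtain ⟨s', w, mv⟩ := r
      rw [(step_base hb).1]; exact base_ne_init hb
  | limit lam hl ih =>
    obtain ⟨i, h1, h2, h3⟩ := st_limit_cof hl 1 (by
      have := hl.add_one_lt hl.bot_lt
      simpa using this)
    rw [← h3]; exact ih i h2 h1

theorem tp_z {t : Ordinal.{0}} (ht : 1 ≤ t) {tr : Tr} (h : tr = zr ∨ tr = zy ∨ tr = zx)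
    (x : Ordinal.{0}) : tp tr t x = decide (x = 0) := by
  have : tp tr t = tp tr 1 := by
    refine keep ht fun ρ h1 _ => ?_
    rcases h with rfl | rfl | rfl <;> exact st_ne_start0 h1
  rw [this]
  obtain ⟨-, -, e1, e2⟩ := step_base base_init
  have := e1 tr (by rcases h with rfl | rfl | rfl <;> simp)
  rw [zero_add] at this
  rw [this, Function.update_apply, hd_zero, tp_zero]
  rcases h with rfl | rfl | rfl <;> by_cases hx : x = 0 <;> simp [hx, upd]

/-- position data -/
structure At (t : Ordinal.{0}) (σ : St) (r y : Ordinal.{0}) (x : ℕ) : Prop where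
  st : st t = σ
  R : hd .R t = r
  Y : hd .Y t = y
  X : hd .X t = x

theorem leftOf_nat (n : ℕ) : leftOf (n : Ordinal.{0}) = ((n - 1 : ℕ) : Ordinal.{0}) := by
  cases n with
  | zero => simp
  | succ n => rw [Nat.cast_succ, leftOf_add_one]; rfl

theorem At.go {t σ r y x s' w mr my mx} (h : At t σ r y x)
    (hb : base σ (rd t) = some (s', w, dir mr my mx)) :
    At (t + 1) s' (if mr then r + 1 else leftOf r) (if my then y + 1 else leftOf y)
      (if mx then x + 1 else x - 1) := by
  obtain ⟨e1, e2, -⟩ := step_base (h.st.symm ▸ hb)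
  refine ⟨e1, ?_, ?_, ?_⟩
  · rw [e2, h.R]; rfl
  · rw [e2, h.Y]; rfl
  · rw [e2, h.X]
    show (if mx then _ else _) = _
    cases mx
    · simp [leftOf_nat]
    · simp

/-- all tracks except `bb` and `vv` -/
structure Fr (F : Tr → Ordinal.{0} → Bool) (t : Ordinal.{0}) : Prop where
  pos : 1 ≤ t
  eq : ∀ tr, tr ≠ bb → tr ≠ vv → tp tr t = F tr

theorem Fr.gow {t s' w mv F F'} (h : Fr F t) (hb : base (st t) (rd t) = some (s', w, mv))
    (hw : ∀ tr, tr ≠ bb → tr ≠ vv → Function.update (F tr) (hd (grp tr) t) (w tr) = F' tr) :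
    Fr F' (t + 1) := by
  refine ⟨h.pos.trans le_self_add, fun tr h1 h2 => ?_⟩
  rw [(step_base hb).2.2.1 tr h2, h.eq tr h1 h2, hw tr h1 h2]

theorem Fr.go {t s' w mv F} (h : Fr F t) (hb : base (st t) (rd t) = some (s', w, mv))
    (hw : ∀ tr, tr ≠ bb → tr ≠ vv → w tr = rd t tr) : Fr F (t + 1) := by
  refine h.gow hb fun tr h1 h2 => ?_
  rw [hw tr h1 h2, ← h.eq tr h1 h2]
  exact Function.update_eq_self _ _

theorem bb_go {t s' w mv} (hb : base (st t) (rd t) = some (s', w, mv)) :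
    tp bb (t + 1) 0 = w bb := by
  rw [(step_base hb).2.2.1 bb (by simp)]
  show Function.update (tp bb t) (hd .K t) (w bb) 0 = _
  rw [hK]; simp

theorem Fr.limit {F T} (hT : IsSuccLimit T) (h : ∃ ρ < T, ∀ i, ρ ≤ i → i < T → Fr F i) : Fr F T := by
  obtain ⟨ρ, h3, h4⟩ := h
  refine ⟨(h4 ρ le_rfl h3).pos.trans h3.le, fun tr h1 h2 => ?_⟩
  funext x
  exact tp_limit_const hT ⟨ρ, h3, fun i a b => by rw [(h4 i a b).eq tr h1 h2]⟩

/-- segments -/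
def Rch (P Q : Ordinal.{0} → Prop) (t : Ordinal.{0}) : Prop :=
  ∃ t', t ≤ t' ∧ (∀ ρ, t ≤ ρ → ρ < t' → P ρ) ∧ Q t'

def Rch' (P Q : Ordinal.{0} → Prop) (t : Ordinal.{0}) : Prop :=
  ∃ t', t < t' ∧ (∀ ρ, t ≤ ρ → ρ < t' → P ρ) ∧ Q t'

theorem Rch'.le {P Q t} (h : Rch' P Q t) : Rch P Q t := by
  obtain ⟨t', h1, h2, h3⟩ := h; exact ⟨t', h1.le, h2, h3⟩

theorem Rch.done {P Q : Ordinal.{0} → Prop} {t} (h : Q t) : Rch P Q t :=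
  ⟨t, le_rfl, fun ρ a b => absurd b (not_lt.2 a), h⟩

theorem Rch.step {P Q : Ordinal.{0} → Prop} {t} (h : P t) (h2 : Rch P Q (t + 1)) : Rch' P Q t := by
  obtain ⟨t', a1, a2, a3⟩ := h2
  refine ⟨t', (lt_add_one t).trans_le a1, fun ρ b1 b2 => ?_, a3⟩
  rcases b1.lt_or_eq with e | rfl
  · exact a2 ρ (Order.add_one_le_of_lt e) b2
  · exact h

theorem Rch.bind {P Q Q' : Ordinal.{0} → Prop} {t} (h : Rch P Q t)
    (h2 : ∀ t', t ≤ t' → Q t' → Rch P Q' t') : Rch P Q' t := by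
  obtain ⟨t', a1, a2, a3⟩ := h
  obtain ⟨t'', b1, b2, b3⟩ := h2 t' a1 a3
  refine ⟨t'', a1.trans b1, fun ρ c1 c2 => ?_, b3⟩
  rcases lt_or_ge ρ t' with e | e
  · exact a2 ρ c1 e
  · exact b2 ρ e c2

theorem Rch'.bind {P Q Q' : Ordinal.{0} → Prop} {t} (h : Rch' P Q t)
    (h2 : ∀ t', t < t' → Q t' → Rch P Q' t') : Rch' P Q' t := by
  obtain ⟨t', a1, a2, a3⟩ := h
  obtain ⟨t'', b1, b2, b3⟩ := h2 t' a1 a3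
  refine ⟨t'', a1.trans_le b1, fun ρ c1 c2 => ?_, b3⟩
  rcases lt_or_ge ρ t' with e | e
  · exact a2 ρ c1 e
  · exact b2 ρ e c2

theorem Rch.bind' {P Q Q' : Ordinal.{0} → Prop} {t} (h : Rch P Q t)
    (h2 : ∀ t', t ≤ t' → Q t' → Rch' P Q' t') : Rch' P Q' t := by
  obtain ⟨t', a1, a2, a3⟩ := h
  obtain ⟨t'', b1, b2, b3⟩ := h2 t' a1 a3
  refine ⟨t'', a1.trans_lt b1, fun ρ c1 c2 => ?_, b3⟩
  rcases lt_or_ge ρ t' with e | e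
  · exact a2 ρ c1 e
  · exact b2 ρ e c2

theorem Rch.mono {P P' Q Q' : Ordinal.{0} → Prop} {t} (h : Rch P Q t)
    (h1 : ∀ ρ, t ≤ ρ → P ρ → P' ρ) (h2 : ∀ t', t ≤ t' → Q t' → Q' t') : Rch P' Q' t := by
  obtain ⟨t', a1, a2, a3⟩ := h
  exact ⟨t', a1, fun ρ a b => h1 ρ a (a2 ρ a b), h2 t' a1 a3⟩

theorem Rch'.mono {P P' Q Q' : Ordinal.{0} → Prop} {t} (h : Rch' P Q t)
    (h1 : ∀ ρ, t ≤ ρ → P ρ → P' ρ) (h2 : ∀ t', t < t' → Q t' → Q' t') : Rch' P' Q' t := by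
  obtain ⟨t', a1, a2, a3⟩ := h
  exact ⟨t', a1, fun ρ a b => h1 ρ a (a2 ρ a b), h2 t' a1 a3⟩

/-- the visited-track invariant -/
structure VInv (t : Ordinal.{0}) : Prop where
  lt : ∀ x < hd .Y t, tp vv t x = true
  down : ∀ x y, x < y → tp vv t y = true → tp vv t x = true
  tt : ∀ x, tp tt t x = true → tp vv t x = true
  mm : ∀ x, tp mm t x = true → tp vv t x = true

theorem VInv.run {t0 t : Ordinal.{0}} (hle : t0 ≤ t) (h0 : VInv t0)
    (h : ∀ ρ, t0 ≤ ρ → ρ < t → 8 ≤ code (st ρ)) : VInv t := by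
  induction t using Ordinal.limitRecOn with
  | zero => rwa [← le_antisymm hle zero_le]
  | add_one t ih =>
    rcases hle.lt_or_eq with hlt | rfl
    · have hle' : t0 ≤ t := Order.lt_add_one_iff.1 hlt
      have iv := ih hle' fun ρ a b => h ρ a (b.trans (lt_add_one t))
      have hc := h t hle' (lt_add_one t)
      cases hb : base (st t) (rd t) with
      | none =>
        rw [base_none.1 hb] at hc; simp [code] at hc
      | some r =>
        obtain ⟨s', w, mv⟩ := r
        obtain ⟨-, e2, e3, e4⟩ := step_base hb
        rw [if_pos hc] at e4
        refine ⟨?_, ?_, ?_, ?_⟩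
        · intro x hx
          rw [e2] at hx
          have : x ≤ hd .Y t := by
            split_ifs at hx
            · exact Order.lt_add_one_iff.1 hx
            · exact hx.le.trans (leftOf_le _)
          rw [e4, Function.update_apply]
          split_ifs with e
          · rfl
          · exact iv.lt x (lt_of_le_of_ne this e)
        · intro x y hxy
          rw [e4, Function.update_apply, Function.update_apply]
          split_ifs with c1 c2 c2
          · simp
          · subst c1; intro _; exact iv.lt _ hxy
          · simp
          · exact iv.down x y hxy
        · intro x hx
          rw [e3 _ (by simp), Function.update_apply] at hx
          rw [e4, Function.update_apply]
          split_ifs at hx ⊢ with c1 c2 c2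
          · rfl
          · rfl
          · exact absurd c2 c1
          · exact iv.tt x hx
        · intro x hx
          rw [e3 _ (by simp), Function.update_apply] at hx
          rw [e4, Function.update_apply]
          split_ifs at hx ⊢ with c1 c2 c2
          · rfl
          · rfl
          · exact absurd c2 c1
          · exact iv.mm x hx
    · exact h0
  | limit t hl ih =>
    rcases hle.lt_or_eq with hlt | rfl
    · have iv : ∀ i, t0 ≤ i → i < t → VInv i := fun i a b =>
        ih i b a fun ρ c e => h ρ c (e.trans b)
      have key : ∀ {p q : Ordinal.{0} → Prop}, (∃ ρ < t, ∀ i, ρ ≤ i → i < t → p i) →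
          (∀ i, t0 ≤ i → i < t → p i → q i) → (∃ ρ < t, ∀ i, ρ ≤ i → i < t → q i) := by
        rintro p q ⟨ρ, a1, a2⟩ h2
        refine ⟨max t0 ρ, max_lt hlt a1, fun i b1 b2 => ?_⟩
        exact h2 i ((le_max_left _ _).trans b1) b2 (a2 i ((le_max_right _ _).trans b1) b2)
      refine ⟨?_, ?_, ?_, ?_⟩
      · intro x hx
        rw [hd_limit hl, lt_liminfAt_iff] at hx
        rw [tp_limit hl]
        exact key hx fun i a b c => (iv i a b).lt x c
      · intro x y hxy
        rw [tp_limit hl, tp_limit hl]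
        intro hx
        exact key hx fun i a b c => (iv i a b).down x y hxy c
      · intro x
        rw [tp_limit hl, tp_limit hl]
        intro hx
        exact key hx fun i a b c => (iv i a b).tt x c
      · intro x
        rw [tp_limit hl, tp_limit hl]
        intro hx
        exact key hx fun i a b c => (iv i a b).mm x c
    · exact h0

end GapU

namespace GapU
open Order Tr

/-! ### Configurations, homing, loops -/

structure Cf (F : Tr → Ordinal.{0} → Bool) (t : Ordinal.{0}) (σ : St) (r y : Ordinal.{0}) (x : ℕ) :
    Prop extends At t σ r y x where
  fr : Fr F t

section
variable {F F' : Tr → Ordinal.{0} → Bool} {t r y : Ordinal.{0}} {σ : St} {x : ℕ}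

theorem Cf.rzr (h : Cf F t σ r y x) : rd t zr = decide (r = 0) := by
  rw [← h.R]; exact tp_z h.fr.pos (by simp) _
theorem Cf.rzy (h : Cf F t σ r y x) : rd t zy = decide (y = 0) := by
  rw [← h.Y]; exact tp_z h.fr.pos (by simp) _
theorem Cf.rzx (h : Cf F t σ r y x) : rd t zx = decide (x = 0) := by
  have : rd t zx = decide ((x : Ordinal.{0}) = 0) := by
    rw [← h.X]; exact tp_z h.fr.pos (by simp) _
  simpa using this
theorem Cf.rs (h : Cf F t σ r y x) : rd t s = F s r := by
  rw [← h.R, ← h.fr.eq _ (by simp) (by simp)]; rfl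
theorem Cf.ra (h : Cf F t σ r y x) : rd t a = F a r := by
  rw [← h.R, ← h.fr.eq _ (by simp) (by simp)]; rfl
theorem Cf.rq (h : Cf F t σ r y x) : rd t q = F q r := by
  rw [← h.R, ← h.fr.eq _ (by simp) (by simp)]; rfl
theorem Cf.rtt (h : Cf F t σ r y x) : rd t tt = F tt y := by
  rw [← h.Y, ← h.fr.eq _ (by simp) (by simp)]; rfl
theorem Cf.rmm (h : Cf F t σ r y x) : rd t mm = F mm y := by
  rw [← h.Y, ← h.fr.eq _ (by simp) (by simp)]; rfl
theorem Cf.rd' (h : Cf F t σ r y x) : rd t d = F d 0 := by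
  rw [← hK t, ← h.fr.eq _ (by simp) (by simp)]; rfl
theorem Cf.rg (h : Cf F t σ r y x) : rd t g = F g 0 := by
  rw [← hK t, ← h.fr.eq _ (by simp) (by simp)]; rfl
theorem rbb : rd t bb = tp bb t 0 := by
  rw [← hK t]; rfl
theorem Cf.rsym (h : Cf F t σ r y x) : sym (rd t) = sym (fun tr => F tr x) := by
  have : ∀ i, rd t (b i) = F (b i) x := fun i => by
    rw [← h.X, ← h.fr.eq _ (by simp) (by simp)]; rfl
  simp [sym, this]

theorem Cf.go {s' w mr my mx} (h : Cf F t σ r y x)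
    (hb : base σ (rd t) = some (s', w, dir mr my mx))
    (hw : ∀ tr, tr ≠ bb → tr ≠ vv → w tr = rd t tr) :
    Cf F (t + 1) s' (if mr then r + 1 else leftOf r) (if my then y + 1 else leftOf y)
      (if mx then x + 1 else x - 1) :=
  ⟨h.toAt.go hb, h.fr.go (h.st.symm ▸ hb) hw⟩

theorem Cf.gow {s' w mr my mx} (h : Cf F t σ r y x)
    (hb : base σ (rd t) = some (s', w, dir mr my mx))
    (hw : ∀ tr, tr ≠ bb → tr ≠ vv → Function.update (F tr) (hd (grp tr) t) (w tr) = F' tr) :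
    Cf F' (t + 1) s' (if mr then r + 1 else leftOf r) (if my then y + 1 else leftOf y)
      (if mx then x + 1 else x - 1) :=
  ⟨h.toAt.go hb, h.fr.gow (h.st.symm ▸ hb) hw⟩

theorem Cf.upd_self (h : Cf F t σ r y x) (tr : Tr) (h1 : tr ≠ bb) (h2 : tr ≠ vv) :
    Function.update (F tr) (hd (grp tr) t) (rd t tr) = F tr := by
  rw [← h.fr.eq tr h1 h2]; exact Function.update_eq_self _ _

theorem Cf.bb (h : Cf F t σ r y x) {s' w mv}
    (hb : base σ (rd t) = some (s', w, mv)) : tp bb (t + 1) 0 = w bb :=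
  bb_go (h.st.symm ▸ hb)
end

theorem iter_leftOf_left {n : ℕ} {o : Ordinal.{0}} (h : leftOf^[n] o = 0) :
    leftOf^[n] (leftOf o) = 0 := by
  rw [← Function.iterate_succ_apply, Function.iterate_succ_apply', h, leftOf_zero]

theorem iter_leftOf_mono {n m : ℕ} (hnm : n ≤ m) {o : Ordinal.{0}} (h : leftOf^[n] o = 0) :
    leftOf^[m] o = 0 := by
  induction m, hnm using Nat.le_induction with
  | base => exact h
  | succ m _ ih => rw [Function.iterate_succ_apply', ih, leftOf_zero]

theorem exists_iter2 (r y : Ordinal.{0}) (x : ℕ) :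
    ∃ n : ℕ, leftOf^[n] r = 0 ∧ leftOf^[n] y = 0 ∧ x ≤ n := by
  obtain ⟨n, hn⟩ := exists_iter_leftOf r
  obtain ⟨m, hm⟩ := exists_iter_leftOf y
  exact ⟨max x (max n m), iter_leftOf_mono (by simp) hn, iter_leftOf_mono (by simp) hm, by simp⟩

theorem homeLLL {F : Tr → Ordinal.{0} → Bool} {σ : St} {c : Ordinal.{0} → Ordinal.{0} → ℕ → Prop}
    (hstep : ∀ t r y x, Cf F t σ r y x → ¬ c r y x →
      base σ (rd t) = some (σ, rd t, dir false false false)) (hc : c 0 0 0)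
    {t r y : Ordinal.{0}} {x : ℕ} (h : Cf F t σ r y x) :
    Rch (fun ρ => ∃ r y x, Cf F ρ σ r y x)
      (fun t' => ∃ r' y' x', r' ≤ r ∧ y' ≤ y ∧ x' ≤ x ∧ Cf F t' σ r' y' x' ∧ c r' y' x') t := by
  obtain ⟨n, h1, h2, h3⟩ := exists_iter2 r y x
  induction n generalizing t r y x with
  | zero =>
    obtain rfl : r = 0 := h1
    obtain rfl : y = 0 := h2
    obtain rfl : x = 0 := by omega
    exact Rch.done ⟨0, 0, 0, le_rfl, le_rfl, le_rfl, h, hc⟩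
  | succ n ih =>
    by_cases hcc : c r y x
    · exact Rch.done ⟨r, y, x, le_rfl, le_rfl, le_rfl, h, hcc⟩
    · have h' := h.go (hstep t r y x h hcc) (fun _ _ _ => rfl)
      simp only [Bool.false_eq_true, if_false] at h'
      refine (Rch.step ⟨r, y, x, h⟩ ((ih h' h1 h2 (by omega)).mono (fun _ _ h => h) ?_)).le
      rintro t' - ⟨r', y', x', a1, a2, a3, a4⟩
      exact ⟨r', y', x', a1.trans (leftOf_le _), a2.trans (leftOf_le _), by omega, a4⟩

/-- homing of the heads `R`, `Y` preserving `X` -/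
theorem homeF {F : Tr → Ordinal.{0} → Bool} {k : Knd}
    {t r y : Ordinal.{0}} {x : ℕ} (h : Cf F t (.F k) r y x) :
    Rch (fun ρ => ∃ σ r y x, Cf F ρ σ r y x ∧ (σ = .F k ∨ σ = .Hb k))
      (fun t' => Cf F t' (.F k) 0 0 x) t := by
  obtain ⟨n, h1, h2, -⟩ := exists_iter2 r y 0
  induction n generalizing t r y with
  | zero =>
    obtain rfl : r = 0 := h1
    obtain rfl : y = 0 := h2
    exact Rch.done h
  | succ n ih =>
    by_cases hcc : r = 0 ∧ y = 0
    · obtain ⟨rfl, rfl⟩ := hcc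
      exact Rch.done h
    · have hb : base (.F k) (rd t) = some (.Hb k, rd t, dir false false true) := by
        have : (rd t zr && rd t zy) = false := by
          rw [h.rzr, h.rzy]; simpa using hcc
        simp [base, this]
      have h' := h.go hb (fun _ _ _ => rfl)
      simp only [Bool.false_eq_true, if_false, if_true] at h'
      have h'' := h'.go (s' := .F k) (w := rd (t + 1)) (mr := false) (my := false) (mx := false)
        rfl (fun _ _ _ => rfl)
      simp only [Bool.false_eq_true, if_false, add_tsub_cancel_right] at h''
      refine (Rch.step ⟨_, r, y, x, h, Or.inl rfl⟩ (Rch.step ⟨_, _, _, _, h', Or.inr rfl⟩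
        (ih h'' (iter_leftOf_left h1) (iter_leftOf_left h2))).le).le

/-- the simplified loop lemma -/
structure LimR (Pre P : Ordinal.{0} → Ordinal.{0} → Prop) (t0 i0 lam T : Ordinal.{0}) : Prop where
  lim : IsSuccLimit T
  ev : ∀ i, i0 ≤ i → i < lam → ∃ s < T, Pre i s ∧ ∀ ρ, s ≤ ρ → ρ < T → ∃ j, i ≤ j ∧ j < lam ∧ P j ρ
  cof : ∀ ρ < T, ∀ i, i0 ≤ i → i < lam → ∃ j s, i ≤ j ∧ j < lam ∧ ρ ≤ s ∧ s < T ∧ Pre j s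

theorem loopR {Pre P : Ordinal.{0} → Ordinal.{0} → Prop} {t0 i0 h : Ordinal.{0}} (hle : i0 ≤ h)
    (h0 : Pre i0 t0)
    (hs : ∀ i t, i0 ≤ i → i < h → t0 ≤ t → Pre i t → Rch' (P i) (Pre (i + 1)) t)
    (hl : ∀ lam T, i0 < lam → lam ≤ h → IsSuccLimit lam → t0 < T → LimR Pre P t0 i0 lam T →
      Pre lam T) :
    Rch (fun ρ => ∃ j, i0 ≤ j ∧ j < h ∧ P j ρ) (Pre h) t0 := by
  obtain ⟨T, a1, a2, -, a3⟩ := loop (Pre := Pre) (Thr := fun j u u' => ∀ ρ, u ≤ ρ → ρ < u' → P j ρ) hle h0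
    (fun i t b1 b2 b3 b4 => by
      obtain ⟨t', c1, c2, c3⟩ := hs i t b1 b2 b3 b4
      exact ⟨t', c1, c3, c2⟩)
    (fun lam T b1 b2 b3 b4 b5 => by
      refine hl lam T b1 b2 b3 b4 ⟨b5.lim, ?_, ?_⟩
      · intro i c1 c2
        obtain ⟨s, d1, d2, d3⟩ := b5.ev i c1 c2
        refine ⟨s, d1, d2, fun ρ e1 e2 => ?_⟩
        obtain ⟨j, u, u', f1, f2, f3, f4, f5, f6⟩ := d3 ρ e1 e2
        exact ⟨j, f1, f2, f6 ρ f3 f4⟩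
      · intro ρ hρ i c1 c2
        obtain ⟨k, d1, d2, d3⟩ := b5.cof ρ hρ
        obtain ⟨s, s', e1, e2, e3, e4, e5⟩ := d3 (max i k) (le_max_right _ _) (max_lt c2 d2)
        exact ⟨max i k, s, le_max_left _ _, max_lt c2 d2, e1, e2.trans e3, e4⟩)
  refine ⟨T, a1, fun ρ c1 c2 => ?_, a2⟩
  obtain ⟨j, u, u', f1, f2, f3, f4, f5, f6⟩ := a3 ρ c1 c2
  exact ⟨j, f1, f2, f6 ρ f3 f4⟩

/-- loops of length `ω` -/
theorem loopOmega {A P : ℕ → Ordinal.{0} → Prop} {t0 : Ordinal.{0}} {Q : Ordinal.{0} → Prop}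
    (h0 : A 0 t0)
    (hs : ∀ n t, t0 ≤ t → A n t → Rch' (P n) (A (n + 1)) t)
    (hl : ∀ T, t0 < T → IsSuccLimit T →
      (∀ n, ∃ s < T, ∀ ρ, s ≤ ρ → ρ < T → ∃ k, n ≤ k ∧ P k ρ) →
      (∀ ρ < T, ∃ n s, ρ ≤ s ∧ s < T ∧ A n s) → Q T) :
    Rch (fun ρ => ∃ n, P n ρ) Q t0 := by
  have key := loopR (Pre := fun i t => (∃ n : ℕ, i = n ∧ A n t) ∨ (i = ω ∧ Q t))
    (P := fun i ρ => ∃ n : ℕ, i = n ∧ P n ρ) (t0 := t0) (i0 := 0) (h := ω) zero_le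
    (Or.inl ⟨0, by simp, h0⟩) ?_ ?_
  · refine key.mono ?_ ?_
    · rintro ρ - ⟨j, -, -, n, -, h⟩; exact ⟨n, h⟩
    · rintro t' - (⟨n, h1, -⟩ | ⟨-, h⟩)
      · exact absurd h1 (Ordinal.nat_lt_omega0 n).ne'
      · exact h
  · rintro i t - hi ht (⟨n, rfl, h⟩ | ⟨rfl, -⟩)
    · refine (hs n t ht h).mono (fun ρ _ h => ⟨n, rfl, h⟩) fun t' _ h => Or.inl ⟨n + 1, by simp, h⟩
    · exact absurd hi (lt_irrefl _)
  · intro lam T c1 c2 c3 c4 c5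
    have hlam : lam = ω := by
      apply le_antisymm c2
      exact Ordinal.omega0_le_of_isSuccLimit c3
    subst hlam
    refine Or.inr ⟨rfl, hl T c4 c5.lim ?_ ?_⟩
    · intro n
      obtain ⟨s, d1, -, d3⟩ := c5.ev n zero_le (Ordinal.nat_lt_omega0 n)
      refine ⟨s, d1, fun ρ e1 e2 => ?_⟩
      obtain ⟨j, f1, f2, k, rfl, f3⟩ := d3 ρ e1 e2
      exact ⟨k, by exact_mod_cast f1, f3⟩
    · intro ρ hρ
      obtain ⟨j, s, -, d1, d2, d3, d4⟩ := c5.cof ρ hρ 0 le_rfl c1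
      rcases d4 with ⟨n, -, h⟩ | ⟨rfl, -⟩
      · exact ⟨n, s, d2, d3, h⟩
      · exact absurd d1 (lt_irrefl _)

end GapU

namespace GapU
open Order Tr

/-! ### Rows -/

def pl (o : Ordinal.{0}) (n : ℕ) : Ordinal.{0} := o + (n : Ordinal.{0})

theorem pl_zero (o) : pl o 0 = o := by simp [pl]
theorem pl_succ (o n) : pl o n + 1 = pl o (n + 1) := by simp [pl, add_assoc]
theorem left_pl (o n) : leftOf (pl o (n + 1)) = pl o n := by
  rw [← pl_succ, leftOf_add_one]
theorem le_pl (o n) : o ≤ pl o n := le_self_add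
theorem pl_pl (o n m) : pl (pl o n) m = pl o (n + m) := by simp [pl, add_assoc]
theorem pl_mono (o) {n m : ℕ} (h : n ≤ m) : pl o n ≤ pl o m := by
  simpa [pl] using h
theorem pl_lt_omega (o n) : pl o n < o + ω := by
  simp [pl, Ordinal.nat_lt_omega0]
theorem pl_two (i : Ordinal.{0}) : pl (2 * i) 2 = 2 * (i + 1) := by
  simp [pl, mul_add]

def SF (F : Tr → Ordinal.{0} → Bool) (k : ℕ) : ℕ := sym (fun tr => F tr (k : Ordinal.{0}))

theorem SF_congr {F F' : Tr → Ordinal.{0} → Bool} (h : ∀ i, F' (b i) = F (b i)) : SF F' = SF F := by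
  funext k; simp [SF, sym, h]

structure Cx (F : Tr → Ordinal.{0} → Bool) (p j : ℕ) : Prop where
  hp : SF F p ≠ 1
  fill : ∀ l < j, SF F (p + 1 + l) = 1
  endNe : SF F (p + 1 + j) ≠ 1

theorem Cx.congr {F F' : Tr → Ordinal.{0} → Bool} {p j} (hc : Cx F p j) (h : ∀ i, F' (b i) = F (b i)) :
    Cx F' p j := by
  obtain ⟨h1, h2, h3⟩ := hc
  rw [← SF_congr h] at h1 h2 h3
  exact ⟨h1, h2, h3⟩

def rs (m : Mode) (σ : St) : Prop := σ = .SKa m ∨ σ = .SKb m ∨ σ = .SEEK m ∨ σ = .RET m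

theorem rs.code_le {m σ} (h : rs m σ) : code (.SKa m) ≤ code σ := by
  rcases h with rfl | rfl | rfl | rfl <;> simp [code]

def Rw (m : Mode) (i : Ordinal.{0}) (p : ℕ) (F : Tr → Ordinal.{0} → Bool) (ρ : Ordinal.{0}) : Prop :=
  ∃ σ r y x, Cf F ρ σ r y x ∧ rs m σ ∧ 2 * i ≤ r ∧ ω * i ≤ y ∧ p ≤ x

def RowPre (m : Mode) (i : Ordinal.{0}) (p : ℕ) (F : Tr → Ordinal.{0} → Bool) (t : Ordinal.{0}) : Prop :=
  Cf F t (.SKa m) (2 * i) (ω * i) p ∧ tp bb t 0 = false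

section
variable {F F' : Tr → Ordinal.{0} → Bool} {t i : Ordinal.{0}} {m : Mode} {p j : ℕ}

theorem upd_keep {F0 : Tr → Bool} {v : Bool} : ∀ tr, tr ≠ bb → tr ≠ vv → upd F0 bb v tr = F0 tr :=
  fun _ h _ => Function.update_of_ne h _ _

theorem omega_skip {y : Ordinal.{0}} {n : ℕ} (hy : y = pl (ω * i) n)
    (h : Cf F t (.SKa m) (2 * (i + 1)) y p) (hbb : tp bb t 0 = true) :
    Rch (Rw m i p F) (RowPre m (i + 1) p F) t := by
  have hi2 : 2 * i ≤ 2 * (i + 1) := by rw [← pl_two]; exact le_pl _ _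
  have := loopOmega (t0 := t)
    (A := fun k t => Cf F t (.SKa m) (2 * (i + 1)) (pl (ω * i) (n + 2 * k)) p ∧ tp bb t 0 = true)
    (P := fun k ρ => ∃ σ r y x, Cf F ρ σ r y x ∧ rs m σ ∧ 2 * (i + 1) ≤ r ∧
      pl (ω * i) (n + 2 * k) ≤ y ∧ p ≤ x) (Q := RowPre m (i + 1) p F) ⟨by simpa [← hy] using h, hbb⟩ ?_ ?_
  · refine this.mono ?_ (fun _ _ h => h)
    rintro ρ - ⟨k, σ, r, y, x, h1, h2, h3, h4, h5⟩
    exact ⟨σ, r, y, x, h1, h2, hi2.trans h3, (le_pl _ _).trans h4, h5⟩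
  · rintro k t - ⟨h1, h2⟩
    have e1 : base (.SKa m) (rd t) = some (.SKb m, upd (rd t) bb false, dir true true true) := by
      simp [base, rbb, h2]
    have h' := h1.go e1 upd_keep
    have e2 : base (.SKb m) (rd (t + 1)) = some (.SKa m, upd (rd (t + 1)) bb true, dir false true false) := rfl
    have h'' := h'.go e2 upd_keep
    simp only [Bool.false_eq_true, if_false, if_true, add_tsub_cancel_right, leftOf_add_one,
      pl_succ] at h' h''
    refine Rch.step ⟨_, _, _, _, h1, Or.inl rfl, le_rfl, le_rfl, le_rfl⟩ (Rch.step ?_ (Rch.done ?_)).le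
    · exact ⟨_, _, _, _, h', Or.inr (Or.inl rfl), le_self_add, pl_mono _ (by omega), by omega⟩
    · refine ⟨h'', ?_⟩
      rw [h'.bb e2]; simp [upd]
  · intro T h1 h2 h3 h4
    have ev : ∃ s < T, ∀ ρ, s ≤ ρ → ρ < T → ∃ σ r y x, Cf F ρ σ r y x ∧ rs m σ ∧ 2 * (i + 1) ≤ r ∧ p ≤ x := by
      obtain ⟨s, a1, a2⟩ := h3 0
      refine ⟨s, a1, fun ρ b1 b2 => ?_⟩
      obtain ⟨k, -, σ, r, y, x, c1, c2, c3, c4, c5⟩ := a2 ρ b1 b2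
      exact ⟨σ, r, y, x, c1, c2, c3, c5⟩
    obtain ⟨s, a1, a2⟩ := ev
    refine ⟨⟨⟨?_, ?_, ?_, ?_⟩, ?_⟩, ?_⟩
    · refine st_limit h2 ⟨s, a1, fun ρ b1 b2 => ?_⟩ fun ρ hρ => ?_
      · obtain ⟨σ, r, y, x, c1, c2, -⟩ := a2 ρ b1 b2
        rw [c1.st]; exact c2.code_le
      · obtain ⟨k, s, c1, c2, c3, -⟩ := h4 ρ hρ
        exact ⟨s, c1, c2, c3.st⟩
    · refine hd_limit_eq h2 (fun x hx => ⟨s, a1, fun ρ b1 b2 => ?_⟩) fun ρ hρ => ?_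
      · obtain ⟨σ, r, y, x, c1, c2, c3, -⟩ := a2 ρ b1 b2
        rw [c1.R]; exact hx.trans_le c3
      · obtain ⟨k, s, c1, c2, c3, -⟩ := h4 ρ hρ
        exact ⟨s, c1, c2, c3.R.le⟩
    · rw [mul_add_one]
      refine hd_limit_eq h2 (fun x hx => ?_) fun ρ hρ => ?_
      · rw [Ordinal.lt_add_iff_of_isSuccLimit isSuccLimit_omega0] at hx
        obtain ⟨d, hd1, hd2⟩ := hx
        obtain ⟨l, rfl⟩ := Ordinal.lt_omega0.1 hd1
        obtain ⟨s, b1, b2⟩ := h3 l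
        refine ⟨s, b1, fun ρ c1 c2 => ?_⟩
        obtain ⟨k, c0, σ, r, y, x, c1, c2, c3, c4, c5⟩ := b2 ρ c1 c2
        rw [c1.Y]
        exact hd2.trans_le (le_trans (pl_mono _ (by omega)) c4)
      · obtain ⟨k, s, c1, c2, c3, -⟩ := h4 ρ hρ
        exact ⟨s, c1, c2, by rw [c3.Y]; exact (pl_lt_omega _ _).le⟩
    · refine hd_limit_eq h2 (fun x hx => ⟨s, a1, fun ρ b1 b2 => ?_⟩) fun ρ hρ => ?_
      · obtain ⟨σ, r, y, x, c1, c2, c3, c4⟩ := a2 ρ b1 b2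
        rw [c1.X]; exact hx.trans_le (by exact_mod_cast c4)
      · obtain ⟨k, s, c1, c2, c3, -⟩ := h4 ρ hρ
        exact ⟨s, c1, c2, c3.X.le⟩
    · refine Fr.limit h2 ⟨s, a1, fun ρ b1 b2 => ?_⟩
      obtain ⟨σ, r, y, x, c1, -⟩ := a2 ρ b1 b2
      exact c1.fr
    · refine tp_limit_false h2 fun ρ hρ => ?_
      obtain ⟨k, s, c1, c2, c3, c4⟩ := h4 ρ hρ
      refine ⟨s + 1, c1.trans le_self_add, h2.add_one_lt c2, ?_⟩
      have e1 : base (.SKa m) (rd s) = some (.SKb m, upd (rd s) bb false, dir true true true) := by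
        simp [base, rbb, c4]
      rw [c3.bb e1]; simp [upd]

theorem ret_run (hc : Cx F p j) {k n : ℕ} (hk : k ≤ j) {r0 : Ordinal.{0}} (hr : 2 * i ≤ r0)
    (h : Cf F t (.RET m) (pl r0 k) (pl (ω * i) n) (p + k)) :
    Rch (Rw m i p F) (fun t' => ∃ n, Cf F t' (.RET m) r0 (pl (ω * i) n) p) t := by
  induction k generalizing t n with
  | zero => exact Rch.done ⟨n, by simpa [pl_zero] using h⟩
  | succ k ih =>
    have e1 : base (.RET m) (rd t) = some (.RET m, rd t, dir false true false) := by
      have : sym (rd t) = 1 := by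
        rw [h.rsym]; have := hc.fill k (by omega)
        rwa [show p + 1 + k = p + (k + 1) by omega] at this
      simp [base, this]
    have h' := h.go e1 (fun _ _ _ => rfl)
    simp only [Bool.false_eq_true, if_false, if_true, left_pl, pl_succ,
      show p + (k + 1) - 1 = p + k by omega] at h'
    refine (Rch.step ⟨_, _, _, _, h, by simp [rs], hr.trans (le_pl _ _), le_pl _ _, by omega⟩
      (ih (by omega) h')).le

theorem ret_skip (hc : Cx F p j) {n : ℕ}
    (h : Cf F t (.RET m) (pl (2 * i) (2 + j)) (pl (ω * i) n) (p + j)) :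
    Rch (Rw m i p F) (RowPre m (i + 1) p F) t := by
  have hi2 : 2 * i ≤ 2 * (i + 1) := by rw [← pl_two]; exact le_pl _ _
  rw [← pl_pl, pl_two] at h
  refine (ret_run hc le_rfl hi2 h).bind ?_
  rintro t' - ⟨n, h1⟩
  have e1 : base (.RET m) (rd t') = some (.SKb m, rd t', dir true true true) := by
    have : sym (rd t') ≠ 1 := by rw [h1.rsym]; exact hc.hp
    simp [base, this]
  have h2 := h1.go e1 (fun _ _ _ => rfl)
  have e2 : base (.SKb m) (rd (t' + 1)) = some (.SKa m, upd (rd (t' + 1)) bb true, dir false true false) := rfl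
  have h3 := h2.go e2 upd_keep
  simp only [Bool.false_eq_true, if_false, if_true, add_tsub_cancel_right, leftOf_add_one,
    pl_succ] at h2 h3
  refine (Rch.step ⟨_, _, _, _, h1, by simp [rs], hi2, le_pl _ _, le_rfl⟩
    (Rch.step ⟨_, _, _, _, h2, by simp [rs], hi2.trans le_self_add, le_pl _ _, by omega⟩ ?_).le).le
  refine omega_skip rfl h3 ?_
  rw [h2.bb e2]; simp [upd]

theorem seek_run (hc : Cx F p j) {k l : ℕ} (hk : l + k = j)
    (h : Cf F t (.SEEK m) (pl (2 * i) (1 + l)) (pl (ω * i) (1 + l)) (p + 1 + l)) :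
    Rch (Rw m i p F) (fun t' => Cf F t' (.SEEK m) (pl (2 * i) (1 + j)) (pl (ω * i) (1 + j)) (p + 1 + j)) t := by
  induction k generalizing t l with
  | zero => obtain rfl : l = j := by omega
            exact Rch.done h
  | succ k ih =>
    have e1 : base (.SEEK m) (rd t) = some (.SEEK m, rd t, dir true true true) := by
      have : sym (rd t) = 1 := by rw [h.rsym]; exact hc.fill l (by omega)
      simp [base, this]
    have h' := h.go e1 (fun _ _ _ => rfl)
    simp only [if_true, pl_succ] at h'
    exact (Rch.step ⟨_, _, _, _, h, by simp [rs], le_pl _ _, le_pl _ _, by omega⟩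
      (ih (l := l + 1) (by omega) h')).le

theorem seek_row (hc : Cx F p j) (h : RowPre m i p F t) (hq : m = .cl0 → F q (2 * i) = false) :
    Rch' (Rw m i p F) (fun t' => Cf F t' (.SEEK m) (pl (2 * i) (1 + j)) (pl (ω * i) (1 + j)) (p + 1 + j)) t := by
  obtain ⟨h1, h2⟩ := h
  have e1 : base (.SKa m) (rd t) = some (.SEEK m, upd (rd t) bb true, dir true true true) := by
    have : ¬ (m = .cl0 ∧ F q (2 * i) = true) := fun ⟨h3, h4⟩ => by rw [hq h3] at h4; simp at h4
    simp only [base, rbb, h2, h1.rq, if_neg this]; simp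
  have h' := h1.go e1 upd_keep
  simp only [if_true] at h'
  refine Rch.step ⟨_, _, _, _, h1, by simp [rs], le_rfl, le_rfl, by omega⟩ ?_
  refine seek_run hc (l := 0) (k := j) (by omega) ?_
  have e : ∀ o : Ordinal.{0}, o + 1 = pl o (1 + 0) := fun o => by rw [← pl_succ, pl_zero]
  rw [← e, ← e]; exact h'

theorem seek_rowq (hc : Cx F p j) (h : RowPre .cl0 i p F t) (hq : F q (2 * i) = true)
    (hF' : F' = Function.update F q (Function.update (F q) (2 * i) false)) :
    Rch' (fun ρ => Rw .cl0 i p F ρ ∨ Rw .cl1 i p F' ρ)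
      (fun t' => Cf F' t' (.SEEK .cl1) (pl (2 * i) (1 + j)) (pl (ω * i) (1 + j)) (p + 1 + j)) t := by
  obtain ⟨h1, h2⟩ := h
  have e1 : base (.SKa .cl0) (rd t) = some (.SEEK .cl1, upd (upd (rd t) bb true) q false, dir true true true) := by
    simp [base, rbb, h2, h1.rq, hq]
  have h' := h1.gow (F' := F') e1 (fun tr n1 n2 => by
    subst hF'
    by_cases htr : tr = q
    · subst htr
      have : hd (grp q) t = 2 * i := h1.R
      rw [this]; simp [upd]
    · rw [upd, Function.update_of_ne htr, upd, Function.update_of_ne n1, Function.update_of_ne htr]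
      exact h1.upd_self tr n1 n2)
  simp only [if_true] at h'
  refine Rch.step (Or.inl ⟨_, _, _, _, h1, by simp [rs], le_rfl, le_rfl, by omega⟩) ?_
  refine (seek_run (hc.congr ?_) (l := 0) (k := j) (by omega) ?_).mono (fun _ _ h => Or.inr h) (fun _ _ h => h)
  · intro i; subst hF'; simp
  have e : ∀ o : Ordinal.{0}, o + 1 = pl o (1 + 0) := fun o => by rw [← pl_succ, pl_zero]
  rw [← e, ← e]; exact h'

theorem row_find {op acc} (hc : Cx F p j) (h : RowPre (.find op acc) i p F t)
    (hm : F mm (pl (ω * i) (1 + j)) = true) :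
    Rch' (Rw (.find op acc) i p F) (RowPre (.find op acc) (i + 1) p F) t := by
  refine (seek_row hc h (by simp)).bind fun t' _ h1 => ?_
  have e1 : base (.SEEK (.find op acc)) (rd t') =
      some (.RET (.find op acc), rd t', dir true true false) := by
    have : sym (rd t') ≠ 1 := by rw [h1.rsym]; exact hc.endNe
    simp [base, this, h1.rmm, hm]
  have h2 := h1.go e1 (fun _ _ _ => rfl)
  simp only [Bool.false_eq_true, if_false, if_true, pl_succ, show p + 1 + j - 1 = p + j by omega,
    show 1 + j + 1 = 2 + j by omega] at h2
  exact (Rch.step ⟨_, _, _, _, h1, by simp [rs], le_pl _ _, le_pl _ _, by omega⟩ (ret_skip hc h2)).le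

theorem row_cl0 (hc : Cx F p j) (h : RowPre .cl0 i p F t)
    (hq : F q (2 * i) = false) :
    Rch' (Rw .cl0 i p F) (RowPre .cl0 (i + 1) p F) t := by
  refine (seek_row hc h (fun _ => hq)).bind fun t' _ h1 => ?_
  have e1 : base (.SEEK .cl0) (rd t') =
      some (.RET .cl0, rd t', dir true true false) := by
    have : sym (rd t') ≠ 1 := by rw [h1.rsym]; exact hc.endNe
    simp [base, this]
  have h2 := h1.go e1 (fun _ _ _ => rfl)
  simp only [Bool.false_eq_true, if_false, if_true, pl_succ, show p + 1 + j - 1 = p + j by omega,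
    show 1 + j + 1 = 2 + j by omega] at h2
  exact (Rch.step ⟨_, _, _, _, h1, by simp [rs], le_pl _ _, le_pl _ _, by omega⟩ (ret_skip hc h2)).le

/-- the second half of a clearing row -/
theorem pass_cl1 (hc : Cx F p j)
    (h1 : Cf F t (.SEEK .cl1) (pl (2 * i) (1 + j)) (pl (ω * i) (1 + j)) (p + 1 + j))
    (hm : F mm (pl (ω * i) (1 + j)) = true)
    (hF' : F' = Function.update F mm (Function.update (F mm) (pl (ω * i) (1 + j)) false)) :
    Rch (fun ρ => Rw .cl1 i p F ρ ∨ Rw .cl1 i p F' ρ) (RowPre .cl1 (i + 1) p F') t := by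
  have e1 : base (.SEEK .cl1) (rd t) =
      some (.RET .cl1, upd (rd t) mm false, dir true true false) := by
    have : sym (rd t) ≠ 1 := by rw [h1.rsym]; exact hc.endNe
    simp [base, this, h1.rmm, hm]
  have h2 := h1.gow (F' := F') e1 (fun tr n1 n2 => by
    subst hF'
    by_cases htr : tr = mm
    · subst htr
      have : hd (grp mm) t = _ := h1.Y
      rw [this]; simp [upd]
    · rw [upd, Function.update_of_ne htr, Function.update_of_ne htr]
      exact h1.upd_self tr n1 n2)
  simp only [Bool.false_eq_true, if_false, if_true, pl_succ, show p + 1 + j - 1 = p + j by omega,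
    show 1 + j + 1 = 2 + j by omega] at h2
  have hc' : Cx F' p j := hc.congr (by intro i; subst hF'; simp)
  exact (Rch.step (Or.inl ⟨_, _, _, _, h1, by simp [rs], le_pl _ _, le_pl _ _, by omega⟩)
    ((ret_skip hc' h2).mono (fun _ _ h => Or.inr h) (fun _ _ h => h))).le

theorem row_cl1 (hc : Cx F p j) (h : RowPre .cl1 i p F t)
    (hm : F mm (pl (ω * i) (1 + j)) = true)
    (hF' : F' = Function.update F mm (Function.update (F mm) (pl (ω * i) (1 + j)) false)) :
    Rch' (fun ρ => Rw .cl1 i p F ρ ∨ Rw .cl1 i p F' ρ) (RowPre .cl1 (i + 1) p F') t :=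
  ((seek_row hc h (by simp)).mono (fun _ _ h => Or.inl h) (fun _ _ h => h)).bind
    fun _ _ h1 => pass_cl1 hc h1 hm hF'

/-- loops over rows -/
theorem rowLoop {Fm : Ordinal.{0} → Tr → Ordinal.{0} → Bool} {i0 h : Ordinal.{0}} (hle : i0 ≤ h)
    (h0 : RowPre m i0 p (Fm i0) t)
    (hs : ∀ i t, i0 ≤ i → i < h → RowPre m i p (Fm i) t →
      Rch' (fun ρ => Rw m i p (Fm i) ρ ∨ Rw m i p (Fm (i + 1)) ρ) (RowPre m (i + 1) p (Fm (i + 1))) t)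
    (hcont : ∀ lam, i0 < lam → lam ≤ h → IsSuccLimit lam → ∀ tr x, ∃ i, i0 ≤ i ∧ i < lam ∧
      ∀ k, i ≤ k → k ≤ lam → Fm k tr x = Fm lam tr x) :
    Rch (fun ρ => ∃ j, i0 ≤ j ∧ j < h ∧ (Rw m j p (Fm j) ρ ∨ Rw m j p (Fm (j + 1)) ρ))
      (RowPre m h p (Fm h)) t := by
  refine loopR (Pre := fun i => RowPre m i p (Fm i)) hle h0
    (fun i t a1 a2 a3 a4 => hs i t a1 a2 a4) ?_
  intro lam T a1 a2 a3 a4 a5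
  have ev : ∀ i, i0 ≤ i → i < lam → ∃ s < T, ∀ ρ, s ≤ ρ → ρ < T → ∃ j σ r y x F, i ≤ j ∧ j ≤ lam ∧
      F = Fm j ∧ Cf F ρ σ r y x ∧ rs m σ ∧ 2 * i ≤ r ∧ ω * i ≤ y ∧ p ≤ x := by
    intro i b1 b2
    obtain ⟨s, c1, -, c3⟩ := a5.ev i b1 b2
    refine ⟨s, c1, fun ρ d1 d2 => ?_⟩
    obtain ⟨j, e1, e2, e3⟩ := c3 ρ d1 d2
    have f1 : 2 * i ≤ 2 * j := by gcongr
    have f2 : ω * i ≤ ω * j := by gcongr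
    rcases e3 with ⟨σ, r, y, x, g1, g2, g3, g4, g5⟩ | ⟨σ, r, y, x, g1, g2, g3, g4, g5⟩
    · exact ⟨j, σ, r, y, x, _, e1, e2.le, rfl, g1, g2, f1.trans g3, f2.trans g4, g5⟩
    · exact ⟨j + 1, σ, r, y, x, _, e1.trans le_self_add, (a3.add_one_lt e2).le, rfl, g1, g2,
        f1.trans g3, f2.trans g4, g5⟩
  have cof : ∀ ρ < T, ∃ j s, j < lam ∧ ρ ≤ s ∧ s < T ∧ RowPre m j p (Fm j) s := by
    intro ρ hρ
    obtain ⟨j, s, b1, b2, b3, b4, b5⟩ := a5.cof ρ hρ i0 le_rfl a1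
    exact ⟨j, s, b2, b3, b4, b5⟩
  have hT := a5.lim
  refine ⟨⟨⟨?_, ?_, ?_, ?_⟩, ?_⟩, ?_⟩
  · obtain ⟨s, b1, b2⟩ := ev i0 le_rfl a1
    refine st_limit hT ⟨s, b1, fun ρ c1 c2 => ?_⟩ fun ρ hρ => ?_
    · obtain ⟨j, σ, r, y, x, F, d1, d2, d3, d4, d5, -⟩ := b2 ρ c1 c2
      rw [d4.st]; exact d5.code_le
    · obtain ⟨j, s, c1, c2, c3, c4⟩ := cof ρ hρ
      exact ⟨s, c2, c3, c4.1.st⟩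
  · refine hd_limit_eq hT (fun x hx => ?_) fun ρ hρ => ?_
    · rw [Ordinal.lt_mul_iff_of_isSuccLimit a3] at hx
      obtain ⟨i, h1, h2⟩ := hx
      obtain ⟨s, b1, b2⟩ := ev (max i0 i) (le_max_left _ _) (max_lt a1 h1)
      refine ⟨s, b1, fun ρ c1 c2 => ?_⟩
      obtain ⟨j, σ, r, y, x, F, d1, d2, d3, d4, d5, d6, -⟩ := b2 ρ c1 c2
      rw [d4.R]; refine h2.trans_le (le_trans ?_ d6); gcongr; exact le_max_right _ _
    · obtain ⟨j, s, c1, c2, c3, c4⟩ := cof ρ hρ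
      exact ⟨s, c2, c3, by rw [c4.1.R]; gcongr⟩
  · refine hd_limit_eq hT (fun x hx => ?_) fun ρ hρ => ?_
    · rw [Ordinal.lt_mul_iff_of_isSuccLimit a3] at hx
      obtain ⟨i, h1, h2⟩ := hx
      obtain ⟨s, b1, b2⟩ := ev (max i0 i) (le_max_left _ _) (max_lt a1 h1)
      refine ⟨s, b1, fun ρ c1 c2 => ?_⟩
      obtain ⟨j, σ, r, y, x, F, d1, d2, d3, d4, d5, d6, d7, -⟩ := b2 ρ c1 c2
      rw [d4.Y]; refine h2.trans_le (le_trans ?_ d7); gcongr; exact le_max_right _ _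
    · obtain ⟨j, s, c1, c2, c3, c4⟩ := cof ρ hρ
      exact ⟨s, c2, c3, by rw [c4.1.Y]; gcongr⟩
  · obtain ⟨s, b1, b2⟩ := ev i0 le_rfl a1
    refine hd_limit_eq hT (fun x hx => ⟨s, b1, fun ρ c1 c2 => ?_⟩) fun ρ hρ => ?_
    · obtain ⟨j, σ, r, y, x, F, d1, d2, d3, d4, d5, d6, d7, d8⟩ := b2 ρ c1 c2
      rw [d4.X]; exact hx.trans_le (by exact_mod_cast d8)
    · obtain ⟨j, s, c1, c2, c3, c4⟩ := cof ρ hρ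
      exact ⟨s, c2, c3, c4.1.X.le⟩
  · refine ⟨?_, fun tr n1 n2 => ?_⟩
    · obtain ⟨s, b1, b2⟩ := ev i0 le_rfl a1
      obtain ⟨j, σ, r, y, x, F, d1, d2, d3, d4, -⟩ := b2 s le_rfl b1
      exact d4.fr.pos.trans b1.le
    · funext x
      obtain ⟨i, b1, b2, b3⟩ := hcont lam a1 a2 a3 tr x
      obtain ⟨s, c1, c2⟩ := ev i b1 b2
      refine tp_limit_const hT ⟨s, c1, fun ρ e1 e2 => ?_⟩
      obtain ⟨j, σ, r, y, x, F, d1, d2, rfl, d4, -⟩ := c2 ρ e1 e2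
      rw [d4.fr.eq tr n1 n2]; exact b3 j d1 d2
  · refine tp_limit_false hT fun ρ hρ => ?_
    obtain ⟨j, s, c1, c2, c3, c4⟩ := cof ρ hρ
    exact ⟨s, c2, c3, c4.2⟩

end

end GapU

namespace GapU
open Order Tr

/-! ### One instruction -/

theorem pl_inj {i i' : Ordinal.{0}} {n n' : ℕ} (h : pl (ω * i) n = pl (ω * i') n') : i = i' ∧ n = n' := by
  have key : ∀ (i : Ordinal.{0}) (n : ℕ), pl (ω * i) n / ω = i := by
    intro i n
    unfold pl
    rw [Ordinal.mul_add_div _ Ordinal.omega0_ne_zero, Ordinal.div_eq_zero_of_lt (Ordinal.nat_lt_omega0 n),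
      add_zero]
  have h1 : i = i' := by rw [← key i n, h, key]
  subst h1
  refine ⟨rfl, ?_⟩
  simpa [pl] using h

theorem left_left_two (h : Ordinal.{0}) : leftOf (leftOf (2 * h)) = 2 * leftOf h := by
  induction h using Ordinal.limitRecOn with
  | zero => simp
  | add_one k _ =>
    rw [← pl_two, left_pl, leftOf_add_one, left_pl, pl_zero]
  | limit lam hl _ =>
    have h2 : IsSuccLimit (2 * lam) := Ordinal.isSuccLimit_mul_right (by simp) hl
    rw [leftOf_limit hl.isSuccPrelimit, leftOf_limit h2.isSuccPrelimit]
    simp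

structure MemRel (m : Mem) (F : Tr → Ordinal.{0} → Bool) : Prop where
  tt : ∀ i j, F tt (pl (ω * i) (1 + j)) = m.T j i
  mm : ∀ i j, F mm (pl (ω * i) (1 + j)) = decide (i < m.h j)

/-- the situation at times during an instruction -/
def Dur (F F' : Tr → Ordinal.{0} → Bool) (ρ : Ordinal.{0}) : Prop :=
  8 ≤ code (st ρ) ∧ ∃ G, Fr G ρ ∧ (∀ tr, tr ≠ tt → tr ≠ mm → tr ≠ q → G tr = F tr) ∧
    ∀ tr x, (tr = tt ∨ tr = mm) → F tr x = true → F' tr x = true → G tr x = true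

section
variable {F F' G : Tr → Ordinal.{0} → Bool} {t i : Ordinal.{0}} {m : Mode} {p j : ℕ}

theorem Cf.fin {k r y x} (h : Cf F t (.Hb k) r y (x + 1)) :
    Rch (fun ρ => ∃ σ r y x, Cf F ρ σ r y x ∧ (σ = .F k ∨ σ = .Hb k))
      (fun t' => Cf F t' (.F k) 0 0 x) t := by
  have h' := h.go (s' := .F k) (w := rd t) (mr := false) (my := false) (mx := false)
    rfl (fun _ _ _ => rfl)
  simp only [Bool.false_eq_true, if_false, add_tsub_cancel_right] at h'
  exact (Rch.step ⟨_, _, _, _, h, Or.inr rfl⟩ (homeF h')).le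

theorem Cf.start {σ} (h : Cf F t σ 0 0 p) (hb : base σ (rd t) = some (.PRE m, rd t, dir false false true)) :
    Rch' (fun ρ => ∃ σ' r y x, Cf F ρ σ' r y x ∧ (σ' = σ ∨ σ' = .PRE m)) (RowPre m 0 p F) t := by
  have h1 := h.go hb (fun _ _ _ => rfl)
  have e2 : base (.PRE m) (rd (t + 1)) = some (.SKa m, upd (rd (t + 1)) Tr.bb false, dir false false false) := rfl
  have h2 := h1.go e2 upd_keep
  simp only [Bool.false_eq_true, if_false, if_true, add_tsub_cancel_right, leftOf_zero] at h1 h2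
  refine Rch.step ⟨_, _, _, _, h, Or.inl rfl⟩ (Rch.step ⟨_, _, _, _, h1, Or.inr rfl⟩ (Rch.done ⟨?_, ?_⟩)).le
  · simpa using h2
  · rw [h1.bb e2]; simp [upd]

theorem code_F (k : Knd) : 8 ≤ code (.F k) := by
  rcases k with ⟨⟨⟩⟩ | _ <;> simp [code]
theorem code_Hb (k : Knd) : 8 ≤ code (.Hb k) := by
  rcases k with ⟨⟨⟩⟩ | _ <;> simp [code]
theorem code_PRE (m : Mode) : 8 ≤ code (.PRE m) := by simp [code]; omega
theorem rs.code8 {σ : St} (h : rs m σ) : 8 ≤ code σ := by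
  refine le_trans ?_ h.code_le; simp [code]; omega

theorem dur_left {ρ r y x} {σ : St} (h : Cf F ρ σ r y x) (hs : 8 ≤ code σ) : Dur F F' ρ :=
  ⟨by rw [h.st]; exact hs, F, h.fr, fun _ _ _ _ => rfl, fun _ _ _ h1 _ => h1⟩

theorem dur_right {ρ r y x} {σ : St} (hF : ∀ tr, tr ≠ tt → tr ≠ mm → F' tr = F tr)
    (h : Cf F' ρ σ r y x) (hs : 8 ≤ code σ) : Dur F F' ρ :=
  ⟨by rw [h.st]; exact hs, F', h.fr, fun tr h1 h2 _ => hF tr h1 h2, fun _ _ _ _ h1 => h1⟩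

theorem Rw.dur_left {ρ} (h : Rw m i p F ρ) : Dur F F' ρ := by
  obtain ⟨σ, r, y, x, h1, h2, -⟩ := h
  exact GapU.dur_left h1 h2.code8

/-- the first phase of each instruction -/
theorem instr_find {op acc} {mem : Mem} (hc : Cx F p j) (hop : opOf (SF F p) = some op)
    (hm : MemRel mem F) (h : Cf F t (.F (.nrm acc)) 0 0 p) :
    Rch' (Dur F F') (fun t' => Cf F t' (.SEEK (.find op acc)) (pl (2 * mem.h j) (1 + j))
      (pl (ω * mem.h j) (1 + j)) (p + 1 + j)) t := by
  have e1 : base (.F (.nrm acc)) (rd t) = some (.PRE (.find op acc), rd t, dir false false true) := by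
    have : opOf (sym (rd t)) = some op := by rw [h.rsym]; exact hop
    simp [base, h.rzr, h.rzy, this]
  refine ((h.start e1).mono (P' := Dur F F') ?_ fun _ _ h => h).bind fun t1 _ h1 => ?_
  · rintro ρ - ⟨σ, r, y, x, h1, rfl | rfl⟩
    · exact dur_left h1 (code_F _)
    · exact dur_left h1 (code_PRE _)
  refine ((rowLoop (Fm := fun _ => F) (h := mem.h j) zero_le h1 ?_ ?_).mono (P' := Dur F F') ?_ fun _ _ h => h).bind
    fun t2 _ h2 => ?_
  · intro i t2 _ hi h2
    refine (row_find hc h2 ?_).mono (fun _ _ h => Or.inl h) fun _ _ h => h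
    rw [hm.mm]; simpa using hi
  · intro lam h1 h2 h3 tr x
    exact ⟨0, le_rfl, h1, fun _ _ _ => rfl⟩
  · rintro ρ - ⟨i, -, -, h | h⟩ <;> exact h.dur_left
  exact ((seek_row hc h2 (by simp)).mono (fun _ _ h => h.dur_left) fun _ _ h => h).le

theorem act_F {op acc} {mem : Mem} (hm : MemRel mem F) (hd : ¬ (op = .dec ∧ acc = true))
    (hF' : F' = Function.update (Function.update F tt (Function.update (F tt)
      (pl (ω * mem.h j) (1 + j)) (newtt op acc (F tt (pl (ω * mem.h j) (1 + j))))))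
      mm (Function.update (F mm) (pl (ω * mem.h j) (1 + j)) (newmm op acc))) :
    MemRel (exec (mem, acc) (op, j)).1 F' ∧
    newacc op acc (F tt (pl (ω * mem.h j) (1 + j))) = (exec (mem, acc) (op, j)).2 := by
  have key : ∀ i j', pl (ω * i) (1 + j') = pl (ω * mem.h j) (1 + j) ↔ i = mem.h j ∧ j' = j := by
    intro i j'
    constructor
    · intro h; obtain ⟨h1, h2⟩ := pl_inj h; exact ⟨h1, by omega⟩
    · rintro ⟨rfl, rfl⟩; rfl
  refine ⟨⟨fun i j' => ?_, fun i j' => ?_⟩, ?_⟩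
  · have : F' Tr.tt = Function.update (F tt)
      (pl (ω * mem.h j) (1 + j)) (newtt op acc (F tt (pl (ω * mem.h j) (1 + j)))) := by
      subst hF'; simp
    rw [this, Function.update_apply, hm.tt, hm.tt]
    simp only [key]
    by_cases hk : i = mem.h j ∧ j' = j
    · obtain ⟨rfl, rfl⟩ := hk
      rw [if_pos ⟨rfl, rfl⟩]
      cases op <;> cases acc <;> simp [newtt, exec, Mem.wr, Mem.mv]
    · rw [if_neg hk]
      have hwr : ∀ v, (mem.wr j v).T j' i = mem.T j' i := by
        intro v
        simp only [Mem.wr]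
        by_cases hj : j' = j
        · subst hj
          have : i ≠ mem.h j' := fun h => hk ⟨h, rfl⟩
          simp [Function.update_of_ne this]
        · simp [Function.update_of_ne hj]
      cases op <;> cases acc <;> simp [exec, Mem.mv, hwr]
  · have : F' Tr.mm = Function.update (F mm) (pl (ω * mem.h j) (1 + j)) (newmm op acc) := by
      subst hF'; simp
    rw [this, Function.update_apply, hm.mm]
    simp only [key]
    by_cases hk : i = mem.h j ∧ j' = j
    · obtain ⟨rfl, rfl⟩ := hk
      rw [if_pos ⟨rfl, rfl⟩]
      cases op <;> cases acc <;> simp [newmm, exec, Mem.wr, Mem.mv] at hd ⊢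
    · rw [if_neg hk]
      have hmv : (decide (i < mem.h j')) = decide (i < (mem.mv j (mem.h j + 1)).h j') := by
        simp only [Mem.mv]
        by_cases hj : j' = j
        · subst hj
          have : i ≠ mem.h j' := fun h => hk ⟨h, rfl⟩
          simp [Order.lt_add_one_iff, le_iff_lt_or_eq, this]
        · simp [Function.update_of_ne hj]
      cases op <;> cases acc <;> first | (exfalso; simp at hd; done) | (exact hmv) | rfl | (simp [exec, Mem.wr]; done)
  · rw [hm.tt]
    cases op <;> cases acc <;> simp [newacc, exec, Mem.rd]

theorem instr_plain {op acc} {mem : Mem} (hc : Cx F p j) (hop : opOf (SF F p) = some op)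
    (hm : MemRel mem F) (h : Cf F t (.F (.nrm acc)) 0 0 p) (hd : ¬ (op = .dec ∧ acc = true)) :
    ∃ F', MemRel (exec (mem, acc) (op, j)).1 F' ∧ (∀ tr, tr ≠ tt → tr ≠ mm → F' tr = F tr) ∧
      Rch' (Dur F F') (fun t' => Cf F' t' (.F (.nrm (exec (mem, acc) (op, j)).2)) 0 0 (p + 1 + j)) t := by
  obtain ⟨F', hF'⟩ : ∃ F', F' = Function.update (Function.update F tt (Function.update (F tt)
      (pl (ω * mem.h j) (1 + j)) (newtt op acc (F tt (pl (ω * mem.h j) (1 + j))))))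
      mm (Function.update (F mm) (pl (ω * mem.h j) (1 + j)) (newmm op acc)) := ⟨_, rfl⟩
  obtain ⟨a1, a2⟩ := act_F hm hd hF'
  have hne : ∀ tr, tr ≠ tt → tr ≠ mm → F' tr = F tr := by
    intro tr h1 h2
    rw [hF', Function.update_of_ne h2, Function.update_of_ne h1]
  refine ⟨F', a1, hne, (instr_find hc hop hm h).bind fun t1 _ h1 => ?_⟩
  have e1 : base (.SEEK (.find op acc)) (rd t1) = some (.Hb (.nrm (newacc op acc (rd t1 tt))),
          upd (upd (rd t1) tt (newtt op acc (rd t1 tt))) mm (newmm op acc), dir false false true) := by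
    have e2 : sym (rd t1) ≠ 1 := by rw [h1.rsym]; exact hc.endNe
    have e3 : rd t1 mm = false := by rw [h1.rmm, hm.mm]; simp
    simp [base, e2, e3, hd]
  have h2 := h1.gow (F' := F') e1 (fun tr n1 n2 => by
    by_cases c1 : tr = mm
    · subst c1
      have : GapU.hd (grp mm) t1 = _ := h1.Y
      rw [this]; simp [upd, hF']
    by_cases c2 : tr = tt
    · subst c2
      have : GapU.hd (grp tt) t1 = _ := h1.Y
      rw [this, h1.rtt, hF']; simp [upd]
    rw [upd, Function.update_of_ne c1, upd, Function.update_of_ne c2, hne tr c2 c1]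
    exact h1.upd_self tr n1 n2)
  rw [h1.rtt, a2] at h2
  simp only [if_true] at h2
  refine (Rch.step (dur_left h1 (by simp [code]; omega)) (h2.fin.mono ?_ fun _ _ h => h)).le
  rintro ρ - ⟨σ, r, y, x, h1, rfl | rfl⟩
  · exact dur_right hne h1 (code_F _)
  · exact dur_right hne h1 (code_Hb _)

/-- the marked tape with the rows in `[i1, i)` of column `j` cleared -/
def clr (F : Tr → Ordinal.{0} → Bool) (j : ℕ) (i1 i : Ordinal.{0}) : Tr → Ordinal.{0} → Bool :=
  open scoped Classical in
  Function.update F mm fun x =>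
    if ∃ k, i1 ≤ k ∧ k < i ∧ x = pl (ω * k) (1 + j) then false else F mm x

theorem clr_ne {i1 i} {tr : Tr} (h : tr ≠ mm) : clr F j i1 i tr = F tr := by
  unfold clr; rw [Function.update_of_ne h]

theorem clr_mm {i1 i x} : clr F j i1 i mm x = true ↔
    (∀ k, i1 ≤ k → k < i → x ≠ pl (ω * k) (1 + j)) ∧ F mm x = true := by
  classical
  unfold clr
  rw [Function.update_self]
  split_ifs with h
  · constructor
    · simp
    · rintro ⟨h1, -⟩
      obtain ⟨k, a1, a2, a3⟩ := h
      exact absurd a3 (h1 k a1 a2)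
  · constructor
    · intro h2; exact ⟨fun k a1 a2 a3 => h ⟨k, a1, a2, a3⟩, h2⟩
    · exact fun h => h.2

theorem clr_self {i1} : clr F j i1 i1 = F := by
  funext tr
  by_cases h : tr = mm
  · subst h
    funext x
    rw [Bool.eq_iff_iff, clr_mm]
    constructor
    · exact fun h => h.2
    · exact fun h => ⟨fun k a1 a2 => absurd a2 (not_lt.2 a1), h⟩
  · exact clr_ne h

theorem clr_succ {i1 i} (hi : i1 ≤ i) : clr F j i1 (i + 1) = Function.update (clr F j i1 i) mm
    (Function.update (clr F j i1 i mm) (pl (ω * i) (1 + j)) false) := by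
  funext tr
  by_cases h : tr = mm
  · subst h
    rw [Function.update_self]
    funext x
    rw [Bool.eq_iff_iff, clr_mm, Function.update_apply]
    split_ifs with hx
    · subst hx
      simp only [Bool.false_eq_true, iff_false, not_and]
      intro h; exact absurd rfl (h i hi (lt_add_one i))
    · rw [clr_mm]
      refine and_congr_left fun _ => ⟨fun h k a1 a2 => h k a1 (a2.trans (lt_add_one i)), fun h k a1 a2 => ?_⟩
      rcases (Order.lt_add_one_iff.1 a2).lt_or_eq with e | rfl
      · exact h k a1 e
      · exact hx
  · rw [Function.update_of_ne h, clr_ne h, clr_ne h]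

theorem dur_clr {ρ r y x} {σ : St} {i1 i h} (hi : i ≤ h) (hc : Cf (clr F j i1 i) ρ σ r y x) (hs : 8 ≤ code σ) :
    Dur F (clr F j i1 h) ρ := by
  refine ⟨by rw [hc.st]; exact hs, _, hc.fr, fun tr _ h2 _ => clr_ne h2, ?_⟩
  rintro tr x (rfl | rfl) h1 h2
  · rw [clr_ne (by simp)]; exact h1
  · rw [clr_mm] at h2 ⊢
    exact ⟨fun k a1 a2 => h2.1 k a1 (a2.trans_le hi), h1⟩

theorem clr_cont {i1 i0 lam : Ordinal.{0}} (h1 : i0 < lam) (hlam : IsSuccLimit lam) (tr : Tr) (x : Ordinal.{0}) :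
    ∃ i, i0 ≤ i ∧ i < lam ∧ ∀ k, i ≤ k → k ≤ lam → clr F j i1 k tr x = clr F j i1 lam tr x := by
  by_cases htr : tr = mm
  · subst htr
    by_cases hx : ∃ k, i1 ≤ k ∧ k < lam ∧ x = pl (ω * k) (1 + j)
    · obtain ⟨k, a1, a2, a3⟩ := hx
      have hlim : k + 1 < lam := hlam.add_one_lt a2
      refine ⟨max i0 (k + 1), le_max_left _ _, max_lt h1 hlim, fun k' b1 b2 => ?_⟩
      have c1 : clr F j i1 k' mm x = false := by
        rw [← Bool.not_eq_true, clr_mm]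
        rintro ⟨h, -⟩
        exact h k a1 ((lt_add_one k).trans_le ((le_max_right _ _).trans b1)) a3
      have c2 : clr F j i1 lam mm x = false := by
        rw [← Bool.not_eq_true, clr_mm]
        rintro ⟨h, -⟩
        exact h k a1 a2 a3
      rw [c1, c2]
    · refine ⟨i0, le_rfl, h1, fun k' b1 b2 => ?_⟩
      rw [Bool.eq_iff_iff, clr_mm, clr_mm]
      refine and_congr_left fun _ => ⟨fun h k a1 a2 a3 => hx ⟨k, a1, a2, a3⟩,
        fun h k a1 a2 => h k a1 (a2.trans_le b2)⟩
  · exact ⟨i0, le_rfl, h1, fun k _ _ => by rw [clr_ne htr, clr_ne htr]⟩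

theorem retd_run (hc : Cx F p j) {k : ℕ} (hk : k ≤ j) {r0 y : Ordinal.{0}}
    (h : Cf F t .RETD (pl r0 k) y (p + k)) :
    Rch (Dur F F') (fun t' => ∃ y, Cf F t' .RETD r0 y p) t := by
  induction k generalizing t y with
  | zero => exact Rch.done ⟨y, by simpa [pl_zero] using h⟩
  | succ k ih =>
    have e1 : base .RETD (rd t) = some (.RETD, rd t, dir false false false) := by
      have : sym (rd t) = 1 := by
        rw [h.rsym]; have := hc.fill k (by omega)
        rwa [show p + 1 + k = p + (k + 1) by omega] at this
      simp [base, this]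
    have h' := h.go e1 (fun _ _ _ => rfl)
    simp only [Bool.false_eq_true, if_false, left_pl,
      show p + (k + 1) - 1 = p + k by omega] at h'
    exact (Rch.step (dur_left h (by simp [code])) (ih (by omega) h')).le

theorem dur_q {ρ r y x} {σ : St} (hF : ∀ tr, tr ≠ q → G tr = F tr) (h : Cf G ρ σ r y x) (hs : 8 ≤ code σ) :
    Dur F F' ρ :=
  ⟨by rw [h.st]; exact hs, G, h.fr, fun tr _ _ h3 => hF tr h3,
    fun tr _ h0 h1 _ => by rwa [hF tr (by rintro rfl; simp at h0)]⟩

/-- from the find phase of a decrement to the clear phase -/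
theorem dec_mid {mem : Mem} (hc : Cx F p j) (hop : opOf (SF F p) = some .dec)
    (hm : MemRel mem F) (h : Cf F t (.F (.nrm true)) 0 0 p)
    (hG : G = Function.update F q (Function.update (F q) (2 * leftOf (mem.h j)) true)) :
    Rch' (Dur F F') (RowPre .cl0 0 p G) t := by
  refine (instr_find hc hop hm h).bind fun t1 _ h1 => ?_
  have e1 : base (.SEEK (.find .dec true)) (rd t1) = some (.RETD, rd t1, dir false false false) := by
    have e2 : sym (rd t1) ≠ 1 := by rw [h1.rsym]; exact hc.endNe
    have e3 : rd t1 mm = false := by rw [h1.rmm, hm.mm]; simp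
    simp [base, e2, e3]
  have h2 := h1.go e1 (fun _ _ _ => rfl)
  simp only [Bool.false_eq_true, if_false, show 1 + j = j + 1 by omega, left_pl,
    show p + 1 + j - 1 = p + j by omega] at h2
  refine (Rch.step (dur_left h1 (by simp [code]; omega)) ((retd_run hc le_rfl h2).bind ?_)).le
  rintro t2 - ⟨y, h3⟩
  have e3 : base .RETD (rd t2) = some (.D1, rd t2, dir false false true) := by
    have : sym (rd t2) ≠ 1 := by rw [h3.rsym]; exact hc.hp
    simp [base, this]
  have h4 := h3.go e3 (fun _ _ _ => rfl)
  have h5 := h4.go (s' := .D2) (w := rd (t2 + 1)) (mr := false) (my := false) (mx := false) rfl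
    (fun _ _ _ => rfl)
  simp only [Bool.false_eq_true, if_false, if_true, left_left_two, add_tsub_cancel_right] at h4 h5
  have h6 := h5.gow (F' := G) (s' := .Hb .dec) (w := upd (rd (t2 + 1 + 1)) q true)
    (mr := false) (my := false) (mx := true) rfl (fun tr n1 n2 => by
    subst hG
    by_cases htr : tr = q
    · subst htr
      have : hd (grp q) (t2 + 1 + 1) = _ := h5.R
      rw [this]; simp [upd]
    · rw [upd, Function.update_of_ne htr, Function.update_of_ne htr]
      exact h5.upd_self tr n1 n2)
  simp only [if_true] at h6
  have hGF : ∀ tr, tr ≠ q → G tr = F tr := fun tr h => by subst hG; exact Function.update_of_ne h _ _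
  refine (Rch.step (dur_left h3 (by simp [code])) (Rch.step (dur_left h4 (by simp [code]))
    (Rch.step (dur_left h5 (by simp [code])) ((h6.fin.mono ?_ fun _ _ h => h).bind fun t3 _ h7 => ?_)).le).le).le
  · rintro ρ - ⟨σ, r, y, x, h1, rfl | rfl⟩
    · exact dur_q hGF h1 (code_F _)
    · exact dur_q hGF h1 (code_Hb _)
  have e4 : base (.F .dec) (rd t3) = some (.PRE .cl0, rd t3, dir false false true) := by
    simp [base, h7.rzr, h7.rzy]
  refine ((h7.start e4).mono ?_ fun _ _ h => h).le
  rintro ρ - ⟨σ, r, y, x, h1, rfl | rfl⟩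
  · exact dur_q hGF h1 (code_F _)
  · exact dur_q hGF h1 (code_PRE _)

theorem Rw.dur_q {ρ} (hF : ∀ tr, tr ≠ q → G tr = F tr) (h : Rw m i p G ρ) : Dur F F' ρ := by
  obtain ⟨σ, r, y, x, h1, h2, -⟩ := h
  exact GapU.dur_q hF h1 h2.code8

theorem Rw.dur_clr {ρ i1 i i' h} (hi : i ≤ h) (hc : Rw m i' p (clr F j i1 i) ρ) : Dur F (clr F j i1 h) ρ := by
  obtain ⟨σ, r, y, x, h1, h2, -⟩ := hc
  exact GapU.dur_clr hi h1 h2.code8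

theorem dec_rel {mem : Mem} (hm : MemRel mem F) :
    MemRel (exec (mem, true) (.dec, j)).1 (clr F j (leftOf (mem.h j)) (mem.h j)) := by
  refine ⟨fun i j' => ?_, fun i j' => ?_⟩
  · rw [clr_ne (by simp), hm.tt]; simp [exec, Mem.mv]
  · rw [Bool.eq_iff_iff, clr_mm, hm.mm]
    simp only [exec, Mem.mv, decide_eq_true_eq, if_true]
    by_cases hj : j' = j
    · subst hj
      rw [Function.update_self]
      constructor
      · rintro ⟨h1, h2⟩
        by_contra h3
        exact h1 i (not_lt.1 h3) h2 rfl
      · intro h1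
        refine ⟨fun k a1 a2 a3 => ?_, h1.trans_le (leftOf_le _)⟩
        obtain ⟨rfl, -⟩ := pl_inj a3
        exact absurd h1 (not_lt.2 a1)
    · rw [Function.update_of_ne hj]
      constructor
      · exact fun h => h.2
      · refine fun h => ⟨fun k a1 a2 a3 => ?_, h⟩
        obtain ⟨-, h⟩ := pl_inj a3
        omega

theorem instr_dec {mem : Mem} (hc : Cx F p j) (hop : opOf (SF F p) = some .dec)
    (hq : F q = fun _ => false)
    (hm : MemRel mem F) (h : Cf F t (.F (.nrm true)) 0 0 p) :
    ∃ F', MemRel (exec (mem, true) (.dec, j)).1 F' ∧ (∀ tr, tr ≠ tt → tr ≠ mm → F' tr = F tr) ∧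
      Rch' (Dur F F') (fun t' => Cf F' t' (.F (.nrm true)) 0 0 (p + 1 + j)) t := by
  obtain ⟨H, hH⟩ : ∃ H, H = mem.h j := ⟨_, rfl⟩
  obtain ⟨i1, hi1⟩ : ∃ i1, i1 = leftOf H := ⟨_, rfl⟩
  have hi1H : i1 ≤ H := by rw [hi1]; exact leftOf_le _
  have hrel := dec_rel (j := j) hm
  rw [← hH, ← hi1] at hrel
  refine ⟨clr F j i1 H, hrel, fun tr _ h2 => clr_ne h2, ?_⟩
  obtain ⟨G, hG⟩ : ∃ G, G = Function.update F q (Function.update (F q) (2 * i1) true) := ⟨_, rfl⟩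
  have hGF : ∀ tr, tr ≠ q → G tr = F tr := fun tr h => by subst hG; exact Function.update_of_ne h _ _
  have hcG : Cx G p j := hc.congr fun i => hGF _ (by simp)
  refine (dec_mid (G := G) hc hop hm h (by rw [hG, hi1, hH])).bind fun t1 _ h1 => ?_
  refine ((rowLoop (Fm := fun _ => G) (h := i1) zero_le h1 ?_ ?_).mono ?_ fun _ _ h => h).bind fun t2 _ h2 => ?_
  · intro i t2 _ hi h2
    refine (row_cl0 hcG h2 ?_).mono (fun _ _ h => Or.inl h) fun _ _ h => h
    rw [hG, Function.update_self, Function.update_of_ne, hq]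
    intro e
    have := mul_left_cancel₀ (by simp) e
    exact hi.ne this
  · intro lam h1 h2 h3 tr x
    exact ⟨0, le_rfl, h1, fun _ _ _ => rfl⟩
  · rintro ρ - ⟨i, -, -, h | h⟩ <;> exact h.dur_q hGF
  have hFG : F = Function.update G q (Function.update (G q) (2 * i1) false) := by
    funext tr
    by_cases htr : tr = q
    · subst htr
      rw [Function.update_self, hG, Function.update_self, hq]
      funext x
      simp [Function.update_apply]
    · rw [Function.update_of_ne htr, hGF tr htr]
  refine ((seek_rowq hcG h2 (by rw [hG]; simp) hFG).mono ?_ fun _ _ h => h).le.bind fun t3 _ h3 => ?_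
  · rintro ρ - (h | h)
    · exact h.dur_q hGF
    · exact h.dur_left
  -- reach row H
  have key : Rch (Dur F (clr F j i1 H)) (fun t' => Cf (clr F j i1 H) t' (.SEEK .cl1) (pl (2 * H) (1 + j))
      (pl (ω * H) (1 + j)) (p + 1 + j)) t3 := by
    rcases hi1H.lt_or_eq with hlt | heq
    · have hmm : ∀ i, i1 ≤ i → i < H → clr F j i1 i mm (pl (ω * i) (1 + j)) = true := by
        intro i a1 a2
        rw [clr_mm, hm.mm]
        refine ⟨fun k b1 b2 b3 => ?_, by simpa [← hH] using a2⟩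
        obtain ⟨rfl, -⟩ := pl_inj b3
        exact lt_irrefl _ b2
      have c0 : ∀ i, Cx (clr F j i1 i) p j := fun i => hc.congr fun _ => clr_ne (by simp)
      rw [← clr_self (F := F) (j := j) (i1 := i1)] at h3
      refine ((pass_cl1 (c0 i1) h3 (hmm i1 le_rfl hlt) (clr_succ le_rfl)).mono ?_ fun _ _ h => h).bind
        fun t4 _ h4 => ?_
      · rintro ρ - (h | h)
        · exact h.dur_clr hi1H
        · exact h.dur_clr (Order.add_one_le_of_lt hlt)
      refine ((rowLoop (Fm := fun i => clr F j i1 i) (h := H) (Order.add_one_le_of_lt hlt) h4 ?_ ?_).mono ?_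
        fun _ _ h => h).bind fun t5 _ h5 => ?_
      · intro i t5 a1 a2 h5
        have a3 : i1 ≤ i := le_self_add.trans a1
        exact row_cl1 (c0 i) h5 (hmm i a3 a2) (clr_succ a3)
      · intro lam a1 a2 a3 tr x
        exact clr_cont a1 a3 tr x
      · rintro ρ - ⟨i, a1, a2, h | h⟩
        · exact h.dur_clr a2.le
        · exact h.dur_clr (Order.add_one_le_of_lt a2)
      exact ((seek_row (c0 H) h5 (by simp)).mono (fun _ _ h => h.dur_clr le_rfl) fun _ _ h => h).le
    · rw [heq] at h3 ⊢
      rw [clr_self]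
      exact Rch.done h3
  refine key.bind fun t4 _ h4 => ?_
  have e1 : base (.SEEK .cl1) (rd t4) = some (.Hb (.nrm true), rd t4, dir false false true) := by
    have e2 : sym (rd t4) ≠ 1 := by rw [h4.rsym]; exact (hc.congr fun _ => clr_ne (by simp)).endNe
    have e3 : rd t4 mm = false := by
      rw [h4.rmm, ← Bool.not_eq_true, clr_mm, hm.mm, ← hH]; simp
    simp [base, e2, e3]
  have h5 := h4.go e1 (fun _ _ _ => rfl)
  simp only [if_true] at h5
  refine (Rch.step (dur_clr le_rfl h4 (by simp [code]; omega)) (h5.fin.mono ?_ fun _ _ h => h)).le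
  rintro ρ - ⟨σ, r, y, x, h1, rfl | rfl⟩
  · exact dur_clr le_rfl h1 (code_F _)
  · exact dur_clr le_rfl h1 (code_Hb _)

theorem instr {op acc} {mem : Mem} (hc : Cx F p j) (hop : opOf (SF F p) = some op)
    (hq : F q = fun _ => false)
    (hm : MemRel mem F) (h : Cf F t (.F (.nrm acc)) 0 0 p) :
    ∃ F', MemRel (exec (mem, acc) (op, j)).1 F' ∧ (∀ tr, tr ≠ tt → tr ≠ mm → F' tr = F tr) ∧
      Rch' (Dur F F') (fun t' => Cf F' t' (.F (.nrm (exec (mem, acc) (op, j)).2)) 0 0 (p + 1 + j)) t := by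
  by_cases hd : op = .dec ∧ acc = true
  · obtain ⟨rfl, rfl⟩ := hd
    have : (exec (mem, true) (.dec, j)).2 = true := by simp [exec]
    rw [this]
    exact instr_dec hc hop hq hm h
  · exact instr_plain hc hop hm h hd

end
end GapU

namespace GapU
open Order Tr

/-! ### Texts -/

inductive Parses (f : ℕ → ℕ) : ℕ → Script → Prop
  | nil {p} : opOf (f p) = none → Parses f p []
  | cons {p op j L} : opOf (f p) = some op → (∀ l < j, f (p + 1 + l) = 1) → f (p + 1 + j) ≠ 1 →
      Parses f (p + 1 + j) L → Parses f p ((op, j) :: L)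

def digits (n k : ℕ) : ℕ := n / 16 ^ k % 16

theorem Parses.shift {f f' : ℕ → ℕ} {p L c} (h : Parses f p L) (hf : ∀ k, f' (k + c) = f k) :
    Parses f' (p + c) L := by
  induction h with
  | nil h => exact .nil (by rw [hf]; exact h)
  | @cons p op j L h1 h2 h3 _ ih =>
    have e : ∀ l, p + c + 1 + l = p + 1 + l + c := fun l => by omega
    refine .cons (by rw [hf]; exact h1) (fun l hl => ?_) ?_ ?_
    · rw [e, hf]; exact h2 l hl
    · rw [e, hf]; exact h3
    · rw [e]; exact ih

theorem digits_lt (n k : ℕ) : digits n k < 16 := Nat.mod_lt _ (by norm_num)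

theorem digits_zero (n : ℕ) {k : ℕ} (h : n ≤ k) : digits n k = 0 := by
  unfold digits
  rw [Nat.div_eq_of_lt]
  exact lt_of_le_of_lt h (Nat.lt_pow_self (by norm_num))

theorem digits_head (c n : ℕ) (h : c < 16) : digits (c + 16 * n) 0 = c := by
  simp only [digits, pow_zero, Nat.div_one]; omega

theorem digits_tail (c n k : ℕ) (h : c < 16) : digits (c + 16 * n) (k + 1) = digits n k := by
  unfold digits
  rw [pow_succ', ← Nat.div_div_eq_div_mul, show (c + 16 * n) / 16 = n by omega]

theorem exists_parses (n p : ℕ) : ∃ L, Parses (digits n) p L := by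
  induction hN : n - p using Nat.strong_induction_on generalizing p with
  | _ N ih =>
    cases hop : opOf (digits n p) with
    | none => exact ⟨[], .nil hop⟩
    | some op =>
      have hp : p < n := by
        by_contra h
        rw [digits_zero n (not_lt.1 h)] at hop
        simp [opOf] at hop
      have hex : ∃ j, digits n (p + 1 + j) ≠ 1 := ⟨n, by rw [digits_zero n (by omega)]; simp⟩
      classical
      obtain ⟨L, hL⟩ := ih (n - (p + 1 + Nat.find hex)) (by omega) (p + 1 + Nat.find hex) rfl
      exact ⟨_, .cons hop (fun l hl => not_not.1 (Nat.find_min hex hl)) (Nat.find_spec hex) hL⟩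

def opSym : Op → ℕ
  | .one => 2 | .and => 3 | .andn => 4 | .set => 5 | .clr => 6 | .inc => 7 | .dec => 8

def fillN : ℕ → ℕ → ℕ
  | 0, n => n
  | j + 1, n => 1 + 16 * fillN j n

def num : Script → ℕ
  | [] => 0
  | (op, j) :: L => opSym op + 16 * fillN j (num L)

theorem fillN_lt (j n l : ℕ) (h : l < j) : digits (fillN j n) l = 1 := by
  induction j generalizing l with
  | zero => omega
  | succ j ih =>
    cases l with
    | zero => exact digits_head _ _ (by norm_num)
    | succ l => rw [fillN, digits_tail _ _ _ (by norm_num)]; exact ih l (by omega)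

theorem fillN_ge (j n k : ℕ) : digits (fillN j n) (k + j) = digits n k := by
  induction j with
  | zero => rfl
  | succ j ih => rw [fillN, ← add_assoc, digits_tail _ _ _ (by norm_num)]; exact ih

theorem opSym_lt (op : Op) : opSym op < 16 := by cases op <;> decide

theorem num_head (L : Script) : digits (num L) 0 ≠ 1 := by
  rcases L with _ | ⟨⟨op, j⟩, L⟩
  · simp [num, digits]
  · rw [num, digits_head _ _ (opSym_lt op)]; cases op <;> decide

theorem parses_num (L : Script) : Parses (digits (num L)) 0 L := by
  induction L with
  | nil => exact .nil (by simp [num, digits, opOf])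
  | cons I L ih =>
    obtain ⟨op, j⟩ := I
    have e : ∀ l, digits (num ((op, j) :: L)) (0 + 1 + l) = digits (fillN j (num L)) l := by
      intro l
      rw [num, show 0 + 1 + l = l + 1 by omega, digits_tail _ _ _ (opSym_lt op)]
    refine .cons ?_ (fun l hl => ?_) ?_ ?_
    · rw [num, digits_head _ _ (opSym_lt op)]; cases op <;> rfl
    · rw [e]; exact fillN_lt _ _ _ hl
    · rw [e]; have := fillN_ge j (num L) 0; rw [zero_add] at this; rw [this]; exact num_head L
    · have := ih.shift (f' := digits (num ((op, j) :: L))) (c := 1 + j) (fun k => by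
        rw [show k + (1 + j) = 0 + 1 + (k + j) by omega, e, fillN_ge])
      rwa [show 0 + (1 + j) = 0 + 1 + j by omega] at this

theorem Parses.unique {f : ℕ → ℕ} {p L L'} (h : Parses f p L) (h' : Parses f p L') : L = L' := by
  induction h generalizing L' with
  | nil h =>
    cases h' with
    | nil _ => rfl
    | cons h1 => rw [h] at h1; cases h1
  | @cons p op j L h1 h2 h3 _ ih =>
    cases h' with
    | nil h => rw [h] at h1; cases h1
    | @cons _ op' j' L' g1 g2 g3 g4 =>
      obtain rfl : op = op' := by rw [h1] at g1; simpa using g1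
      obtain rfl : j = j' := by
        rcases lt_trichotomy j j' with h | h | h
        · exact absurd (g2 j h) h3
        · exact h
        · exact absurd (h2 j' h) g3
      rw [ih g4]

def scr (n : ℕ) : Script := Classical.choose (exists_parses n 0)
theorem scr_parses (n : ℕ) : Parses (digits n) 0 (scr n) := Classical.choose_spec (exists_parses n 0)
theorem scr_num (L : Script) : scr (num L) = L := (scr_parses _).unique (parses_num L)

end GapU

namespace GapU
open Order Tr

/-! ### One stage -/

section
variable {F G B : Tr → Ordinal.{0} → Bool} {t σ α : Ordinal.{0}} {p : ℕ} {L : Script} {s0 : Mem × Bool}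

/-- bits common to all the prefixes of the stage -/
structure Bits (L : Script) (s0 : Mem × Bool) (G : Tr → Ordinal.{0} → Bool) : Prop where
  tt : ∀ j i, (∀ k, (execL (L.take k) s0).1.T j i = true) → G tt (pl (ω * i) (1 + j)) = true
  mm : ∀ j i, (∀ k, i < (execL (L.take k) s0).1.h j) → G mm (pl (ω * i) (1 + j)) = true

theorem MemRel.bits {k : ℕ} (h : MemRel (execL (L.take k) s0).1 G) : Bits L s0 G :=
  ⟨fun j i hh => by rw [h.tt]; exact hh k, fun j i hh => by rw [h.mm]; simpa using hh k⟩

theorem stage_run (hL : Parses (SF F) p L) (hq : F q = fun _ => false) (hm : MemRel s0.1 F)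
    (h : Cf F t (.F (.nrm s0.2)) 0 0 p) :
    ∃ t' F' x, t < t' ∧ Cf F' t' (.TK (execL L s0).2) 0 0 x ∧ MemRel (execL L s0).1 F' ∧
      (∀ tr, tr ≠ tt → tr ≠ mm → F' tr = F tr) ∧
      (∀ k, ∃ ρ G, t ≤ ρ ∧ ρ < t' ∧ Fr G ρ ∧ MemRel (execL (L.take k) s0).1 G) ∧
      (∀ ρ, t ≤ ρ → ρ < t' → 8 ≤ code (st ρ) ∧ ∃ G, Fr G ρ ∧
        (∀ tr, tr ≠ tt → tr ≠ mm → tr ≠ q → G tr = F tr) ∧ Bits L s0 G) := by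
  induction L generalizing F t p s0 with
  | nil =>
    cases hL with
    | nil hop =>
    have e1 : base (.F (.nrm s0.2)) (rd t) = some (.TK s0.2, rd t, dir false false false) := by
      have : opOf (sym (rd t)) = none := by rw [h.rsym]; exact hop
      simp [base, h.rzr, h.rzy, this]
    have h1 := h.go e1 (fun _ _ _ => rfl)
    simp only [Bool.false_eq_true, if_false, leftOf_zero] at h1
    refine ⟨t + 1, F, p - 1, lt_add_one t, h1, hm, fun _ _ _ => rfl, fun k => ⟨t, F, le_rfl, lt_add_one t, h.fr, ?_⟩,
      fun ρ a1 a2 => ?_⟩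
    · simpa [execL] using hm
    · obtain rfl : ρ = t := le_antisymm (Order.lt_add_one_iff.1 a2) a1
      refine ⟨by rw [h.st]; exact code_F _, F, h.fr, fun _ _ _ _ => rfl, MemRel.bits (k := 0) ?_⟩
      simpa [execL] using hm
  | cons I L ih =>
    cases hL with
    | @cons _ op j _ hop hfill hendNe hL =>
    have hc : Cx F p j := ⟨by rintro e; rw [e] at hop; simp [opOf] at hop, hfill, hendNe⟩
    obtain ⟨F1, b1, b2, t1, b3, b4, b5⟩ := instr hc hop hq (mem := s0.1) (acc := s0.2) hm h
    have hSF : SF F1 = SF F := SF_congr fun i => b2 _ (by simp) (by simp)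
    obtain ⟨t', F', x, c1, c2, c3, c4, c5, c6⟩ := ih (F := F1) (s0 := exec s0 (op, j)) (by rw [hSF]; exact hL)
      (by rw [b2 _ (by simp) (by simp)]; exact hq) b1 b5
    refine ⟨t', F', x, b3.trans c1, c2, c3, fun tr h1 h2 => by rw [c4 tr h1 h2, b2 tr h1 h2], fun k => ?_,
      fun ρ a1 a2 => ?_⟩
    · cases k with
      | zero => exact ⟨t, F, le_rfl, b3.trans c1, h.fr, hm⟩
      | succ k =>
        obtain ⟨ρ, G, d1, d2, d3, d4⟩ := c5 k
        exact ⟨ρ, G, b3.le.trans d1, d2, d3, d4⟩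
    · rcases lt_or_ge ρ t1 with hlt | hge
      · obtain ⟨d1, G, d2, d3, d4⟩ := b4 ρ a1 hlt
        refine ⟨d1, G, d2, d3, ?_, ?_⟩
        · intro j' i hh
          refine d4 _ _ (Or.inl rfl) ?_ ?_
          · rw [hm.tt]; exact hh 0
          · rw [b1.tt]; exact hh 1
        · intro j' i hh
          refine d4 _ _ (Or.inr rfl) ?_ ?_
          · rw [hm.mm]; exact decide_eq_true (hh 0)
          · rw [b1.mm]; exact decide_eq_true (hh 1)
      · obtain ⟨d1, G, d2, d3, d4⟩ := c6 ρ hge a2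
        refine ⟨d1, G, d2, fun tr e1 e2 e3 => by rw [d3 tr e1 e2 e3, b2 tr e1 e2], ?_, ?_⟩
        · exact fun j i hh => d4.tt j i fun k => hh (k + 1)
        · exact fun j i hh => d4.mm j i fun k => hh (k + 1)

theorem hd_limit_nat {T : Ordinal.{0}} (hT : IsSuccLimit T) {x0 : ℕ}
    (h : ∀ ρ < T, ∃ i, ρ ≤ i ∧ i < T ∧ hd .X i ≤ x0) : ∃ x ≤ x0, hd .X T = (x : Ordinal.{0}) := by
  have h1 : hd .X T ≤ x0 := by rw [hd_limit hT]; exact liminfAt_le h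
  obtain ⟨x, hx⟩ := Ordinal.lt_omega0.1 (h1.trans_lt (Ordinal.nat_lt_omega0 x0))
  exact ⟨x, by rw [hx] at h1; exact_mod_cast h1, hx⟩

theorem tk_scan {acc : Bool} {x0 : ℕ} (h : Cf F t (.TK acc) 0 0 x0) (hs : ∀ x < σ, F s x = true) :
    Rch (fun ρ => ∃ r x, Cf F ρ (.TK acc) r 0 x) (fun t' => ∃ x, Cf F t' (.TK acc) σ 0 x) t := by
  refine (loopR (Pre := fun r t => ∃ x ≤ x0, Cf F t (.TK acc) r 0 x)
    (P := fun r t => ∃ x ≤ x0, Cf F t (.TK acc) r 0 x) (i0 := 0) (h := σ) zero_le ⟨x0, le_rfl, h⟩ ?_ ?_).mono ?_ ?_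
  · rintro r t - hr - ⟨x, hx, h⟩
    have e1 : base (.TK acc) (rd t) = some (.TK acc, rd t, dir true false false) := by
      simp [base, h.rs, hs r hr]
    have h1 := h.go e1 (fun _ _ _ => rfl)
    simp only [Bool.false_eq_true, if_false, if_true, leftOf_zero] at h1
    exact Rch.step ⟨x, hx, h⟩ (Rch.done ⟨x - 1, by omega, h1⟩)
  · intro lam T a1 a2 a3 a4 a5
    have hT := a5.lim
    obtain ⟨s1, b1, -, b2⟩ := a5.ev 0 le_rfl a1
    obtain ⟨x, c1, c2⟩ := hd_limit_nat hT (x0 := x0) fun ρ hρ => by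
      obtain ⟨j, s, d1, d2, d3, d4, x, d5, d6⟩ := a5.cof ρ hρ 0 le_rfl a1
      exact ⟨s, d3, d4, by rw [d6.X]; exact_mod_cast d5⟩
    refine ⟨x, c1, ⟨⟨?_, ?_, ?_, c2⟩, ?_⟩⟩
    · refine st_limit_const hT ⟨s1, b1, fun ρ d1 d2 => ?_⟩
      obtain ⟨j, -, -, x, -, h⟩ := b2 ρ d1 d2
      exact h.st
    · refine hd_limit_eq hT (fun x hx => ?_) fun ρ hρ => ?_
      · obtain ⟨s2, d1, -, d2⟩ := a5.ev (x + 1) zero_le (a3.add_one_lt hx)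
        refine ⟨s2, d1, fun ρ e1 e2 => ?_⟩
        obtain ⟨j, f1, f2, _, _, h⟩ := d2 ρ e1 e2
        rw [h.R]; exact (lt_add_one x).trans_le f1
      · obtain ⟨j, s, d1, d2, d3, d4, x, d5, d6⟩ := a5.cof ρ hρ 0 le_rfl a1
        exact ⟨s, d3, d4, by rw [d6.R]; exact d2.le⟩
    · refine hd_limit_eq hT (fun x hx => absurd hx not_lt_zero) fun ρ hρ => ?_
      obtain ⟨j, s, d1, d2, d3, d4, x, d5, d6⟩ := a5.cof ρ hρ 0 le_rfl a1
      exact ⟨s, d3, d4, d6.Y.le⟩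
    · refine Fr.limit hT ⟨s1, b1, fun ρ d1 d2 => ?_⟩
      obtain ⟨j, -, -, x, -, h⟩ := b2 ρ d1 d2
      exact h.fr
  · rintro ρ - ⟨j, -, -, x, -, h⟩; exact ⟨j, x, h⟩
  · rintro ρ - ⟨x, -, h⟩; exact ⟨x, h⟩

/-! ### Ticks -/

structure TickF (L : Script) (B : Tr → Ordinal.{0} → Bool) (σ : Ordinal.{0}) (F : Tr → Ordinal.{0} → Bool) : Prop where
  mem : MemRel (absRun L σ) F
  q : F q = fun _ => false
  s : ∀ x, F s x = true ↔ x < σ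
  rest : ∀ tr, tr ≠ bb → tr ≠ vv → tr ≠ tt → tr ≠ mm → tr ≠ Tr.q → tr ≠ Tr.s → F tr = B tr

def Tick (L : Script) (B : Tr → Ordinal.{0} → Bool) (σ t : Ordinal.{0}) : Prop :=
  ∃ F, Cf F t (.F (.nrm false)) 0 0 0 ∧ TickF L B σ F

/-- the situation at times during a tick -/
def Dur2 (L : Script) (B : Tr → Ordinal.{0} → Bool) (σ ρ : Ordinal.{0}) : Prop :=
  8 ≤ code (st ρ) ∧ ∃ G, Fr G ρ ∧ (∀ tr, tr ≠ bb → tr ≠ vv → tr ≠ tt → tr ≠ mm → tr ≠ q → tr ≠ s → G tr = B tr) ∧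
    Bits L (absRun L σ, false) G ∧ ∀ x < σ, G s x = true

structure TickThr (L : Script) (B : Tr → Ordinal.{0} → Bool) (σ u u' : Ordinal.{0}) : Prop where
  seg : ∀ ρ, u ≤ ρ → ρ < u' → Dur2 L B σ ρ
  att : ∀ k, ∃ ρ G, u ≤ ρ ∧ ρ < u' ∧ Fr G ρ ∧ MemRel (pref L k (absRun L σ)).1 G

theorem tick_limit {lam T : Ordinal.{0}} (h0 : 0 < lam) (hlam : IsSuccLimit lam)
    (hl : Lim (Tick L B) (TickThr L B) 0 lam T) : Tick L B lam T := by
  have hT := hl.lim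
  have ev : ∀ i < lam, ∃ s < T, ∀ ρ, s ≤ ρ → ρ < T → ∃ j, i ≤ j ∧ j < lam ∧ Dur2 L B j ρ := by
    intro i hi
    obtain ⟨s, a1, -, a2⟩ := hl.ev i zero_le hi
    refine ⟨s, a1, fun ρ b1 b2 => ?_⟩
    obtain ⟨j, u, u', c1, c2, c3, c4, c5, c6⟩ := a2 ρ b1 b2
    exact ⟨j, c1, c2, c6.seg ρ c3 c4⟩
  have cof : ∀ ρ < T, ∃ j s, j < lam ∧ ρ ≤ s ∧ s < T ∧ Tick L B j s := by
    intro ρ hρ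
    obtain ⟨i, -, a2, a3⟩ := hl.cof ρ hρ
    obtain ⟨s, s', b1, b2, b3, b4, -⟩ := a3 i le_rfl a2
    exact ⟨i, s, a2, b1, b2.trans b3, b4⟩
  obtain ⟨s0, hs0, ev0⟩ := ev 0 h0
  have hFr : Fr (fun tr => tp tr T) T := by
    refine ⟨?_, fun _ _ _ => rfl⟩
    obtain ⟨j, -, -, -, G, h, -⟩ := ev0 s0 le_rfl hs0
    exact h.pos.trans hs0.le
  refine ⟨fun tr => tp tr T, ⟨⟨?_, ?_, ?_, ?_⟩, hFr⟩, ⟨?_, ?_, ?_, ?_⟩⟩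
  · refine st_limit hT ⟨s0, hs0, fun ρ a1 a2 => ?_⟩ fun ρ hρ => ?_
    · obtain ⟨j, -, -, h, -⟩ := ev0 ρ a1 a2
      exact h
    · obtain ⟨j, s, -, a2, a3, F, a4, -⟩ := cof ρ hρ
      exact ⟨s, a2, a3, a4.st⟩
  · refine hd_limit_eq hT (fun x hx => absurd hx not_lt_zero) fun ρ hρ => ?_
    obtain ⟨j, s, -, a2, a3, F, a4, -⟩ := cof ρ hρ
    exact ⟨s, a2, a3, a4.R.le⟩
  · refine hd_limit_eq hT (fun x hx => absurd hx not_lt_zero) fun ρ hρ => ?_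
    obtain ⟨j, s, -, a2, a3, F, a4, -⟩ := cof ρ hρ
    exact ⟨s, a2, a3, a4.Y.le⟩
  · refine hd_limit_eq hT (fun x hx => ?_) fun ρ hρ => ?_
    · simp at hx
    obtain ⟨j, s, -, a2, a3, F, a4, -⟩ := cof ρ hρ
    exact ⟨s, a2, a3, a4.X.le⟩
  · refine ⟨fun i j => ?_, fun i j => ?_⟩
    · rw [Bool.eq_iff_iff, tp_limit hT, absRun_limit_T L hlam]
      constructor
      · rintro ⟨ρ, a1, a2⟩
        obtain ⟨γ, -, b2, b3⟩ := hl.cof ρ a1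
        refine ⟨γ, b2, fun σ c1 c2 k => ?_⟩
        obtain ⟨u, u', d1, d2, d3, -, -, d4⟩ := b3 σ c1 c2
        obtain ⟨ρ', G, e1, e2, e3, e4⟩ := d4.att k
        rw [← e4.tt, ← e3.eq _ (by simp) (by simp)]
        exact a2 ρ' (d1.trans e1) (e2.trans d3)
      · rintro ⟨γ, a1, a2⟩
        obtain ⟨s1, b1, b2⟩ := ev γ a1
        refine ⟨s1, b1, fun ρ c1 c2 => ?_⟩
        obtain ⟨σ, d1, d2, -, G, d3, -, d4, -⟩ := b2 ρ c1 c2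
        rw [d3.eq _ (by simp) (by simp)]
        exact d4.tt j i (a2 σ d1 d2)
    · rw [Bool.eq_iff_iff, tp_limit hT, decide_eq_true_eq, absRun_limit_h L hlam]
      constructor
      · rintro ⟨ρ, a1, a2⟩
        obtain ⟨γ, -, b2, b3⟩ := hl.cof ρ a1
        refine ⟨γ, b2, fun σ c1 c2 k => ?_⟩
        obtain ⟨u, u', d1, d2, d3, -, -, d4⟩ := b3 σ c1 c2
        obtain ⟨ρ', G, e1, e2, e3, e4⟩ := d4.att k
        rw [← decide_eq_true_eq (p := i < _), ← e4.mm, ← e3.eq _ (by simp) (by simp)]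
        exact a2 ρ' (d1.trans e1) (e2.trans d3)
      · rintro ⟨γ, a1, a2⟩
        obtain ⟨s1, b1, b2⟩ := ev γ a1
        refine ⟨s1, b1, fun ρ c1 c2 => ?_⟩
        obtain ⟨σ, d1, d2, -, G, d3, -, d4, -⟩ := b2 ρ c1 c2
        rw [d3.eq _ (by simp) (by simp)]
        exact d4.mm j i (a2 σ d1 d2)
  · funext x
    refine tp_limit_false hT fun ρ hρ => ?_
    obtain ⟨j, s, -, a2, a3, F, a4, a5⟩ := cof ρ hρ
    exact ⟨s, a2, a3, by rw [a4.fr.eq _ (by simp) (by simp), a5.q]⟩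
  · intro x
    constructor
    · intro h
      by_contra hx
      rw [tp_limit_false hT] at h
      · simp at h
      intro ρ hρ
      obtain ⟨j, s, a1, a2, a3, F, a4, a5⟩ := cof ρ hρ
      refine ⟨s, a2, a3, ?_⟩
      rw [a4.fr.eq _ (by simp) (by simp), ← Bool.not_eq_true, a5.s]
      exact fun h => hx (h.trans a1)
    · intro hx
      obtain ⟨s1, b1, b2⟩ := ev (x + 1) (hlam.add_one_lt hx)
      refine tp_limit_const hT ⟨s1, b1, fun ρ c1 c2 => ?_⟩
      obtain ⟨σ, d1, d2, -, G, d3, -, -, d4⟩ := b2 ρ c1 c2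
      rw [d3.eq _ (by simp) (by simp)]
      exact d4 x ((lt_add_one x).trans_le d1)
  · intro tr h5 h6 h1 h2 h3 h4
    funext x
    refine tp_limit_const hT ⟨s0, hs0, fun ρ c1 c2 => ?_⟩
    obtain ⟨σ, d1, d2, -, G, d3, d4, -⟩ := ev0 ρ c1 c2
    rw [d3.eq _ h5 h6, d4 tr h5 h6 h1 h2 h3 h4]

end
end GapU

namespace GapU
open Order Tr

/-! ### Running all the ticks -/

section
variable {F G B : Tr → Ordinal.{0} → Bool} {t σ α : Ordinal.{0}} {L : Script}

/-- frame after a stage -/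
structure StageF (L : Script) (B : Tr → Ordinal.{0} → Bool) (σ : Ordinal.{0}) (F : Tr → Ordinal.{0} → Bool) : Prop where
  mem : MemRel (stage L (absRun L σ)).1 F
  q : F q = fun _ => false
  s : ∀ x, F s x = true ↔ x < σ
  rest : ∀ tr, tr ≠ bb → tr ≠ vv → tr ≠ tt → tr ≠ mm → tr ≠ Tr.q → tr ≠ Tr.s → F tr = B tr

theorem StageF.dur2 {ρ} (h : StageF L B σ F) (hf : Fr F ρ) (hc : 8 ≤ code (st ρ)) : Dur2 L B σ ρ :=
  ⟨hc, F, hf, h.rest, MemRel.bits (k := L.length) (by rw [List.take_length]; exact h.mem), fun x hx => (h.s x).2 hx⟩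

theorem tick_stage (hL : Parses (SF B) 0 L) (h : Tick L B σ t) :
    ∃ t' F' x, t < t' ∧ Cf F' t' (.TK (stage L (absRun L σ)).2) σ 0 x ∧ StageF L B σ F' ∧
      TickThr L B σ t t' := by
  obtain ⟨F, h1, h2⟩ := h
  have hSF : SF F = SF B := SF_congr fun i => h2.rest _ (by simp) (by simp) (by simp) (by simp) (by simp) (by simp)
  obtain ⟨t1, F1, x1, a1, a2, a3, a4, a5, a6⟩ := stage_run (F := F) (t := t) (s0 := (absRun L σ, false))
    (by rw [hSF]; exact hL) h2.q h2.mem h1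
  have hs : StageF L B σ F1 := by
    refine ⟨a3, ?_, ?_, ?_⟩
    · rw [a4 _ (by simp) (by simp)]; exact h2.q
    · rw [a4 _ (by simp) (by simp)]; exact h2.s
    · intro tr e1 e2 e3 e4 e5 e6
      rw [a4 _ e3 e4]; exact h2.rest tr e1 e2 e3 e4 e5 e6
  obtain ⟨t2, b1, b2, x2, b3⟩ := tk_scan (σ := σ) a2 fun x hx => (hs.s x).2 hx
  refine ⟨t2, F1, x2, a1.trans_le b1, b3, hs, ⟨fun ρ c1 c2 => ?_, fun k => ?_⟩⟩
  · rcases lt_or_ge ρ t1 with e | e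
    · obtain ⟨d1, G, d2, d3, d4⟩ := a6 ρ c1 e
      refine ⟨d1, G, d2, fun tr e1 e2 e3 e4 e5 e6 => ?_, d4, fun x hx => ?_⟩
      · rw [d3 tr e3 e4 e5]; exact h2.rest tr e1 e2 e3 e4 e5 e6
      · rw [d3 _ (by simp) (by simp) (by simp)]; exact (h2.s x).2 hx
    · obtain ⟨r, x, d⟩ := b2 ρ e c2
      refine hs.dur2 d.fr ?_
      rw [d.st]
      generalize (execL L (absRun L σ, false)).2 = c
      cases c <;> simp [code]
  · obtain ⟨ρ, G, c1, c2, c3, c4⟩ := a5 k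
    exact ⟨ρ, G, c1, c2.trans_le b1, c3, c4⟩

theorem tick_step (hL : Parses (SF B) 0 L) (h : Tick L B σ t) (ha : B a σ = true) (hev : ¬ ev L σ) :
    ∃ t', t < t' ∧ Tick L B (σ + 1) t' ∧ TickThr L B σ t t' := by
  obtain ⟨t1, F1, x1, a1, a2, a3, a4⟩ := tick_stage hL h
  have hacc : (stage L (absRun L σ)).2 = false := by simpa [ev] using hev
  rw [hacc] at a2
  have hs : F1 s σ = false := by
    rw [← Bool.not_eq_true, a3.s]; exact lt_irrefl _
  have haa : F1 a σ = true := by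
    rw [a3.rest _ (by simp) (by simp) (by simp) (by simp) (by simp) (by simp)]; exact ha
  have e1 : base (.TK false) (rd t1) = some (.TKh, upd (rd t1) s true, dir false false false) := by
    simp [base, a2.rs, hs, a2.ra, haa]
  set F2 : Tr → Ordinal.{0} → Bool := Function.update F1 s (Function.update (F1 s) σ true) with hF2
  have hF2n : ∀ tr, tr ≠ s → F2 tr = F1 tr := fun tr h => by rw [hF2, Function.update_of_ne h]
  have hF2s : ∀ x, F2 s x = true ↔ x < σ + 1 := by
    intro x
    rw [hF2, Function.update_self, Function.update_apply, Order.lt_add_one_iff, le_iff_eq_or_lt]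
    split_ifs with e
    · simp [e]
    · rw [a3.s]; simp [e]
  have h2 := a2.gow (F' := F2) e1 (fun tr c1 c2 => by
    by_cases e : tr = s
    · subst e
      show Function.update (F1 s) (hd .R t1) _ = _
      rw [a2.R, hF2]; simp [upd]
    · rw [hF2n tr e]
      simp only [upd]
      rw [Function.update_of_ne e]
      exact a2.upd_self tr c1 c2)
  simp only [Bool.false_eq_true, if_false, leftOf_zero] at h2
  have hmem : MemRel (stage L (absRun L σ)).1 F2 :=
    ⟨fun i j => by rw [hF2n _ (by simp)]; exact a3.mem.tt i j, fun i j => by rw [hF2n _ (by simp)]; exact a3.mem.mm i j⟩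
  have hrest : ∀ tr, tr ≠ bb → tr ≠ vv → tr ≠ tt → tr ≠ mm → tr ≠ q → tr ≠ s → F2 tr = B tr := by
    intro tr c1 c2 c3 c4 c5 c6
    rw [hF2n tr c6, a3.rest tr c1 c2 c3 c4 c5 c6]
  have hdur : ∀ ρ, Fr F2 ρ → st ρ = .TKh → Dur2 L B σ ρ := fun ρ c1 c2 =>
    ⟨by rw [c2]; simp [code], F2, c1, hrest, MemRel.bits (k := L.length) (by rw [List.take_length]; exact hmem),
      fun x hx => (hF2s x).2 (hx.trans (lt_add_one σ))⟩
  obtain ⟨t3, b1, b2, r', y', x', -, b3, -, b4, b5, b6⟩ := homeLLL (F := F2) (σ := .TKh) (c := fun r _ x => r = 0 ∧ x = 0)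
    (fun t r y x h hc => by
      have : (rd t zr && rd t zx) = false := by rw [h.rzr, h.rzx]; simpa using hc
      simp [base, this]) ⟨rfl, rfl⟩ h2
  obtain rfl : y' = 0 := le_antisymm b3 zero_le
  subst b5 b6
  have e3 : base .TKh (rd t3) = some (.F (.nrm false), rd t3, dir false false false) := by
    simp [base, b4.rzr, b4.rzx]
  have h4 := b4.go e3 (fun _ _ _ => rfl)
  simp only [Bool.false_eq_true, if_false, leftOf_zero, Nat.zero_sub] at h4
  refine ⟨t3 + 1, (a1.trans (lt_add_one t1)).trans_le (b1.trans le_self_add), ⟨F2, h4, ?_, ?_, hF2s, hrest⟩, ?_, ?_⟩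
  · rw [absRun_succ]; exact hmem
  · rw [hF2n _ (by simp)]; exact a3.q
  · intro ρ c1 c2
    rcases lt_or_ge ρ t1 with e | e
    · exact a4.seg ρ c1 e
    rcases e.lt_or_eq with e | rfl
    · rcases lt_or_ge ρ t3 with f | f
      · obtain ⟨r, y, x, d⟩ := b2 ρ (Order.add_one_le_of_lt e) f
        exact hdur ρ d.fr d.st
      · obtain rfl : ρ = t3 := le_antisymm (Order.lt_add_one_iff.1 c2) f
        exact hdur ρ b4.fr b4.st
    · exact a3.dur2 a2.fr (by rw [a2.st]; simp [code])
  · intro k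
    obtain ⟨ρ, G, c1, c2, c3, c4⟩ := a4.att k
    exact ⟨ρ, G, c1, c2.trans_le ((le_self_add.trans b1).trans le_self_add), c3, c4⟩

/-- the situation at the start of `E0` -/
structure Out (L : Script) (B F : Tr → Ordinal.{0} → Bool) (α σ : Ordinal.{0}) : Prop where
  q : F q = fun _ => false
  s : ∀ x, F s x = true ↔ x < σ
  rest : ∀ tr, tr ≠ bb → tr ≠ vv → tr ≠ tt → tr ≠ mm → tr ≠ Tr.q → tr ≠ Tr.s → tr ≠ a → tr ≠ g → F tr = B tr
  out : ((∀ x, F a x = true ↔ x < α + 1) ∧ F g 0 = false ∧ firstEvent L α) ∨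
    (F a = B a ∧ F g = B g ∧ ¬ firstEvent L α)

theorem ticks (hL : Parses (SF B) 0 L) (h : Tick L B 0 t) (ha : ∀ x, B a x = true ↔ x < α) :
    ∃ t' F σ r x, t < t' ∧ Cf F t' .E0 r 0 x ∧ Out L B F α σ ∧ ∀ ρ, t ≤ ρ → ρ < t' → 8 ≤ code (st ρ) := by
  obtain ⟨σ, hσ1, hσ2⟩ : ∃ σ, (σ = α ∨ ev L σ) ∧ ∀ τ < σ, ¬ (τ = α ∨ ev L τ) := by
    have hne : {σ | σ = α ∨ ev L σ}.Nonempty := ⟨α, Or.inl rfl⟩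
    exact ⟨sInf _, csInf_mem hne, fun τ hτ => notMem_of_lt_csInf' (s := {σ | σ = α ∨ ev L σ}) hτ⟩
  have hle : σ ≤ α := not_lt.1 fun hh => hσ2 α hh (Or.inl rfl)
  obtain ⟨t1, a1, a2, -, a3⟩ := loop (Pre := Tick L B) (Thr := TickThr L B) (i0 := 0) (h := σ) (t0 := t) zero_le h
    (fun i t _ c2 _ c4 => tick_step hL c4 ((ha i).2 (c2.trans_le hle)) fun hh => hσ2 i c2 (Or.inr hh))
    (fun lam T c1 _ c3 _ c5 => tick_limit c1 c3 c5)
  obtain ⟨t2, F, x, b1, b2, b3, b4⟩ := tick_stage hL a2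
  have hseg : ∀ ρ, t ≤ ρ → ρ < t2 + 1 → 8 ≤ code (st ρ) := by
    intro ρ c1 c2
    rcases (Order.lt_add_one_iff.1 c2).lt_or_eq with e | rfl
    · rcases lt_or_ge ρ t1 with f | f
      · obtain ⟨j, u, u', -, -, d1, d2, -, d3⟩ := a3 ρ c1 f
        exact (d3.seg ρ d1 d2).1
      · exact (b4.seg ρ f e).1
    · rw [b2.st]
      generalize (stage L (absRun L σ)).2 = c
      cases c <;> simp [code]
  have hlt : t < t2 + 1 := (a1.trans_lt b1).trans (lt_add_one t2)
  have hs : F s σ = false := by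
    rw [← Bool.not_eq_true, b3.s]; exact lt_irrefl _
  have haa : F a = B a := b3.rest _ (by simp) (by simp) (by simp) (by simp) (by simp) (by simp)
  have hgg : F g = B g := b3.rest _ (by simp) (by simp) (by simp) (by simp) (by simp) (by simp)
  rcases hle.lt_or_eq with hlt' | rfl
  · have hev : ev L σ := hσ1.resolve_left hlt'.ne
    have hacc : (stage L (absRun L σ)).2 = true := hev
    rw [hacc] at b2
    have e1 : base (.TK true) (rd t2) = some (.E0, rd t2, dir false false false) := by
      have : B a σ = true := (ha σ).2 hlt'
      simp [base, b2.rs, hs, b2.ra, haa, this]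
    have h2 := b2.go e1 (fun _ _ _ => rfl)
    simp only [Bool.false_eq_true, if_false, leftOf_zero] at h2
    refine ⟨t2 + 1, F, σ, _, _, hlt, h2, ⟨b3.q, b3.s, fun tr c1 c2 c3 c4 c5 c6 _ _ => b3.rest tr c1 c2 c3 c4 c5 c6,
      Or.inr ⟨haa, hgg, fun hf => ?_⟩⟩, hseg⟩
    exact hf.2 σ hlt' hev
  · have hna : F a σ = false := by
      rw [haa, ← Bool.not_eq_true, ha]; exact lt_irrefl _
    by_cases hev : ev L σ
    · have hacc : (stage L (absRun L σ)).2 = true := hev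
      rw [hacc] at b2
      have e1 : base (.TK true) (rd t2) = some (.E0, upd (upd (rd t2) a true) g false, dir false false false) := by
        simp [base, b2.rs, hs, b2.ra, hna]
      set F2 : Tr → Ordinal.{0} → Bool := Function.update (Function.update F a (Function.update (F a) σ true)) g
        (Function.update (F g) 0 false) with hF2
      have hF2n : ∀ tr, tr ≠ a → tr ≠ g → F2 tr = F tr := fun tr h h' => by
        rw [hF2, Function.update_of_ne h', Function.update_of_ne h]
      have h2 := b2.gow (F' := F2) e1 (fun tr c1 c2 => by
        by_cases e : tr = a
        · subst e
          show Function.update (F a) (hd .R t2) _ = _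
          rw [b2.R, hF2]; simp [upd]
        by_cases e' : tr = g
        · subst e'
          show Function.update (F g) (hd .K t2) _ = _
          rw [hK, hF2]; simp [upd]
        rw [hF2n tr e e']
        simp only [upd]
        rw [Function.update_of_ne e', Function.update_of_ne e]
        exact b2.upd_self tr c1 c2)
      simp only [Bool.false_eq_true, if_false, leftOf_zero] at h2
      refine ⟨t2 + 1, F2, σ, _, _, hlt, h2, ⟨?_, ?_, ?_, Or.inl ⟨?_, ?_, hev, fun τ hτ h => hσ2 τ hτ (Or.inr h)⟩⟩, hseg⟩
      · rw [hF2n _ (by simp) (by simp)]; exact b3.q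
      · rw [hF2n _ (by simp) (by simp)]; exact b3.s
      · intro tr c1 c2 c3 c4 c5 c6 c7 c8
        rw [hF2n _ c7 c8]; exact b3.rest tr c1 c2 c3 c4 c5 c6
      · intro x
        have : F2 a = Function.update (F a) σ true := by
          rw [hF2, Function.update_of_ne (by simp), Function.update_self]
        rw [this, Function.update_apply, Order.lt_add_one_iff, le_iff_eq_or_lt, haa]
        split_ifs with e
        · simp [e]
        · rw [ha]; simp [e]
      · rw [hF2]; simp
    · have hacc : (stage L (absRun L σ)).2 = false := by simpa [ev] using hev
      rw [hacc] at b2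
      have e1 : base (.TK false) (rd t2) = some (.E0, rd t2, dir false false false) := by
        simp [base, b2.rs, hs, b2.ra, hna]
      have h2 := b2.go e1 (fun _ _ _ => rfl)
      simp only [Bool.false_eq_true, if_false, leftOf_zero] at h2
      exact ⟨t2 + 1, F, σ, _, _, hlt, h2, ⟨b3.q, b3.s, fun tr c1 c2 c3 c4 c5 c6 _ _ => b3.rest tr c1 c2 c3 c4 c5 c6,
        Or.inr ⟨haa, hgg, fun hf => hev hf.1⟩⟩, hseg⟩

end
end GapU

namespace GapU
open Order Tr

/-! ### Clean-up and incrementation -/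

theorem Cf.self {t r y : Ordinal.{0}} {σ : St} {x : ℕ} (ht : 1 ≤ t) (h : At t σ r y x) :
    Cf (fun tr => tp tr t) t σ r y x := ⟨h, ht, fun _ _ _ => rfl⟩

def clean (tr : Tr) : Prop := tr = s ∨ tr = vv ∨ tr = tt ∨ tr = mm

theorem e1_step {t r : Ordinal.{0}} (ht : 1 ≤ t) (h : At t .E1 r r 0)
    (hs : tp s t r = true ∨ tp vv t r = true) :
    At (t + 1) .E1 (r + 1) (r + 1) 0 ∧ ∀ tr, clean tr → tp tr (t + 1) = Function.update (tp tr t) r false := by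
  have hrs : rd t s = tp s t r := by rw [← h.R]; rfl
  have hrv : rd t vv = tp vv t r := by rw [← h.Y]; rfl
  have e1 : base .E1 (rd t) = some (.E1, upd (upd (upd (upd (rd t) s false) vv false) tt false) mm false,
      dir true true false) := by
    have : (rd t s || rd t vv) = true := by rw [hrs, hrv]; simpa using hs
    simp [base, this]
  refine ⟨by simpa using h.go e1, fun tr htr => ?_⟩
  obtain ⟨-, -, e3, e4⟩ := step_base (h.st.symm ▸ e1)
  rcases htr with rfl | rfl | rfl | rfl
  · rw [e3 _ (by simp)]; show Function.update _ (hd .R t) _ = _; rw [h.R]; simp [upd]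
  · rw [e4, h.st, h.Y]; simp [upd, code]
  · rw [e3 _ (by simp)]; show Function.update _ (hd .Y t) _ = _; rw [h.Y]; simp [upd]
  · rw [e3 _ (by simp)]; show Function.update _ (hd .Y t) _ = _; rw [h.Y]; simp [upd]

structure Pre1 (t0 i t : Ordinal.{0}) : Prop where
  at' : At t .E1 i i 0
  eq : ∀ tr, clean tr → ∀ x, tp tr t x = true ↔ i ≤ x ∧ tp tr t0 x = true

theorem e1_scan {t0 σ V : Ordinal.{0}} (ht0 : 1 ≤ t0) (h : At t0 .E1 0 0 0)
    (hs : ∀ x, tp s t0 x = true ↔ x < σ) (hv : ∀ x, tp vv t0 x = true ↔ x < V)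
    (ht : ∀ x, tp tt t0 x = true → tp vv t0 x = true) (hm : ∀ x, tp mm t0 x = true → tp vv t0 x = true) :
    Rch' (fun ρ => st ρ = .E1) (fun t' => (∃ r, At t' .E2 r r 0) ∧ ∀ tr, clean tr → tp tr t' = fun _ => false) t0 := by
  have key : Rch (fun ρ => st ρ = .E1) (Pre1 t0 (max σ V)) t0 := by
    refine (loopR (Pre := Pre1 t0) (P := Pre1 t0) (i0 := 0) (h := max σ V) zero_le ⟨h, fun tr _ x => by simp⟩ ?_ ?_).mono ?_ ?_
    · intro i t _ hi htt hp
      have hi' : tp s t i = true ∨ tp vv t i = true := by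
        rw [hp.eq s (Or.inl rfl), hp.eq vv (Or.inr (Or.inl rfl)), hs, hv]
        simpa using lt_max_iff.1 hi
      obtain ⟨a1, a2⟩ := e1_step (ht0.trans htt) hp.at' hi'
      refine Rch.step hp (Rch.done ⟨a1, fun tr htr x => ?_⟩)
      rw [a2 tr htr, Function.update_apply]
      split_ifs with e
      · subst e; simp
      · rw [hp.eq tr htr, Order.add_one_le_iff]
        constructor
        · rintro ⟨b1, b2⟩; exact ⟨lt_of_le_of_ne b1 (Ne.symm e), b2⟩
        · rintro ⟨b1, b2⟩; exact ⟨b1.le, b2⟩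
    · intro lam T a1 a2 a3 a4 a5
      have hT := a5.lim
      obtain ⟨s1, b1, -, b2⟩ := a5.ev 0 le_rfl a1
      have hhd : ∀ γ : Gr, (∀ i t, Pre1 t0 i t → hd γ t = i) → hd γ T = lam := by
        intro γ hγ
        refine hd_limit_eq hT (fun x hx => ?_) fun ρ hρ => ?_
        · obtain ⟨s2, d1, -, d2⟩ := a5.ev (x + 1) zero_le (a3.add_one_lt hx)
          refine ⟨s2, d1, fun ρ e1 e2 => ?_⟩
          obtain ⟨j, f1, f2, h⟩ := d2 ρ e1 e2
          rw [hγ _ _ h]; exact (lt_add_one x).trans_le f1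
        · obtain ⟨j, s, d1, d2, d3, d4, d6⟩ := a5.cof ρ hρ 0 le_rfl a1
          exact ⟨s, d3, d4, by rw [hγ _ _ d6]; exact d2.le⟩
      refine ⟨⟨?_, hhd _ fun i t h => h.at'.R, hhd _ fun i t h => h.at'.Y, ?_⟩, fun tr htr x => ?_⟩
      · refine st_limit_const hT ⟨s1, b1, fun ρ d1 d2 => ?_⟩
        obtain ⟨j, -, -, h⟩ := b2 ρ d1 d2
        exact h.at'.st
      · refine hd_limit_eq hT (fun x hx => ?_) fun ρ hρ => ?_
        · simp at hx
        obtain ⟨j, s, d1, d2, d3, d4, d6⟩ := a5.cof ρ hρ 0 le_rfl a1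
        exact ⟨s, d3, d4, d6.at'.X.le⟩
      · rcases lt_or_ge x lam with hx | hx
        · have : tp tr T x = false := by
            obtain ⟨s2, d1, -, d2⟩ := a5.ev (x + 1) zero_le (a3.add_one_lt hx)
            refine tp_limit_const hT ⟨s2, d1, fun ρ e1 e2 => ?_⟩
            obtain ⟨j, f1, f2, h⟩ := d2 ρ e1 e2
            rw [← Bool.not_eq_true, h.eq tr htr]
            rintro ⟨g1, -⟩
            exact absurd (f1.trans g1) (not_le.2 (lt_add_one x))
          rw [this]; simp [hx]
        · have : tp tr T x = tp tr t0 x := by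
            refine tp_limit_const hT ⟨s1, b1, fun ρ e1 e2 => ?_⟩
            obtain ⟨j, f1, f2, h⟩ := b2 ρ e1 e2
            rw [Bool.eq_iff_iff, h.eq tr htr]
            simp [f2.le.trans hx]
          rw [this]; simp [hx]
    · rintro ρ - ⟨j, -, -, h⟩; exact h.at'.st
    · rintro ρ - h; exact h
  have hfal : ∀ t, Pre1 t0 (max σ V) t → ∀ tr, clean tr → tp tr t = fun _ => false := by
    intro t hp tr htr
    funext x
    rw [← Bool.not_eq_true, hp.eq tr htr]
    rintro ⟨c1, c2⟩
    have hV : ¬ tp vv t0 x = true := by rw [hv]; exact not_lt.2 ((le_max_right _ _).trans c1)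
    rcases htr with rfl | rfl | rfl | rfl
    · rw [hs] at c2; exact absurd c2 (not_lt.2 ((le_max_left _ _).trans c1))
    · exact hV c2
    · exact hV (ht x c2)
    · exact hV (hm x c2)
  refine key.bind' fun t htt hp => ?_
  have hf := hfal t hp
  have hrs : rd t s = false := by unfold rd; rw [hf s (Or.inl rfl)]
  have hrv : rd t vv = false := by unfold rd; rw [hf vv (Or.inr (Or.inl rfl))]
  have e1 : base .E1 (rd t) = some (.E2, rd t, dir false false false) := by
    simp [base, hrs, hrv]
  have h1 := hp.at'.go e1
  simp only [Bool.false_eq_true, if_false] at h1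
  refine Rch.step hp.at'.st (Rch.done ⟨⟨_, h1⟩, fun tr htr => ?_⟩)
  obtain ⟨-, -, e3, e4⟩ := step_base (hp.at'.st.symm ▸ e1)
  have : tp tr (t + 1) = Function.update (tp tr t) (hd (grp tr) t) (rd t tr) := by
    by_cases e : tr = vv
    · subst e; rw [e4, hp.at'.st]; simp [code]; rfl
    · exact e3 tr e
  rw [this]
  exact (Function.update_eq_self _ _).trans (hf tr htr)

/-! increment -/

theorem digits_inc {n c : ℕ} (h : 16 ^ c ∣ n + 1) :
    (digits n c = 15 → digits (n + 1) c = 0 ∧ 16 ^ (c + 1) ∣ n + 1) ∧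
    (digits n c ≠ 15 → digits (n + 1) c = digits n c + 1 ∧ ∀ k, c < k → digits (n + 1) k = digits n k) := by
  obtain ⟨m, hm⟩ := h
  have hp : 0 < 16 ^ c := by positivity
  obtain ⟨m, rfl⟩ : ∃ m', m = m' + 1 := ⟨m - 1, by rcases m with _ | m; · simp at hm
                                                   · rfl⟩
  have hn : n / 16 ^ c = m := by
    have : n = 16 ^ c * m + (16 ^ c - 1) := by rw [mul_add, mul_one] at hm; omega
    rw [this, Nat.mul_add_div hp, Nat.div_eq_of_lt (by omega), add_zero]
  have hn1 : (n + 1) / 16 ^ c = m + 1 := by rw [hm, Nat.mul_div_cancel_left _ hp]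
  constructor
  · intro h15
    unfold digits at h15 ⊢
    rw [hn] at h15; rw [hn1]
    refine ⟨by omega, ?_⟩
    rw [hm, pow_succ]
    exact Nat.mul_dvd_mul_left _ (by omega)
  · intro h15
    unfold digits at h15 ⊢
    rw [hn] at h15
    refine ⟨by rw [hn, hn1]; omega, fun k hk => ?_⟩
    obtain ⟨j, rfl⟩ : ∃ j, k = c + (j + 1) := ⟨k - c - 1, by omega⟩
    rw [pow_add, ← Nat.div_div_eq_div_mul, ← Nat.div_div_eq_div_mul, hn, hn1, pow_succ', ← Nat.div_div_eq_div_mul,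
      ← Nat.div_div_eq_div_mul, show (m + 1) / 16 = m / 16 by omega]

theorem sym_wsym (v : ℕ) (h : v < 16) (r : Tr → Bool) : sym (wsym v r) = v := by
  interval_cases v <;> rfl

theorem sym_zero {r : Tr → Bool} (h : sym r = 0) (i : Fin 4) : r (b i) = false := by
  unfold sym at h
  have h0 : (r (b 0)).toNat = 0 := by omega
  have h1 : (r (b 1)).toNat = 0 := by omega
  have h2 : (r (b 2)).toNat = 0 := by omega
  have h3 : (r (b 3)).toNat = 0 := by omega
  have : ∀ x : Bool, x.toNat = 0 → x = false := by decide
  fin_cases i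
  exacts [this _ h0, this _ h1, this _ h2, this _ h3]

/-- the text at time `t` -/
def txt (t : Ordinal.{0}) : ℕ → ℕ := SF (fun tr => tp tr t)

theorem txt_write {t : Ordinal.{0}} {x v : ℕ} {s' mv} (hv : v < 16) (hx : hd .X t = x)
    (hb : base (st t) (rd t) = some (s', wsym v (rd t), mv)) (k : ℕ) :
    txt (t + 1) k = if k = x then v else txt t k := by
  have e3 := (step_base hb).2.2.1
  have : ∀ i, tp (b i) (t + 1) k = if k = x then wsym v (rd t) (b i) else tp (b i) t k := by
    intro i
    rw [e3 _ (by simp)]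
    show Function.update _ (hd .X t) _ _ = _
    rw [hx, Function.update_apply]
    simp only [Nat.cast_inj]
  unfold txt SF sym
  simp only [this]
  split_ifs with e
  · exact sym_wsym v hv _
  · rfl

theorem e3_scan {t : Ordinal.{0}} {n c : ℕ} (ht : 1 ≤ t) (h : At t .E3 0 0 c) (hd' : 16 ^ c ∣ n + 1)
    (hlo : ∀ k < c, txt t k = digits (n + 1) k) (hhi : ∀ k, c ≤ k → txt t k = digits n k) :
    Rch' (fun ρ => st ρ = .E3) (fun t' => 1 ≤ t' ∧ (∃ x, At t' .E4 0 0 x) ∧ txt t' = digits (n + 1)) t := by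
  have hcn : c < n + 1 := (Nat.lt_pow_self (by norm_num)).trans_le (Nat.le_of_dvd (by omega) hd')
  induction hN : n + 1 - c using Nat.strong_induction_on generalizing t c with
  | _ N ih =>
    have hc := Cf.self ht h
    have hsym : sym (rd t) = digits n c := by rw [hc.rsym, ← hhi c le_rfl]; rfl
    by_cases h15 : digits n c = 15
    · obtain ⟨a1, a2⟩ := (digits_inc hd').1 h15
      have e1 : base .E3 (rd t) = some (.E3, wsym 0 (rd t), dir false false true) := by
        simp [base, hsym, h15]
      have h1 := h.go e1
      simp only [Bool.false_eq_true, if_false, if_true, leftOf_zero] at h1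
      have hw := txt_write (v := 0) (by norm_num) h.X (h.st.symm ▸ e1)
      refine Rch.step h.st (Rch'.le (ih (n + 1 - (c + 1)) (by omega) (ht.trans le_self_add) h1 a2 ?_ ?_
        ((Nat.lt_pow_self (by norm_num)).trans_le (Nat.le_of_dvd (by omega) a2)) rfl))
      · intro k hk
        rw [hw]
        split_ifs with e
        · rw [e, a1]
        · exact hlo k (by omega)
      · intro k hk
        rw [hw, if_neg (by omega)]
        exact hhi k (by omega)
    · obtain ⟨a1, a2⟩ := (digits_inc hd').2 h15
      have e1 : base .E3 (rd t) = some (.E4, wsym (digits n c + 1) (rd t), dir false false false) := by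
        simp [base, hsym, h15]
      have h1 := h.go e1
      simp only [Bool.false_eq_true, if_false, leftOf_zero] at h1
      have hw := txt_write (v := digits n c + 1) (by have := digits_lt n c; omega) h.X (h.st.symm ▸ e1)
      refine Rch.step h.st (Rch.done ⟨ht.trans le_self_add, ⟨_, h1⟩, ?_⟩)
      funext k
      rw [hw]
      split_ifs with e
      · rw [e, a1]
      · rcases lt_or_ge k c with f | f
        · exact hlo k f
        · rw [hhi k f, a2 k (by omega)]

theorem txt_congr {t t' : Ordinal.{0}} (h : ∀ i, tp (b i) t' = tp (b i) t) : txt t' = txt t := SF_congr h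

end GapU

namespace GapU
open Order Tr

/-! ### One iteration -/

/-- from `E0` to the next iteration -/
theorem e_phase {t r σ : Ordinal.{0}} {x n : ℕ} (ht : 1 ≤ t) (h : At t .E0 r 0 x) (hv : VInv t)
    (hs : ∀ x, tp s t x = true ↔ x < σ) (hx : txt t = digits n) :
    ∃ t', t < t' ∧ At t' .N0 0 0 0 ∧ txt t' = digits (n + 1) ∧ (∀ tr, clean tr → tp tr t' = fun _ => false) ∧
      tp d t' 0 = true ∧ (∀ tr, tr = a ∨ tr = q ∨ tr = g → tp tr t' = tp tr t) ∧
      ∀ ρ, t ≤ ρ → ρ < t' → 3 ≤ code (st ρ) ∧ code (st ρ) < 8 := by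
  -- E0
  obtain ⟨t1, a1, a2, r1, y1, x1, -, a4, -, a6, a7, a8⟩ := homeLLL (F := fun tr => tp tr t) (σ := .E0)
    (c := fun r _ x => r = 0 ∧ x = 0)
    (fun t r y x h hc => by
      have : (rd t zr && rd t zx) = false := by rw [h.rzr, h.rzx]; simpa using hc
      simp [base, this]) ⟨rfl, rfl⟩ (Cf.self ht h)
  obtain rfl : y1 = 0 := le_antisymm a4 zero_le
  subst a7 a8
  have e1 : base .E0 (rd t1) = some (.E1, rd t1, dir false false false) := by
    simp [base, a6.rzr, a6.rzx]
  have h1 := a6.toAt.go e1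
  simp only [Bool.false_eq_true, if_false, leftOf_zero, Nat.zero_sub] at h1
  have st0 : ∀ ρ, t ≤ ρ → ρ < t1 + 1 → st ρ = .E0 := by
    intro ρ c1 c2
    rcases (Order.lt_add_one_iff.1 c2).lt_or_eq with e | rfl
    · obtain ⟨_, _, _, d⟩ := a2 ρ c1 e; exact d.st
    · exact a6.st
  have k0 : ∀ tr, ¬ writes tr .E0 → tp tr (t1 + 1) = tp tr t := fun tr hw =>
    keep (a1.trans le_self_add) fun ρ c1 c2 => by rw [st0 ρ c1 c2]; exact hw
  have hvv : tp vv (t1 + 1) = tp vv t := k0 _ (by simp [writes, code])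
  have htt : tp tt (t1 + 1) = tp tt t := k0 _ (by simp [writes])
  have hmm : tp mm (t1 + 1) = tp mm t := k0 _ (by simp [writes])
  have hss : tp s (t1 + 1) = tp s t := k0 _ (by simp [writes])
  -- E1
  obtain ⟨V, hV⟩ : ∃ V, ∀ x, tp vv t x = true ↔ x < V := by
    have hne : {x | ¬ tp vv t x = true}.Nonempty := ⟨t, fun h => lt_irrefl _ (tp_lt _ _ _ h)⟩
    refine ⟨sInf {x | ¬ tp vv t x = true}, fun x => ⟨fun hx => ?_, fun hx => ?_⟩⟩
    · by_contra hc
      rcases (not_lt.1 hc).lt_or_eq with e | e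
      · exact csInf_mem hne (hv.down _ _ e hx)
      · exact csInf_mem hne (e ▸ hx)
    · exact not_not.1 (notMem_of_lt_csInf' (s := {x | ¬ tp vv t x = true}) hx)
  obtain ⟨t2, b1, b2, ⟨r2, b3⟩, b4⟩ := e1_scan (σ := σ) (V := V) (ht.trans (a1.trans le_self_add)) h1
    (by rw [hss]; exact hs) (by rw [hvv]; exact hV) (by rw [hvv, htt]; exact hv.tt) (by rw [hvv, hmm]; exact hv.mm)
  have hle2 : t ≤ t2 := a1.trans (le_self_add.trans b1.le)
  have k1 : ∀ tr, ¬ writes tr .E1 → tp tr t2 = tp tr (t1 + 1) := fun tr hw =>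
    keep b1.le fun ρ c1 c2 => by rw [b2 ρ c1 c2]; exact hw
  -- E2
  obtain ⟨t3, c1, c2, r3, y3, x3, -, -, c3, c4, c5, c6⟩ := homeLLL (F := fun tr => tp tr t2) (σ := .E2)
    (c := fun r y _ => r = 0 ∧ y = 0)
    (fun t r y x h hc => by
      have : (rd t zr && rd t zy) = false := by rw [h.rzr, h.rzy]; simpa using hc
      simp [base, this]) ⟨rfl, rfl⟩ (Cf.self (ht.trans hle2) b3)
  obtain rfl : x3 = 0 := by omega
  subst c5 c6
  have e3 : base .E2 (rd t3) = some (.E3, rd t3, dir false false false) := by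
    simp [base, c4.rzr, c4.rzy]
  have h3 := c4.toAt.go e3
  simp only [Bool.false_eq_true, if_false, leftOf_zero, Nat.zero_sub] at h3
  have st2 : ∀ ρ, t2 ≤ ρ → ρ < t3 + 1 → st ρ = .E2 := by
    intro ρ c1 c2'
    rcases (Order.lt_add_one_iff.1 c2').lt_or_eq with e | rfl
    · obtain ⟨_, _, _, d⟩ := c2 ρ c1 e; exact d.st
    · exact c4.st
  have hle3 : t ≤ t3 + 1 := hle2.trans (c1.trans le_self_add)
  have k2 : ∀ tr, ¬ writes tr .E2 → tp tr (t3 + 1) = tp tr t2 := fun tr hw =>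
    keep (c1.trans le_self_add) fun ρ c1 c2 => by rw [st2 ρ c1 c2]; exact hw
  have hx3 : txt (t3 + 1) = digits n := by
    rw [← hx]
    refine txt_congr fun i => ?_
    rw [k2 _ (by simp [writes]), k1 _ (by simp [writes]), k0 _ (by simp [writes])]
  -- E3
  obtain ⟨t4, d1, d2, d3, ⟨x4, d4⟩, d5⟩ := e3_scan (n := n) (c := 0) (ht.trans hle3) h3 (by simp)
    (fun k hk => by omega) (fun k _ => by rw [hx3])
  have k3 : ∀ tr, ¬ writes tr .E3 → tp tr t4 = tp tr (t3 + 1) := fun tr hw =>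
    keep d1.le fun ρ c1 c2 => by rw [d2 ρ c1 c2]; exact hw
  -- E4
  obtain ⟨t5, f1, f2, r5, y5, x5, f3, f4, -, f5, f6⟩ := homeLLL (F := fun tr => tp tr t4) (σ := .E4)
    (c := fun _ _ x => x = 0)
    (fun t r y x h hc => by
      have : rd t zx = false := by rw [h.rzx]; simpa using hc
      simp [base, this]) rfl (Cf.self d3 d4)
  obtain rfl : r5 = 0 := le_antisymm f3 zero_le
  obtain rfl : y5 = 0 := le_antisymm f4 zero_le
  subst f6
  have e5 : base .E4 (rd t5) = some (.N0, upd (rd t5) d true, dir false false false) := by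
    simp [base, f5.rzx]
  have h5 := f5.toAt.go e5
  simp only [Bool.false_eq_true, if_false, leftOf_zero, Nat.zero_sub] at h5
  have st4 : ∀ ρ, t4 ≤ ρ → ρ < t5 + 1 → st ρ = .E4 := by
    intro ρ c1 c2'
    rcases (Order.lt_add_one_iff.1 c2').lt_or_eq with e | rfl
    · obtain ⟨_, _, _, d⟩ := f2 ρ c1 e; exact d.st
    · exact f5.st
  have k4 : ∀ tr, ¬ writes tr .E4 → tp tr (t5 + 1) = tp tr t4 := fun tr hw =>
    keep (f1.trans le_self_add) fun ρ c1 c2 => by rw [st4 ρ c1 c2]; exact hw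
  refine ⟨t5 + 1, hle3.trans_lt (d1.trans_le (f1.trans le_self_add)), h5, ?_, ?_, ?_, ?_, ?_⟩
  · rw [← d5]; exact txt_congr fun i => k4 _ (by simp [writes])
  · rintro tr htr
    rw [← b4 tr htr]
    have : ¬ writes tr .E2 ∧ ¬ writes tr .E3 ∧ ¬ writes tr .E4 := by
      rcases htr with rfl | rfl | rfl | rfl <;> simp [writes, code]
    rw [k4 _ this.2.2, k3 _ this.2.1, k2 _ this.1]
  · rw [(step_base (f5.st.symm ▸ e5)).2.2.1 _ (by simp)]
    show Function.update _ (hd .K t5) _ _ = _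
    rw [hK]; simp [upd]
  · intro tr htr
    have : ¬ writes tr .E0 ∧ ¬ writes tr .E1 ∧ ¬ writes tr .E2 ∧ ¬ writes tr .E3 ∧ ¬ writes tr .E4 := by
      rcases htr with rfl | rfl | rfl <;> simp [writes]
    rw [k4 _ this.2.2.2.2, k3 _ this.2.2.2.1, k2 _ this.2.2.1, k1 _ this.2.1, k0 _ this.1]
  · intro ρ i1 i2
    rcases lt_or_ge ρ (t1 + 1) with j1 | j1
    · rw [st0 ρ i1 j1]; simp [code]
    rcases lt_or_ge ρ t2 with j2 | j2
    · rw [b2 ρ j1 j2]; simp [code]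
    rcases lt_or_ge ρ (t3 + 1) with j3 | j3
    · rw [st2 ρ j2 j3]; simp [code]
    rcases lt_or_ge ρ t4 with j4 | j4
    · rw [d2 ρ j3 j4]; simp [code]
    · rw [st4 ρ j4 i2]; simp [code]

structure Start (n : ℕ) (α t : Ordinal.{0}) : Prop where
  pos : 1 ≤ t
  at' : At t .N0 0 0 0
  cl : ∀ tr, clean tr ∨ tr = q → tp tr t = fun _ => false
  txt : txt t = digits n
  a : ∀ x, tp a t x = true ↔ x < α

theorem iterate {n : ℕ} {α t : Ordinal.{0}} (h : Start n α t) (hnh : ¬ (tp d t 0 = false ∧ tp g t 0 = true)) :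
    ∃ t' α', t < t' ∧ Start (n + 1) α' t' ∧ tp d t' 0 = true ∧ t + 1 < t' ∧ tp d (t + 1) 0 = false ∧
      ((α' = α + 1 ∧ tp g t' 0 = false ∧ firstEvent (scr n) α) ∨
        (α' = α ∧ tp g t' 0 = (tp g t 0 || !tp d t 0) ∧ ¬ firstEvent (scr n) α)) ∧
      ∀ ρ, t < ρ → ρ < t' → st ρ ≠ .N0 := by
  have hrd : rd t d = tp d t 0 := by rw [← hK t]; rfl
  have hrg : rd t g = tp g t 0 := by rw [← hK t]; rfl
  have e1 : base .N0 (rd t) = some (.F (.nrm false), upd (upd (rd t) g (rd t g || !rd t d)) d false,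
      dir false false false) := by
    have : (!rd t d && rd t g) = false := by
      rw [hrd, hrg]; revert hnh; cases tp d t 0 <;> cases tp g t 0 <;> simp
    simp [base, this]
  have h1 := h.at'.go e1
  simp only [Bool.false_eq_true, if_false, leftOf_zero, Nat.zero_sub] at h1
  have ht1 : 1 ≤ t + 1 := h.pos.trans le_self_add
  have hk : ∀ tr, ¬ writes tr .N0 → tp tr (t + 1) = tp tr t := fun tr hw => step_keep t (by rw [h.at'.st]; exact hw)
  have e3 := (step_base (h.at'.st.symm ▸ e1)).2.2.1
  have hd1 : tp d (t + 1) 0 = false := by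
    rw [e3 _ (by simp)]
    show Function.update _ (hd .K t) _ _ = _
    rw [hK]; simp [upd]
  have hg1 : tp g (t + 1) 0 = (tp g t 0 || !tp d t 0) := by
    rw [e3 _ (by simp)]
    show Function.update _ (hd .K t) _ _ = _
    rw [hK, ← hrd, ← hrg]; simp [upd]
  have hcl : ∀ tr, clean tr ∨ tr = q → tp tr (t + 1) = fun _ => false := by
    intro tr htr
    rw [hk tr, h.cl tr htr]
    rcases htr with (rfl | rfl | rfl | rfl) | rfl <;> simp [writes, code]
  have ha1 : ∀ x, tp a (t + 1) x = true ↔ x < α := by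
    rw [hk a (by simp [writes])]; exact h.a
  have hx1 : GapU.txt (t + 1) = digits n := by
    rw [← h.txt]; exact txt_congr fun i => hk _ (by simp [writes])
  set B : Tr → Ordinal.{0} → Bool := fun tr => tp tr (t + 1) with hB
  have hT : Tick (scr n) B 0 (t + 1) := by
    refine ⟨B, Cf.self ht1 h1, ⟨fun i j => ?_, fun i j => ?_⟩, hcl q (Or.inr rfl), fun x => ?_, fun tr _ _ _ _ _ _ => rfl⟩
    · rw [absRun_zero, hB]; simp only; rw [hcl tt (Or.inl (by simp [clean]))]; rfl
    · rw [absRun_zero, hB]; simp only; rw [hcl mm (Or.inl (by simp [clean]))]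
      simp [Mem.zero]
    · rw [hB]; simp only; rw [hcl s (Or.inl (by simp [clean]))]
      simp
  obtain ⟨t2, F, σ, r, x, a1, a2, a3, a4⟩ := ticks (B := B) (L := scr n) (α := α)
    (by rw [show SF B = digits n from hx1]; exact scr_parses n) hT ha1
  have hv1 : VInv (t + 1) := by
    refine ⟨fun x hx => ?_, fun x y _ hy => ?_, fun x hx => ?_, fun x hx => ?_⟩
    · rw [h1.Y] at hx; exact absurd hx not_lt_zero
    · rw [hcl vv (Or.inl (by simp [clean]))] at hy; simp at hy
    · rw [hcl tt (Or.inl (by simp [clean]))] at hx; simp at hx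
    · rw [hcl mm (Or.inl (by simp [clean]))] at hx; simp at hx
  have hv2 : VInv t2 := VInv.run a1.le hv1 a4
  have hFe : ∀ tr, tr ≠ bb → tr ≠ vv → tp tr t2 = F tr := a2.fr.eq
  have hx2 : GapU.txt t2 = digits n := by
    rw [← hx1]
    refine txt_congr fun i => ?_
    rw [hFe _ (by simp) (by simp), a3.rest _ (by simp) (by simp) (by simp) (by simp) (by simp) (by simp) (by simp) (by simp)]
  obtain ⟨t3, b1, b2, b3, b4, b5, b6, b7⟩ := e_phase (σ := σ) a2.fr.pos a2.toAt hv2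
    (by rw [hFe _ (by simp) (by simp)]; exact a3.s) hx2
  have hst : ∀ ρ, t < ρ → ρ < t3 → st ρ ≠ .N0 := by
    intro ρ c1 c2 hh
    have : 3 ≤ code (st ρ) := by
      rcases lt_or_ge ρ t2 with e | e
      · have := a4 ρ (Order.add_one_le_of_lt c1) e; omega
      · exact (b7 ρ e c2).1
    rw [hh] at this; simp [code] at this
  have hq3 : tp q t3 = fun _ => false := by
    rw [b6 _ (by simp), hFe _ (by simp) (by simp)]; exact a3.q
  have ha3 : tp a t3 = F a := by rw [b6 _ (by simp), hFe _ (by simp) (by simp)]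
  have hg3 : tp g t3 = F g := by rw [b6 _ (by simp), hFe _ (by simp) (by simp)]
  have hst3 : ∀ α', (∀ x, F a x = true ↔ x < α') → Start (n + 1) α' t3 := fun α' hα =>
    ⟨ht1.trans (a1.trans b1).le, b2, fun tr htr => htr.elim (b4 tr) fun e => e ▸ hq3, b3, by rw [ha3]; exact hα⟩
  have hlt : t + 1 < t3 := a1.trans b1
  rcases a3.out with ⟨c1, c2, c3⟩ | ⟨c1, c2, c3⟩
  · exact ⟨t3, α + 1, (lt_add_one t).trans hlt, hst3 _ c1, b5, hlt, hd1, Or.inl ⟨rfl, by rw [hg3, c2], c3⟩, hst⟩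
  · refine ⟨t3, α, (lt_add_one t).trans hlt, hst3 _ ?_, b5, hlt, hd1, Or.inr ⟨rfl, ?_, c3⟩, hst⟩
    · rw [c1]; exact ha1
    · rw [hg3, c2]; exact hg1

end GapU

namespace GapU
open Order Tr

/-! ### Global facts -/

theorem base_a {σ : St} {r : Tr → Bool} {s' w mv} (h : base σ r = some (s', w, mv)) :
    (r a = true → w a = true) ∧ (σ ≠ .N0 → w g = true → r g = true) ∧ (w g = true → w a = r a) := by
  unfold base at h
  split at h <;> (try split at h) <;> (try split at h) <;> (try split at h) <;> (try split at h) <;>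
    simp only [Option.some.injEq, Prod.mk.injEq, reduceCtorEq] at h <;>
    first
    | (obtain ⟨-, rfl, -⟩ := h; simp [wsym, upd, Function.update_apply]; done)
    | exact absurd h id

theorem step_upd (t : Ordinal.{0}) : (∃ s' w mv, base (st t) (rd t) = some (s', w, mv) ∧
      ∀ tr, tr ≠ vv → tp tr (t + 1) = Function.update (tp tr t) (hd (grp tr) t) (w tr)) ∨
      (∀ tr, tp tr (t + 1) = tp tr t) := by
  cases hb : base (st t) (rd t) with
  | none =>
    right; intro tr
    have : trans (st t) (rd t) = none := by simp [trans, hb]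
    unfold tp; rw [step_none this]
  | some r =>
    obtain ⟨s', w, mv⟩ := r
    exact Or.inl ⟨s', w, mv, rfl, (step_base hb).2.2.1⟩

theorem a_mono {u v x : Ordinal.{0}} (huv : u ≤ v) (h : tp a u x = true) : tp a v x = true := by
  induction v using Ordinal.limitRecOn with
  | zero => rwa [← le_antisymm huv zero_le]
  | add_one v ih =>
    rcases huv.lt_or_eq with e | rfl
    · have h1 := ih (Order.lt_add_one_iff.1 e)
      rcases step_upd v with ⟨s', w, mv, a1, a2⟩ | a1
      · rw [a2 _ (by simp), Function.update_apply]
        split_ifs with c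
        · exact (base_a a1).1 (by rw [c] at h1; exact h1)
        · exact h1
      · rw [a1]; exact h1
    · exact h
  | limit v hv ih =>
    rcases huv.lt_or_eq with e | rfl
    · exact tp_limit_const hv ⟨u, e, fun i c1 c2 => ih i c2 c1⟩
    · exact h

theorem g_back {u v : Ordinal.{0}} (huv : u ≤ v) (hst : ∀ ρ, u ≤ ρ → ρ < v → st ρ ≠ .N0)
    (h : tp g v 0 = true) : tp g u 0 = true := by
  induction v using Ordinal.limitRecOn with
  | zero => rwa [le_antisymm huv zero_le]
  | add_one v ih =>
    rcases huv.lt_or_eq with e | rfl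
    · have huv' := Order.lt_add_one_iff.1 e
      refine ih huv' (fun ρ c1 c2 => hst ρ c1 (c2.trans (lt_add_one v))) ?_
      rcases step_upd v with ⟨s', w, mv, a1, a2⟩ | a1
      · rw [a2 _ (by simp)] at h
        change Function.update _ (hd .K v) _ _ = _ at h
        rw [hK, Function.update_self] at h
        have := (base_a a1).2.1 (hst v huv' (lt_add_one v)) h
        rw [← hK v]; exact this
      · rwa [a1] at h
    · exact h
  | limit v hv ih =>
    rcases huv.lt_or_eq with e | rfl
    · rw [tp_limit hv] at h
      obtain ⟨ρ, c1, c2⟩ := h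
      exact ih (max u ρ) (max_lt e c1) (le_max_left _ _) (fun τ d1 d2 => hst τ d1 (d2.trans (max_lt e c1)))
        (c2 _ (le_max_right _ _) (max_lt e c1))
    · exact h

theorem a_const {u v : Ordinal.{0}} (huv : u ≤ v) (h : ∀ ρ, u ≤ ρ → ρ ≤ v → tp g ρ 0 = true) : tp a v = tp a u := by
  induction v using Ordinal.limitRecOn with
  | zero => rw [le_antisymm huv zero_le]
  | add_one v ih =>
    rcases huv.lt_or_eq with e | rfl
    · have huv' := Order.lt_add_one_iff.1 e
      rw [← ih huv' fun ρ c1 c2 => h ρ c1 (c2.trans le_self_add)]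
      rcases step_upd v with ⟨s', w, mv, a1, a2⟩ | a1
      · have hg := h (v + 1) huv le_rfl
        rw [a2 _ (by simp)] at hg
        change Function.update _ (hd .K v) _ _ = _ at hg
        rw [hK, Function.update_self] at hg
        rw [a2 _ (by simp), (base_a a1).2.2 hg]
        exact Function.update_eq_self _ _
      · rw [a1]
    · rfl
  | limit v hv ih =>
    rcases huv.lt_or_eq with e | rfl
    · funext x
      refine tp_limit_const hv ⟨u, e, fun i c1 c2 => ?_⟩
      rw [ih i c2 c1 fun ρ d1 d2 => h ρ d1 (d2.trans c2.le)]
    · rfl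

theorem H_abs {u v : Ordinal.{0}} (huv : u ≤ v) (h : st u = .H) : st v = .H := by
  induction v using Ordinal.limitRecOn with
  | zero => rwa [← le_antisymm huv zero_le]
  | add_one v ih =>
    rcases huv.lt_or_eq with e | rfl
    · have h1 := ih (Order.lt_add_one_iff.1 e)
      have : trans (st v) (rd v) = none := trans_none.2 h1
      rw [← h1]; unfold st; rw [step_none this]
    · exact h
  | limit v hv ih =>
    rcases huv.lt_or_eq with e | rfl
    · exact st_limit_const hv ⟨u, e, fun i c1 c2 => ih i c2 c1⟩
    · exact h

/-! ### The main loop -/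

structure ItP (π : Ordinal.{0}) (n : ℕ) (α t : Ordinal.{0}) : Prop where
  start : Start n α t
  ev : ∀ α' < α, ∃ m, firstEvent (scr m) α'
  dd : tp d t 0 = decide (0 < n)
  pi : π ≤ α
  z : n = 0 → tp g t 0 = false
  g0 : 0 < n → tp g t 0 = false → π + 1 ≤ α
  g1 : 0 < n → tp g t 0 = true → ∀ m < n, ¬ firstEvent (scr m) α

def It (ν t : Ordinal.{0}) : Prop := ∃ π n α, ν = ω * π + (n : ℕ) ∧ ItP π n α t

theorem div_wn (π : Ordinal.{0}) (n : ℕ) : (ω * π + n) / ω = π := by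
  rw [Ordinal.mul_add_div _ omega0_ne_zero, Ordinal.div_eq_zero_of_lt (nat_lt_omega0 n), add_zero]

theorem wn_inj {π π' : Ordinal.{0}} {n n' : ℕ} (h : ω * π + (n : Ordinal.{0}) = ω * π' + n') : π = π' ∧ n = n' := by
  have h1 : π = π' := by rw [← div_wn π n, h, div_wn]
  subst h1
  exact ⟨rfl, by simpa using h⟩

theorem It.get {π : Ordinal.{0}} {n : ℕ} {t} (h : It (ω * π + n) t) : ∃ α, ItP π n α t := by
  obtain ⟨π', n', α, h1, h2⟩ := h
  obtain ⟨rfl, rfl⟩ := wn_inj h1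
  exact ⟨α, h2⟩

structure ItT (j u u' : Ordinal.{0}) : Prop where
  p0 : It j u
  p1 : It (j + 1) u'
  no : ∀ ρ, u < ρ → ρ < u' → st ρ ≠ .N0
  lt : u + 1 < u'
  d0 : tp d (u + 1) 0 = false

/-- a halting situation -/
def Good (t α : Ordinal.{0}) : Prop :=
  Start 0 α t ∧ tp d t 0 = false ∧ tp g t 0 = true ∧ ∀ m, ¬ firstEvent (scr m) α

theorem it_step {ν t : Ordinal.{0}} (h : It ν t) : ∃ t', t < t' ∧ It (ν + 1) t' ∧ ItT ν t t' := by
  obtain ⟨π, n, α, h1, h2⟩ := id h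
  have hnh : ¬ (tp d t 0 = false ∧ tp g t 0 = true) := by
    rintro ⟨c1, c2⟩
    rw [h2.dd, decide_eq_false_iff_not] at c1
    rw [h2.z (by omega)] at c2; simp at c2
  obtain ⟨t', α', a1, a2, a3, a4, a5, a6, a7⟩ := iterate h2.start hnh
  have hit : It (ν + 1) t' := by
    refine ⟨π, n + 1, α', by rw [h1]; push_cast; rw [add_assoc], ?_⟩
    rcases a6 with ⟨rfl, c2, c3⟩ | ⟨rfl, c2, c3⟩
    · refine ⟨a2, fun β hβ => ?_, by simp [a3], h2.pi.trans le_self_add, fun h => by omega, fun _ _ => ?_, fun _ c => ?_⟩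
      · rcases (Order.lt_add_one_iff.1 hβ).lt_or_eq with e | rfl
        · exact h2.ev β e
        · exact ⟨n, c3⟩
      · gcongr; exact h2.pi
      · rw [c2] at c; simp at c
    · refine ⟨a2, h2.ev, by simp [a3], h2.pi, fun h => by omega, fun _ c => ?_, fun _ c m hm => ?_⟩
      · rw [c2, Bool.or_eq_false_iff] at c
        refine h2.g0 ?_ c.1
        have := h2.dd
        rw [show tp d t 0 = true by simpa using c.2] at this
        simpa using this.symm
      · rcases (Nat.lt_succ_iff.1 hm).lt_or_eq with e | rfl
        · have hn : 0 < n := by omega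
          have hdd : tp d t 0 = true := by rw [h2.dd]; simp [hn]
          rw [c2, hdd] at c
          exact h2.g1 hn (by simpa using c) m e
        · exact c3
  exact ⟨t', a1, hit, h, hit, a7, a4, a5⟩

theorem it_limit (hno : ∀ t α, ¬ Good t α) {lam T : Ordinal.{0}} (hlam : IsSuccLimit lam)
    (hl : Lim It ItT 0 lam T) : It lam T := by
  have hT := hl.lim
  obtain ⟨hlam0, π', hπ⟩ := Ordinal.isSuccLimit_iff_omega0_dvd.1 hlam
  have cof : ∀ ρ < T, ∃ (π : Ordinal.{0}) (n0 : ℕ), ω * π + n0 < lam ∧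
      ∀ n : ℕ, n0 ≤ n → ∃ s α, ρ ≤ s ∧ s + 1 < T ∧ ItP π n α s ∧ tp d (s + 1) 0 = false := by
    intro ρ hρ
    obtain ⟨i, -, c1, c2⟩ := hl.cof ρ hρ
    obtain ⟨s, s', -, -, -, ⟨π, n0, -, d2, -⟩, -⟩ := c2 i le_rfl c1
    subst d2
    refine ⟨π, n0, c1, fun n hn => ?_⟩
    have hlt : ω * π + (n : Ordinal.{0}) < lam := by
      rw [hπ]
      have : ω * π < ω * π' := by rw [← hπ]; exact le_self_add.trans_lt c1
      have hpp : π < π' := lt_of_mul_lt_mul_left' this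
      calc ω * π + (n : Ordinal.{0}) < ω * π + ω := by gcongr; exact nat_lt_omega0 n
        _ = ω * (π + 1) := by rw [mul_add, mul_one]
        _ ≤ ω * π' := by gcongr; exact Order.add_one_le_of_lt hpp
    obtain ⟨s, s', e1, e2, e3, e4, -, e5⟩ := c2 (ω * π + n) (by gcongr) hlt
    obtain ⟨α, e6⟩ := e4.get
    exact ⟨s, α, e1, e5.lt.trans e3, e6, e5.d0⟩
  have cof' : ∀ ρ < T, ∃ s α π n, ρ ≤ s ∧ s < T ∧ ItP π n α s ∧ s + 1 < T ∧ tp d (s + 1) 0 = false := by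
    intro ρ hρ
    obtain ⟨π, n0, -, h⟩ := cof ρ hρ
    obtain ⟨s, α, c1, c2, c3, c4⟩ := h n0 le_rfl
    exact ⟨s, α, π, n0, c1, (lt_add_one s).trans c2, c3, c2, c4⟩
  have hT0 : 0 < T := hT.bot_lt
  obtain ⟨s0, α0, π0, n0, -, hs0T, hs0, -⟩ := cof' 0 hT0
  have hT1 : 1 ≤ T := hs0.start.pos.trans hs0T.le
  have hat : At T .N0 0 0 0 := by
    refine ⟨?_, ?_, ?_, ?_⟩
    · refine st_limit hT ⟨s0, hs0T, fun ρ c1 c2 => ?_⟩ fun ρ hρ => ?_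
      · have := st_ne_start0 (hs0.start.pos.trans c1)
        have h2 : code (st ρ) ≠ 0 := fun h => this (code_inj (h.trans rfl))
        show 1 ≤ code (st ρ)
        omega
      · obtain ⟨s, α, π, n, c1, c2, c3, -⟩ := cof' ρ hρ
        exact ⟨s, c1, c2, c3.start.at'.st⟩
    · refine hd_limit_eq hT (fun x hx => absurd hx not_lt_zero) fun ρ hρ => ?_
      obtain ⟨s, α, π, n, c1, c2, c3, -⟩ := cof' ρ hρ
      exact ⟨s, c1, c2, c3.start.at'.R.le⟩
    · refine hd_limit_eq hT (fun x hx => absurd hx not_lt_zero) fun ρ hρ => ?_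
      obtain ⟨s, α, π, n, c1, c2, c3, -⟩ := cof' ρ hρ
      exact ⟨s, c1, c2, c3.start.at'.Y.le⟩
    · refine hd_limit_eq hT (fun x hx => ?_) fun ρ hρ => ?_
      · simp at hx
      obtain ⟨s, α, π, n, c1, c2, c3, -⟩ := cof' ρ hρ
      exact ⟨s, c1, c2, c3.start.at'.X.le⟩
  have hcl : ∀ tr, clean tr ∨ tr = q → tp tr T = fun _ => false := by
    intro tr htr
    funext x
    refine tp_limit_false hT fun ρ hρ => ?_
    obtain ⟨s, α, π, n, c1, c2, c3, -⟩ := cof' ρ hρ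
    exact ⟨s, c1, c2, by rw [c3.start.cl tr htr]⟩
  have htx : txt T = digits 0 := by
    have hb : ∀ i (k : ℕ), tp (b i) T k = false := by
      intro i k
      refine tp_limit_false hT fun ρ hρ => ?_
      obtain ⟨π, n0, -, h⟩ := cof ρ hρ
      obtain ⟨s, α, c1, c2, c3, -⟩ := h (16 ^ (k + 1) * n0) (Nat.le_mul_of_pos_left _ (by positivity))
      refine ⟨s, c1, (lt_add_one s).trans c2, ?_⟩
      have h1 : txt s k = 0 := by
        rw [c3.start.txt, digits, pow_succ, mul_assoc, Nat.mul_div_cancel_left _ (by positivity)]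
        omega
      exact sym_zero (r := fun tr => tp tr s (k : Ordinal.{0})) h1 i
    funext k
    rw [digits_zero 0 (Nat.zero_le k)]
    simp [txt, SF, sym, hb]
  have hmono : ∀ s α π n, s < T → ItP π n α s → ∀ x < α, tp a T x = true := fun s α π n c1 c2 x hx =>
    a_mono c1.le ((c2.start.a x).2 hx)
  obtain ⟨α, hα⟩ : ∃ α, ∀ x, tp a T x = true ↔ x < α := by
    have hne : {x | ¬ tp a T x = true}.Nonempty := ⟨T, fun h => lt_irrefl _ (tp_lt _ _ _ h)⟩
    refine ⟨sInf {x | ¬ tp a T x = true}, fun x => ⟨fun hx => ?_, fun hx => ?_⟩⟩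
    · by_contra hc
      have hx' := hx
      rw [tp_limit hT] at hx'
      obtain ⟨ρ, c1, c2⟩ := hx'
      obtain ⟨s, α, π, n, d1, d2, d3, -⟩ := cof' ρ c1
      have := (d3.start.a x).1 (c2 s d1 d2)
      exact csInf_mem hne (hmono s α π n d2 d3 _ ((not_lt.1 hc).trans_lt this))
    · exact not_not.1 (notMem_of_lt_csInf' (s := {x | ¬ tp a T x = true}) hx)
  have hle : ∀ s α' π n, s < T → ItP π n α' s → α' ≤ α := fun s α' π n c1 c2 =>
    le_of_forall_lt fun x hx => (hα x).1 (hmono s α' π n c1 c2 x hx)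
  have hev : ∀ α' < α, ∃ m, firstEvent (scr m) α' := by
    intro α' h'
    have hx' := (hα α').2 h'
    rw [tp_limit hT] at hx'
    obtain ⟨ρ, c1, c2⟩ := hx'
    obtain ⟨s, α1, π, n, d1, d2, d3, -⟩ := cof' ρ c1
    exact d3.ev α' ((d3.start.a α').1 (c2 s d1 d2))
  have hdT : tp d T 0 = false := by
    refine tp_limit_false hT fun ρ hρ => ?_
    obtain ⟨s, α, π, n, c1, c2, c3, c4, c5⟩ := cof' ρ hρ
    exact ⟨s + 1, c1.trans le_self_add, c4, c5⟩
  have hst : Start 0 α T := ⟨hT1, hat, hcl, htx, hα⟩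
  have hg : tp g T 0 = false := by
    rw [← Bool.not_eq_true]
    intro hg
    refine hno T α ⟨hst, hdT, hg, fun m => ?_⟩
    have hg' := hg
    rw [tp_limit hT] at hg'
    obtain ⟨ρ, c1, c2⟩ := hg'
    obtain ⟨π, n0, -, h⟩ := cof ρ c1
    obtain ⟨s, α1, d1, d2, d3, -⟩ := h (max n0 (m + 1)) (le_max_left _ _)
    have hsT : s < T := (lt_add_one s).trans d2
    have hac : tp a T = tp a s := a_const hsT.le fun τ e1 e2 => by
      rcases e2.lt_or_eq with e | rfl
      · exact c2 τ (d1.trans e1) e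
      · exact hg
    have hαα : α1 = α := by
      refine le_antisymm (hle _ _ _ _ hsT d3) (le_of_forall_lt fun x hx => ?_)
      rw [← d3.start.a, ← hac]; exact (hα x).2 hx
    rw [← hαα]
    exact d3.g1 (by omega) (c2 s d1 hsT) m (by omega)
  have hpi : π' ≤ α := by
    by_contra hc
    have hc := not_le.1 hc
    -- π' must be the successor of α
    have hsucc : π' = α + 1 := by
      refine le_antisymm ?_ (Order.add_one_le_of_lt hc)
      by_contra hc2
      have hc2 := not_le.1 hc2
      have hlt : ω * (α + 1) + (0 : ℕ) < lam := by
        rw [hπ, Nat.cast_zero, add_zero]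
        exact mul_lt_mul_of_pos_left hc2 omega0_pos
      obtain ⟨s, d1, d2, -⟩ := hl.ev _ zero_le hlt
      obtain ⟨α1, d3⟩ := d2.get
      exact absurd (d3.pi.trans (hle _ _ _ _ d1 d3)) (not_le.2 (lt_add_one α))
    have hpass : ∀ j u, ω * α + 1 ≤ j → j < lam → u < T → It j u → tp g u 0 = true := by
      rintro j u c1 c2 c3 ⟨π, n, α1, rfl, c4⟩
      have h1 : π = α := by
        apply le_antisymm
        · rw [hπ, hsucc, Ordinal.lt_mul_iff_div_lt omega0_ne_zero, div_wn] at c2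
          exact Order.lt_add_one_iff.1 c2
        · rw [← div_wn π n, Ordinal.le_div omega0_ne_zero]
          exact le_self_add.trans c1
      subst h1
      have hn : 0 < n := by
        rw [pos_iff_ne_zero]; rintro rfl
        simp at c1
      by_contra hgf
      have := c4.g0 hn (by simpa using hgf)
      exact absurd (this.trans (hle _ _ _ _ c3 c4)) (not_le.2 (lt_add_one _))
    have hlt : ω * α + 1 < lam := by
      rw [hπ, hsucc, mul_add, mul_one]
      gcongr; exact one_lt_omega0
    obtain ⟨s, d1, -, d2⟩ := hl.ev _ zero_le hlt
    have : tp g T 0 = true := by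
      refine tp_limit_const hT ⟨s, d1, fun ρ c1 c2 => ?_⟩
      obtain ⟨j, u, u', e1, e2, e3, e4, e5, e6⟩ := d2 ρ c1 c2
      rcases e3.lt_or_eq with e | rfl
      · refine g_back e4.le (fun τ f1 f2 => e6.no τ (e.trans_le f1) f2)
          (hpass (j + 1) u' (e1.trans le_self_add) (hlam.add_one_lt e2) e5 e6.p1)
      · exact hpass j u e1 e2 c2 e6.p0
    rw [hg] at this; simp at this
  exact ⟨π', 0, α, by rw [hπ]; simp, hst, hev, by simp [hdT], hpi, fun _ => hg, fun h => absurd h (lt_irrefl _),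
    fun h => absurd h (lt_irrefl _)⟩

theorem it_zero : It 0 1 := by
  refine ⟨0, 0, 0, by simp, ⟨le_rfl, ⟨st_one, hd_one _, hd_one _, by simpa using hd_one .X⟩, ?_, ?_, ?_⟩, ?_, ?_, le_rfl, ?_, ?_, ?_⟩
  · intro tr htr; funext x
    refine tp_one tr ?_ x
    rcases htr with (rfl | rfl | rfl | rfl) | rfl <;> simp
  · funext k
    rw [digits_zero 0 (Nat.zero_le k)]
    have : ∀ i, tp (b i) 1 (k : Ordinal.{0}) = false := fun i => tp_one _ (by simp) _
    simp [txt, SF, sym, this]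
  · intro x; rw [tp_one _ (by simp)]; simp
  · intro x hx; simp at hx
  · rw [tp_one _ (by simp)]; simp
  · intro _; rw [tp_one _ (by simp)]
  · intro h; simp at h
  · intro h; simp at h

theorem exists_good : ∃ t α, Good t α := by
  by_contra hno
  push Not at hno
  set Ω : Ordinal.{0} := (Cardinal.aleph 1).ord with hΩ
  obtain ⟨T, -, hT, -, -⟩ := loop (Pre := It) (Thr := ItT) (t0 := 1) (i0 := 0) (h := ω * Ω) zero_le it_zero
    (fun i t _ _ _ h => it_step h) (fun lam T _ _ h3 _ h5 => it_limit hno h3 h5)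
  obtain ⟨α, hα⟩ : ∃ α, ItP Ω 0 α T := It.get (by simpa using hT)
  have h1 : ∀ x : Set.Iio Ω, ∃ m, firstEvent (scr m) x.1 := fun x => hα.ev _ (x.2.trans_le hα.pi)
  choose f hf using h1
  have hinj : Function.Injective f := by
    intro x y hxy
    have := hf y
    rw [← hxy] at this
    exact Subtype.ext (firstEvent_unique (hf x) this)
  have hc : Countable (Set.Iio Ω) := hinj.countable
  have h2 := Cardinal.mk_le_aleph0 (α := Set.Iio Ω)
  rw [Cardinal.mk_Iio_ordinal, hΩ, Cardinal.card_ord, Cardinal.lift_le_aleph0] at h2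
  exact absurd h2 (not_le.2 Cardinal.aleph0_lt_aleph_one)

/-! ### Conclusion -/

theorem clockable_event {α : Ordinal.{0}} (h : OTMClockable α) : ∃ m, firstEvent (scr m) α := by
  obtain ⟨P, hP⟩ := h
  exact ⟨num (compile P), by rw [scr_num]; exact compile_firstEvent hP⟩

/-- a program with halting time `1` -/
def triv : OTMProgram where
  tapes := 0
  states := 1
  trans := fun s _ => if s = 0 then some (1, fun _ => false, fun _ => false) else none

theorem triv_zero : OTMClockable 0 := by
  refine ⟨triv, ?_, ?_⟩
  · unfold OTMProgram.haltedAt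
    rw [run_succ, run_zero]
    simp [OTMProgram.stepConfig, triv, OTMProgram.initConfig]
  · intro σ hσ
    rw [zero_add, Ordinal.lt_one_iff_zero] at hσ
    subst hσ
    unfold OTMProgram.haltedAt
    rw [run_zero]
    simp [triv, OTMProgram.initConfig]

theorem main : ∃ α β γ : Ordinal.{0}, α < β ∧ β < γ ∧ OTMClockable α ∧ OTMClockable γ ∧ ¬ OTMClockable β := by
  obtain ⟨t, α, h1, h2, h3, h4⟩ := exists_good
  have hα : ¬ OTMClockable α := fun h => by
    obtain ⟨m, hm⟩ := clockable_event h
    exact h4 m hm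
  have ht : OTMClockable t := by
    refine ⟨U, ?_, fun σ hσ => ?_⟩
    · rw [halted_iff']
      have hrd : rd t d = tp d t 0 := by rw [← hK t]; rfl
      have hrg : rd t g = tp g t 0 := by rw [← hK t]; rfl
      have e1 : base .N0 (rd t) = some (.H, rd t, dir false false false) := by
        simp [base, hrd, hrg, h2, h3]
      exact (h1.at'.go e1).st
    · rw [halted_iff']
      intro hH
      have := H_abs (Order.lt_add_one_iff.1 hσ) hH
      rw [h1.at'.st] at this
      simp at this
  have hle : α ≤ t := le_of_forall_lt fun x hx => tp_lt _ _ _ ((h1.a x).2 hx)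
  refine ⟨0, α, t, ?_, lt_of_le_of_ne hle ?_, triv_zero, ht, hα⟩
  · rw [pos_iff_ne_zero]; rintro rfl; exact hα triv_zero
  · rintro rfl; exact hα ht

end GapU

/-- There are gaps in the OTM-clockable ordinals. -/
theorem otm_clockable_gaps_exist :
    ∃ α β γ : Ordinal.{0}, α < β ∧ β < γ ∧
      OTMClockable α ∧ OTMClockable γ ∧ ¬ OTMClockable β := by
  exact GapU.main

end
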